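/- For every η > 0 there exists a subset ℰ ⊆ 𝒟 of hyperbolic measure zero with the following property: for all α ∈ 𝒟 \ ℰ one has P(α, N, [0,Δ]) = (1 + o(1))·Δ as N → ∞, uniformly in the range N^{−1+η} ≤ Δ ≤ N^{−η}. Precisely: for every δ > 0 there exists N₀ (depending on α, η, δ) such that for all N ≥ N₀ and all Δ with N^{−1+η} ≤ Δ ≤ N^{−η} one has |P(α, N, [0,Δ]) − Δ| ≤ δ·Δ. -/

import Mathlib

open MeasureTheory

noncomputable section

/-- The binary quadratic form `q_α(m,n) = α₁m² + α₂mn + α₃n²`. -/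
def qf (α : ℝ × ℝ × ℝ) (m n : ℤ) : ℝ :=
  α.1 * (m : ℝ) ^ 2 + α.2.1 * (m : ℝ) * (n : ℝ) + α.2.2 * (n : ℝ) ^ 2

/-- `D(α) = π⁻¹ (4α₁α₃ - α₂²)^{1/2}`. -/
def Dfun (α : ℝ × ℝ × ℝ) : ℝ := Real.sqrt (4 * α.1 * α.2.2 - α.2.1 ^ 2) / Real.pi

/-- The index set: `m > 0`, or `m = 0` and `n ≥ 0`. -/
def idx : Set (ℤ × ℤ) := {p | 0 < p.1 ∨ (p.1 = 0 ∧ 0 ≤ p.2)}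

/-- The pair correlation counting function `P(α, N, I)`: the ordered multiset
`0 < Λ₁ ≤ Λ₂ ≤ …` of values `q_α(m,n)/D(α)` over `(m,n) ∈ idx` is in bijection with `idx`,
so pairs of distinct indices `(j,k)` correspond to pairs of distinct points of `idx`. -/
def Pcorr (α : ℝ × ℝ × ℝ) (N : ℝ) (I : Set ℝ) : ℝ :=
  (1 / N) * Nat.card {pq : (ℤ × ℤ) × (ℤ × ℤ) //
    pq.1 ∈ idx ∧ pq.2 ∈ idx ∧ pq.1 ≠ pq.2 ∧
    qf α pq.1.1 pq.1.2 / Dfun α ≤ N ∧ qf α pq.2.1 pq.2.2 / Dfun α ≤ N ∧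
    (qf α pq.1.1 pq.1.2 - qf α pq.2.1 pq.2.2) / Dfun α ∈ I}

/-- The set of reduced forms `𝒟 = {0 ≤ α₂ ≤ α₁ ≤ α₃}`. -/
def Dset : Set (ℝ × ℝ × ℝ) := {α | 0 ≤ α.2.1 ∧ α.2.1 ≤ α.1 ∧ α.1 ≤ α.2.2}

/-- The hyperbolic measure `dα₁dα₂dα₃ / (4α₁α₃ - α₂²)^{3/2}`. -/
def hypMeasure : Measure (ℝ × ℝ × ℝ) :=
  volume.withDensity fun α => ENNReal.ofReal ((4 * α.1 * α.2.2 - α.2.1 ^ 2) ^ (-(3 : ℝ) / 2))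

end

/-- The sup norm of an integer vector. -/
def vn (w : ℤ × ℤ) : ℕ := max w.1.natAbs w.2.natAbs

/-- The determinant of two integer vectors. -/
def dt (w z : ℤ × ℤ) : ℤ := w.1 * z.2 - w.2 * z.1

/-- The nonzero integer vectors of sup norm at most `n`. -/
noncomputable def box (n : ℕ) : Finset (ℤ × ℤ) :=
  ((Finset.Icc (-n : ℤ) n) ×ˢ (Finset.Icc (-n : ℤ) n)).filter (· ≠ 0)

theorem mem_box {n : ℕ} {w : ℤ × ℤ} : w ∈ box n ↔ w ≠ 0 ∧ vn w ≤ n := by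
  simp only [box, vn, Finset.mem_filter, Finset.mem_product, Finset.mem_Icc, max_le_iff]
  constructor
  · rintro ⟨⟨⟨h1, h2⟩, h3, h4⟩, h5⟩
    exact ⟨h5, by omega, by omega⟩
  · rintro ⟨h5, h1, h2⟩
    exact ⟨⟨⟨by omega, by omega⟩, by omega, by omega⟩, h5⟩

theorem vn_pos {w : ℤ × ℤ} (h : w ≠ 0) : 1 ≤ vn w := by
  by_contra hc
  apply h
  simp only [vn, not_le, Nat.lt_one_iff] at hc
  have h1 : w.1.natAbs = 0 := by omega
  have h2 : w.2.natAbs = 0 := by omega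
  ext <;> simp_all

theorem card_le_of_congr (S : Finset ℤ) (n q : ℕ) (hq : 0 < q)
    (hS : S ⊆ Finset.Icc (-n : ℤ) n) (hc : ∀ s ∈ S, ∀ t ∈ S, (q : ℤ) ∣ s - t) :
    S.card ≤ 2 * n / q + 1 := by
  rcases S.eq_empty_or_nonempty with rfl | hne
  · simp
  set m := S.min' hne with hm
  have hmS : m ∈ S := S.min'_mem hne
  have hle : ∀ s ∈ S, m ≤ s := fun s hs => S.min'_le s hs
  have : S.card ≤ (Finset.range (2 * n / q + 1)).card := by
    apply Finset.card_le_card_of_injOn (fun s => ((s - m) / q).toNat)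
    · intro s hs
      have hs' : s ∈ S := hs
      simp only [Finset.coe_range, Set.mem_Iio]
      have h1 := Finset.mem_Icc.1 (hS hs')
      have h2 := Finset.mem_Icc.1 (hS hmS)
      have h3 := hle s hs'
      have h4 : (s - m) / q ≤ (2 * n : ℤ) / q := Int.ediv_le_ediv (by exact_mod_cast hq) (by omega)
      have h5 : ((2 * n / q : ℕ) : ℤ) = (2 * n : ℤ) / q := by push_cast; rfl
      have h6 : 0 ≤ (s - m) / (q : ℤ) := Int.ediv_nonneg (by omega) (by omega)
      change ((s - m) / (q : ℤ)).toNat < 2 * n / q + 1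
      rw [← h5] at h4
      generalize (s - m) / (q : ℤ) = A at *
      generalize 2 * n / q = B at *
      omega
    · intro s hs t ht hst
      have h1 := hle s hs
      have h2 := hle t ht
      obtain ⟨x, hx⟩ := hc s hs m hmS
      obtain ⟨y, hy⟩ := hc t ht m hmS
      have hq' : (q : ℤ) ≠ 0 := by exact_mod_cast hq.ne'
      have hq'' : (0 : ℤ) < q := by exact_mod_cast hq
      simp only [hx, hy, Int.mul_ediv_cancel_left _ hq'] at hst
      have hx0 : 0 ≤ x := by
        by_contra hneg
        push Not at hneg
        nlinarith
      have hy0 : 0 ≤ y := by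
        by_contra hneg
        push Not at hneg
        nlinarith
      have : x = y := by omega
      subst this
      omega
  simpa using this

theorem card_line_aux (z : ℤ × ℤ) (hg : IsCoprime z.1 z.2) (hz : z.1 ≠ 0) (n : ℕ) (h : ℤ) :
    ((box n).filter (fun w => dt z w = h)).card ≤ 2 * n / z.1.natAbs + 1 := by
  have hinj : Set.InjOn (Prod.fst : ℤ × ℤ → ℤ) ((box n).filter (fun w => dt z w = h)) := by
    intro w hw w' hw' he
    replace hw := Finset.mem_filter.1 (Finset.mem_coe.1 hw)
    replace hw' := Finset.mem_filter.1 (Finset.mem_coe.1 hw')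
    simp only [dt] at hw hw'
    have h2 : z.1 * w.2 = z.1 * w'.2 := by
      have := hw.2; have := hw'.2
      rw [he] at *
      linarith
    exact Prod.ext he (mul_left_cancel₀ hz h2)
  rw [← Finset.card_image_of_injOn hinj]
  apply card_le_of_congr
  · omega
  · intro s hs
    simp only [Finset.mem_image, Finset.mem_filter, mem_box, vn, max_le_iff] at hs
    obtain ⟨w, ⟨⟨_, h1, h2⟩, _⟩, rfl⟩ := hs
    simp only [Finset.mem_Icc]
    omega
  · intro s hs t ht
    simp only [Finset.mem_image, Finset.mem_filter] at hs ht
    simp only [dt] at hs ht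
    obtain ⟨w, ⟨_, hw⟩, rfl⟩ := hs
    obtain ⟨w', ⟨_, hw'⟩, rfl⟩ := ht
    rw [Int.natAbs_dvd]
    apply hg.dvd_of_dvd_mul_left
    exact ⟨w.2 - w'.2, by linarith⟩

theorem card_line (z : ℤ × ℤ) (hg : IsCoprime z.1 z.2) (n : ℕ) (h : ℤ) :
    ((box n).filter (fun w => dt z w = h)).card ≤ 2 * n / vn z + 1 := by
  have hz : z ≠ 0 := by
    rintro rfl
    exact not_isCoprime_zero_zero hg
  rcases le_total z.2.natAbs z.1.natAbs with hle | hle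
  · have hv : vn z = z.1.natAbs := max_eq_left hle
    have h1 := vn_pos hz
    rw [hv]
    exact card_line_aux z hg (by omega) n h
  · have hv : vn z = z.2.natAbs := max_eq_right hle
    have h1 := vn_pos hz
    rw [hv]
    refine le_trans ?_ (card_line_aux z.swap hg.symm (by simp; omega) n (-h))
    apply Finset.card_le_card_of_injOn Prod.swap
    · intro w hw
      replace hw := Finset.mem_filter.1 (Finset.mem_coe.1 hw)
      refine Finset.mem_coe.2 (Finset.mem_filter.2 ?_)
      simp only [mem_box, vn, dt] at hw ⊢
      refine ⟨⟨?_, ?_⟩, ?_⟩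
      · intro h0
        apply hw.1.1
        rw [← Prod.swap_swap w, h0]; rfl
      · simpa [max_comm] using hw.1.2
      · simp only [Prod.fst_swap, Prod.snd_swap]; linarith [hw.2]
    · exact fun _ _ _ _ => fun he => Prod.swap_injective he

/-- Partial sums of the harmonic series. -/
noncomputable def hs (N : ℕ) : ℝ := ∑ k ∈ Finset.Icc 1 N, (1 : ℝ) / k

theorem hs_nonneg (N : ℕ) : 0 ≤ hs N := Finset.sum_nonneg fun _ _ => by positivity

theorem hs_mono {M N : ℕ} (h : M ≤ N) : hs M ≤ hs N :=
  Finset.sum_le_sum_of_subset_of_nonneg (Finset.Icc_subset_Icc le_rfl h)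
    fun _ _ _ => by positivity

theorem one_le_hs {N : ℕ} (h : 1 ≤ N) : 1 ≤ hs N := by
  have := hs_mono h
  simpa [hs] using this

theorem sum_recip_max (g H : ℕ) (hg : 1 ≤ g) :
    ∑ h ∈ Finset.Icc (-H : ℤ) H, 1 / max 1 (|(g : ℝ) * h|) ≤ 1 + 2 / g * hs H := by
  have hg' : (0 : ℝ) < g := by exact_mod_cast hg
  have hsplit : Finset.Icc (-H : ℤ) H ⊆
      insert 0 ((Finset.Icc 1 H).image (fun k : ℕ => (k : ℤ)) ∪
        (Finset.Icc 1 H).image (fun k : ℕ => -(k : ℤ))) := by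
    intro h hh
    simp only [Finset.mem_Icc, Finset.mem_insert, Finset.mem_union, Finset.mem_image] at hh ⊢
    rcases lt_trichotomy h 0 with h0 | h0 | h0
    · right; right; exact ⟨h.natAbs, by omega, by omega⟩
    · left; exact h0
    · right; left; exact ⟨h.natAbs, by omega, by omega⟩
  have hnn : ∀ h : ℤ, 0 ≤ 1 / max 1 (|(g : ℝ) * h|) := fun h => by positivity
  have hone : ∀ k ∈ Finset.Icc 1 H, 1 / max 1 (|(g : ℝ) * ((k : ℤ) : ℝ)|) ≤ 1 / g * (1 / k) := by
    intro k hk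
    have hk1 : (1 : ℝ) ≤ k := by exact_mod_cast (Finset.mem_Icc.1 hk).1
    rw [one_div_mul_one_div]
    apply one_div_le_one_div_of_le (by positivity)
    refine le_trans ?_ (le_max_right _ _)
    simp
  refine (Finset.sum_le_sum_of_subset_of_nonneg hsplit fun _ _ _ => hnn _).trans ?_
  rw [Finset.sum_insert (by simp)]
  have hu : ∑ h ∈ ((Finset.Icc 1 H).image (fun k : ℕ => (k : ℤ)) ∪
        (Finset.Icc 1 H).image (fun k : ℕ => -(k : ℤ))), 1 / max 1 (|(g : ℝ) * h|) ≤
      1 / g * hs H + 1 / g * hs H := by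
    refine (Finset.sum_le_sum_of_subset_of_nonneg (Finset.Subset.refl _) fun _ _ _ => hnn _).trans ?_
    have := Finset.sum_union_inter (s₁ := (Finset.Icc 1 H).image (fun k : ℕ => (k : ℤ)))
      (s₂ := (Finset.Icc 1 H).image (fun k : ℕ => -(k : ℤ)))
      (f := fun h : ℤ => 1 / max 1 (|(g : ℝ) * h|))
    have h3 : 0 ≤ ∑ h ∈ ((Finset.Icc 1 H).image (fun k : ℕ => (k : ℤ)) ∩
        (Finset.Icc 1 H).image (fun k : ℕ => -(k : ℤ))), 1 / max 1 (|(g : ℝ) * h|) :=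
      Finset.sum_nonneg fun _ _ => hnn _
    have h1 : ∑ h ∈ (Finset.Icc 1 H).image (fun k : ℕ => (k : ℤ)), 1 / max 1 (|(g : ℝ) * h|)
        ≤ 1 / g * hs H := by
      rw [Finset.sum_image (by intro a _ b _ h; simpa using h), hs, Finset.mul_sum]
      exact Finset.sum_le_sum hone
    have h2 : ∑ h ∈ (Finset.Icc 1 H).image (fun k : ℕ => -(k : ℤ)), 1 / max 1 (|(g : ℝ) * h|)
        ≤ 1 / g * hs H := by
      rw [Finset.sum_image (by intro a _ b _ h; simpa using h), hs, Finset.mul_sum]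
      refine Finset.sum_le_sum fun k hk => ?_
      have := hone k hk
      simpa using this
    linarith
  have : (2 : ℝ) / g * hs H = 1 / g * hs H + 1 / g * hs H := by ring
  simp only [Int.cast_zero, mul_zero, abs_zero]
  rw [this]
  norm_num
  norm_num at hu
  exact hu

theorem exists_primitive {z : ℤ × ℤ} (hz : z ≠ 0) : ∃ z0 : ℤ × ℤ, IsCoprime z0.1 z0.2 ∧
    z.1 = (Int.gcd z.1 z.2 : ℤ) * z0.1 ∧ z.2 = (Int.gcd z.1 z.2 : ℤ) * z0.2 ∧
    1 ≤ Int.gcd z.1 z.2 ∧ vn z = Int.gcd z.1 z.2 * vn z0 := by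
  have hg : 0 < Int.gcd z.1 z.2 := by
    apply Int.gcd_pos_iff.2
    by_contra h
    push Not at h
    exact hz (Prod.ext h.1 h.2)
  obtain ⟨x, y, h1, h2, h3⟩ := Int.exists_gcd_one hg
  refine ⟨(x, y), Int.isCoprime_iff_gcd_eq_one.2 h1, by rw [mul_comm]; exact h2,
    by rw [mul_comm]; exact h3, hg, ?_⟩
  have e1 : z.1.natAbs = Int.gcd z.1 z.2 * x.natAbs := by
    conv_lhs => rw [h2]
    rw [Int.natAbs_mul, mul_comm]; simp
  have e2 : z.2.natAbs = Int.gcd z.1 z.2 * y.natAbs := by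
    conv_lhs => rw [h3]
    rw [Int.natAbs_mul, mul_comm]; simp
  simp only [vn]
  rw [e1, e2, Nat.mul_max_mul_left]

theorem natAbs_dt_le (w z : ℤ × ℤ) : (dt w z).natAbs ≤ 2 * (vn w * vn z) := by
  have h1 : w.1.natAbs * z.2.natAbs ≤ vn w * vn z :=
    Nat.mul_le_mul (le_max_left _ _) (le_max_right _ _)
  have h2 : w.2.natAbs * z.1.natAbs ≤ vn w * vn z :=
    Nat.mul_le_mul (le_max_right _ _) (le_max_left _ _)
  have h3 := Int.natAbs_sub_le (w.1 * z.2) (w.2 * z.1)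
  rw [Int.natAbs_mul, Int.natAbs_mul] at h3
  unfold dt
  omega

theorem sum_recip_dt {R n : ℕ} {z : ℤ × ℤ} (hz : z ≠ 0) (hzn : vn z ≤ n) (hn : n ≤ R) :
    ∑ w ∈ box n, 1 / max 1 |(dt z w : ℝ)| ≤
      3 * n / vn z * (Int.gcd z.1 z.2 + 2 * hs (2 * R * R)) := by
  obtain ⟨z0, hc, h1, h2, hg, hv⟩ := exists_primitive hz
  set g := Int.gcd z.1 z.2 with hgdef
  have hvp : 1 ≤ vn z := vn_pos hz
  have hv0 : 1 ≤ vn z0 := by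
    rcases Nat.eq_zero_or_pos (vn z0) with h | h
    · rw [h] at hv; omega
    · exact h
  have hdt : ∀ w, dt z w = g * dt z0 w := by
    intro w
    simp only [dt]
    rw [mul_sub, ← mul_assoc, ← mul_assoc, ← h1, ← h2]
  have hv0z : vn z0 ≤ vn z := by rw [hv]; exact Nat.le_mul_of_pos_left _ hg
  have hmaps : ∀ w ∈ box n, dt z0 w ∈ Finset.Icc (-(2 * R * R : ℕ) : ℤ) (2 * R * R : ℕ) := by
    intro w hw
    have := natAbs_dt_le z0 w
    have hw' := (mem_box.1 hw).2
    have : vn z0 * vn w ≤ R * R := Nat.mul_le_mul (by omega) (by omega)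
    rw [Finset.mem_Icc]
    have e : 2 * R * R = 2 * (R * R) := by ring
    rw [e]
    omega
  rw [← Finset.sum_fiberwise_of_maps_to hmaps]
  have hfib : ∀ h ∈ Finset.Icc (-(2 * R * R : ℕ) : ℤ) (2 * R * R : ℕ),
      ∑ w ∈ (box n).filter (fun w => dt z0 w = h), 1 / max 1 |(dt z w : ℝ)| ≤
        (3 * n / vn z0) * (1 / max 1 |(g : ℝ) * h|) := by
    intro h _
    have : ∀ w ∈ (box n).filter (fun w => dt z0 w = h), 1 / max 1 |(dt z w : ℝ)| =
        1 / max 1 |(g : ℝ) * h| := by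
      intro w hw
      have := (Finset.mem_filter.1 hw).2
      rw [hdt w, this]; push_cast; rfl
    rw [Finset.sum_congr rfl this, Finset.sum_const, nsmul_eq_mul]
    apply mul_le_mul_of_nonneg_right _ (by positivity)
    have hcard := card_line z0 hc n h
    have hp : (0 : ℝ) < vn z0 := by exact_mod_cast hv0
    calc (((box n).filter (fun w => dt z0 w = h)).card : ℝ) ≤ ((2 * n / vn z0 + 1 : ℕ) : ℝ) := by
          exact_mod_cast hcard
      _ ≤ 2 * n / vn z0 + 1 := by
          push_cast
          have := @Nat.cast_div_le ℝ _ _ _ (2 * n) (vn z0)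
          push_cast at this
          linarith
      _ ≤ 3 * n / vn z0 := by
          rw [div_add_one hp.ne']
          apply div_le_div_of_nonneg_right _ hp.le
          have : (vn z0 : ℝ) ≤ n := by exact_mod_cast hv0z.trans hzn
          linarith
  refine (Finset.sum_le_sum hfib).trans ?_
  rw [← Finset.mul_sum]
  have hg' : (0 : ℝ) < g := by exact_mod_cast hg
  have hp : (0 : ℝ) < vn z0 := by exact_mod_cast hv0
  refine (mul_le_mul_of_nonneg_left (sum_recip_max g (2 * R * R) hg) (by positivity)).trans ?_
  apply le_of_eq
  rw [hv]
  push_cast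
  field_simp

theorem abs_dt_comm (w z : ℤ × ℤ) : |(dt w z : ℝ)| = |(dt z w : ℝ)| := by
  have : dt w z = -dt z w := by simp only [dt]; ring
  rw [this]; push_cast; rw [abs_neg]

theorem card_vn_eq (R k : ℕ) (hk : 1 ≤ k) : ((box R).filter (fun z => vn z = k)).card ≤ 12 * k := by
  have hsub : (box R).filter (fun z => vn z = k) ⊆
      (({(k : ℤ), -(k : ℤ)} : Finset ℤ) ×ˢ Finset.Icc (-k : ℤ) k) ∪
      (Finset.Icc (-k : ℤ) k ×ˢ ({(k : ℤ), -(k : ℤ)} : Finset ℤ)) := by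
    intro z hz
    have h := (Finset.mem_filter.1 hz).2
    simp only [vn] at h
    simp only [Finset.mem_union, Finset.mem_product, Finset.mem_insert, Finset.mem_singleton,
      Finset.mem_Icc]
    omega
  refine (Finset.card_le_card hsub).trans ((Finset.card_union_le _ _).trans ?_)
  rw [Finset.card_product, Finset.card_product]
  have h2 : ({(k : ℤ), -(k : ℤ)} : Finset ℤ).card ≤ 2 := Finset.card_le_two
  have h3 : (Finset.Icc (-k : ℤ) k).card = 2 * k + 1 := by rw [Int.card_Icc]; omega
  rw [h3]
  nlinarith

theorem sum_box_radial (R : ℕ) (f : ℕ → ℝ) (hf : ∀ k, 0 ≤ f k) :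
    ∑ z ∈ box R, f (vn z) ≤ 12 * ∑ k ∈ Finset.Icc 1 R, k * f k := by
  have hmaps : ∀ z ∈ box R, vn z ∈ Finset.Icc 1 R := fun z hz =>
    Finset.mem_Icc.2 ⟨vn_pos (mem_box.1 hz).1, (mem_box.1 hz).2⟩
  rw [← Finset.sum_fiberwise_of_maps_to hmaps, Finset.mul_sum]
  refine Finset.sum_le_sum fun k hk => ?_
  have : ∀ z ∈ (box R).filter (fun z => vn z = k), f (vn z) = f k := fun z hz => by
    rw [(Finset.mem_filter.1 hz).2]
  rw [Finset.sum_congr rfl this, Finset.sum_const, nsmul_eq_mul, ← mul_assoc]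
  apply mul_le_mul_of_nonneg_right _ (hf k)
  exact_mod_cast card_vn_eq R k (Finset.mem_Icc.1 hk).1

theorem sum_box_inv_sq (R : ℕ) : ∑ z ∈ box R, 1 / (vn z : ℝ) ^ 2 ≤ 12 * hs R := by
  refine (sum_box_radial R (fun k => 1 / (k : ℝ) ^ 2) fun k => by positivity).trans ?_
  apply mul_le_mul_of_nonneg_left _ (by norm_num)
  apply le_of_eq
  refine Finset.sum_congr rfl fun k hk => ?_
  have : (k : ℝ) ≠ 0 := by
    have := (Finset.mem_Icc.1 hk).1
    positivity
  field_simp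

theorem sum_box_inv (R : ℕ) : ∑ z ∈ box R, 1 / (vn z : ℝ) ≤ 12 * R := by
  refine (sum_box_radial R (fun k => 1 / (k : ℝ)) fun k => by positivity).trans ?_
  apply mul_le_mul_of_nonneg_left _ (by norm_num)
  have : ∀ k ∈ Finset.Icc 1 R, (k : ℝ) * (1 / k) = 1 := fun k hk => by
    have : (k : ℝ) ≠ 0 := by
      have := (Finset.mem_Icc.1 hk).1
      positivity
    field_simp
  rw [Finset.sum_congr rfl this]
  simp

theorem sum_box_gcd (R : ℕ) :
    ∑ z ∈ box R, (Int.gcd z.1 z.2 : ℝ) / (vn z : ℝ) ^ 2 ≤ 12 * hs R ^ 2 := by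
  classical
  have hex := fun (z : ℤ × ℤ) (hz : z ≠ 0) => exists_primitive hz
  choose! p hp1 hp2 hp3 hp4 hp5 using hex
  have hle : ∀ z ∈ box R, (Int.gcd z.1 z.2 : ℝ) / (vn z : ℝ) ^ 2 =
      (fun t : ℕ × (ℤ × ℤ) => 1 / (t.1 : ℝ) * (1 / (vn t.2 : ℝ) ^ 2)) (Int.gcd z.1 z.2, p z) := by
    intro z hz
    have hz0 := (mem_box.1 hz).1
    have h4 := hp4 _ hz0
    have hv := vn_pos hz0
    rw [hp5 _ hz0] at hv ⊢
    have h0 : (Int.gcd z.1 z.2 : ℝ) ≠ 0 := by positivity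
    have h1 : (vn (p z) : ℝ) ≠ 0 := by
      intro h
      have : vn (p z) = 0 := by exact_mod_cast h
      rw [this] at hv; omega
    push_cast
    field_simp
  rw [Finset.sum_congr rfl hle]
  have hinj : Set.InjOn (fun z => (Int.gcd z.1 z.2, p z)) (box R : Set (ℤ × ℤ)) := by
    intro z hz z' hz' he
    have hz0 := (mem_box.1 (Finset.mem_coe.1 hz)).1
    have hz0' := (mem_box.1 (Finset.mem_coe.1 hz')).1
    simp only [Prod.mk.injEq] at he
    have a1 := hp2 _ hz0
    have a2 := hp3 _ hz0
    rw [he.1, he.2, ← hp2 _ hz0'] at a1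
    rw [he.1, he.2, ← hp3 _ hz0'] at a2
    exact Prod.ext a1 a2
  rw [← Finset.sum_image (f := fun t : ℕ × (ℤ × ℤ) => 1 / (t.1 : ℝ) * (1 / (vn t.2 : ℝ) ^ 2)) hinj]
  have hsub : (box R).image (fun z => (Int.gcd z.1 z.2, p z)) ⊆ Finset.Icc 1 R ×ˢ box R := by
    intro t ht
    obtain ⟨z, hz, rfl⟩ := Finset.mem_image.1 ht
    have hz0 := (mem_box.1 hz).1
    have hzR := (mem_box.1 hz).2
    have h4 := hp4 _ hz0
    have hv := vn_pos hz0
    have h5 := hp5 _ hz0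
    have hv0 : 1 ≤ vn (p z) := by
      rcases Nat.eq_zero_or_pos (vn (p z)) with h | h
      · rw [h] at h5; omega
      · exact h
    rw [Finset.mem_product, Finset.mem_Icc, mem_box]
    refine ⟨⟨h4, ?_⟩, ?_, ?_⟩
    · exact (Nat.le_mul_of_pos_right _ hv0).trans (h5 ▸ hzR)
    · intro h
      change p z = 0 at h
      rw [h] at hv0
      simp [vn] at hv0
    · exact (Nat.le_mul_of_pos_left _ h4).trans (h5 ▸ hzR)
  refine (Finset.sum_le_sum_of_subset_of_nonneg hsub fun _ _ _ => by positivity).trans ?_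
  rw [Finset.sum_product]
  simp only [← Finset.mul_sum]
  rw [← Finset.sum_mul]
  have := mul_le_mul_of_nonneg_left (sum_box_inv_sq R) (hs_nonneg R)
  change hs R * _ ≤ _
  linarith

theorem one_div_eq_telescope {k R : ℕ} (hk : 1 ≤ k) (hkR : k ≤ R) :
    1 / (k : ℝ) = 1 / (R + 1) + ∑ n ∈ Finset.Icc k R, 1 / ((n : ℝ) * (n + 1)) := by
  induction R, hkR using Nat.le_induction with
  | base =>
    simp only [Finset.Icc_self, Finset.sum_singleton]
    field_simp
  | succ R hR ih =>
    rw [Finset.sum_Icc_succ_top (by omega), ih]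
    push_cast
    field_simp
    ring

theorem sum_recip_dt_weighted {R : ℕ} {z : ℤ × ℤ} (hz : z ∈ box R) :
    ∑ w ∈ (box R).filter (fun w => vn z ≤ vn w), 1 / (vn w : ℝ) * (1 / max 1 |(dt z w : ℝ)|) ≤
      6 * hs (2 * R * R) * ((Int.gcd z.1 z.2 + 2 * hs (2 * R * R)) / vn z) := by
  obtain ⟨hz0, hzR⟩ := mem_box.1 hz
  have hv := vn_pos hz0
  set L := hs (2 * R * R) with hL
  set A : ℝ := Int.gcd z.1 z.2 + 2 * L with hA
  have hL0 : 0 ≤ L := hs_nonneg _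
  have hL1 : 1 ≤ L := one_le_hs (by nlinarith)
  have hLR : hs R ≤ L := hs_mono (by nlinarith)
  have hA0 : 0 ≤ A := by positivity
  have hvp : (0 : ℝ) < vn z := by exact_mod_cast hv
  set F : ℕ → ℝ := fun n => ∑ w ∈ box n, 1 / max 1 |(dt z w : ℝ)| with hF
  have hFb : ∀ n, vn z ≤ n → n ≤ R → F n ≤ 3 * n / vn z * A := fun n h1 h2 =>
    sum_recip_dt hz0 h1 h2
  have hf0 : ∀ w, 0 ≤ 1 / max 1 |(dt z w : ℝ)| := fun w => by positivity
  have step1 : ∑ w ∈ (box R).filter (fun w => vn z ≤ vn w),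
      1 / (vn w : ℝ) * (1 / max 1 |(dt z w : ℝ)|) ≤
      1 / (R + 1) * F R + ∑ n ∈ Finset.Icc (vn z) R, 1 / ((n : ℝ) * (n + 1)) * F n := by
    have e1 : ∀ w ∈ (box R).filter (fun w => vn z ≤ vn w),
        1 / (vn w : ℝ) * (1 / max 1 |(dt z w : ℝ)|) =
        1 / (R + 1) * (1 / max 1 |(dt z w : ℝ)|) + ∑ n ∈ Finset.Icc (vn z) R,
          if vn w ≤ n then 1 / ((n : ℝ) * (n + 1)) * (1 / max 1 |(dt z w : ℝ)|) else 0 := by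
      intro w hw
      obtain ⟨hw1, hw2⟩ := Finset.mem_filter.1 hw
      obtain ⟨hw3, hw4⟩ := mem_box.1 hw1
      rw [one_div_eq_telescope (vn_pos hw3) hw4, add_mul, Finset.sum_mul, ← Finset.sum_filter]
      congr 2
      ext n
      simp only [Finset.mem_Icc, Finset.mem_filter]
      omega
    rw [Finset.sum_congr rfl e1, Finset.sum_add_distrib, Finset.sum_comm, ← Finset.mul_sum]
    apply add_le_add
    · apply mul_le_mul_of_nonneg_left _ (by positivity)
      exact Finset.sum_le_sum_of_subset_of_nonneg (Finset.filter_subset _ _) fun _ _ _ => hf0 _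
    · refine Finset.sum_le_sum fun n hn => ?_
      rw [← Finset.sum_filter, ← Finset.mul_sum]
      apply mul_le_mul_of_nonneg_left _ (by positivity)
      apply Finset.sum_le_sum_of_subset_of_nonneg _ fun _ _ _ => hf0 _
      intro w hw
      simp only [Finset.mem_filter, mem_box] at hw ⊢
      exact ⟨hw.1.1.1, hw.2⟩
  refine step1.trans ?_
  have b1 : 1 / ((R : ℝ) + 1) * F R ≤ 3 * (A / vn z) := by
    calc 1 / ((R : ℝ) + 1) * F R ≤ 1 / ((R : ℝ) + 1) * (3 * R / vn z * A) :=
          mul_le_mul_of_nonneg_left (hFb R hzR le_rfl) (by positivity)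
      _ = R / (R + 1) * (3 * (A / vn z)) := by field_simp
      _ ≤ 1 * (3 * (A / vn z)) := by
          apply mul_le_mul_of_nonneg_right _ (by positivity)
          rw [div_le_one (by positivity)]; linarith
      _ = _ := one_mul _
  have b2 : ∑ n ∈ Finset.Icc (vn z) R, 1 / ((n : ℝ) * (n + 1)) * F n ≤ hs R * (3 * (A / vn z)) := by
    rw [hs, Finset.sum_mul]
    refine (Finset.sum_le_sum (g := fun n : ℕ => 1 / (n : ℝ) * (3 * (A / vn z))) ?_).trans
      (Finset.sum_le_sum_of_subset_of_nonneg (Finset.Icc_subset_Icc hv le_rfl)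
        fun _ _ _ => by positivity)
    intro n hn
    obtain ⟨h1, h2⟩ := Finset.mem_Icc.1 hn
    have hn0 : (0 : ℝ) < n := by exact_mod_cast (hv.trans h1)
    calc 1 / ((n : ℝ) * (n + 1)) * F n ≤ 1 / ((n : ℝ) * (n + 1)) * (3 * n / vn z * A) :=
          mul_le_mul_of_nonneg_left (hFb n h1 h2) (by positivity)
      _ = 1 / (n + 1) * (3 * (A / vn z)) := by field_simp
      _ ≤ 1 / (n : ℝ) * (3 * (A / vn z)) := by
          apply mul_le_mul_of_nonneg_right _ (by positivity)
          apply one_div_le_one_div_of_le hn0; linarith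
  have hq : 0 ≤ A / vn z := by positivity
  nlinarith

theorem sum_sum_recip (R : ℕ) :
    ∑ z ∈ box R, ∑ w ∈ box R, 1 / ((vn z : ℝ) * vn w * max 1 |(dt z w : ℝ)|) ≤
      432 * hs (2 * R * R) ^ 3 := by
  rcases Nat.eq_zero_or_pos R with rfl | hR
  · have : box 0 = ∅ := by
      ext w
      simp only [mem_box, Finset.notMem_empty, iff_false, not_and]
      intro h h2
      have := vn_pos h
      omega
    rw [this]
    simp [hs]
  set L := hs (2 * R * R) with hL
  have hL0 : 0 ≤ L := hs_nonneg _
  have hL1 : 1 ≤ L := one_le_hs (by nlinarith)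
  have hLR : hs R ≤ L := hs_mono (by nlinarith)
  set f : (ℤ × ℤ) → (ℤ × ℤ) → ℝ :=
    fun z w => 1 / ((vn z : ℝ) * vn w * max 1 |(dt z w : ℝ)|) with hf
  have hf0 : ∀ z w, 0 ≤ f z w := fun z w => by simp only [hf]; positivity
  have hsym : ∀ z w, f z w = f w z := fun z w => by
    simp only [hf]; rw [abs_dt_comm z w, mul_comm (vn z : ℝ)]
  have hsplit : ∀ z w, f z w ≤ (if vn z ≤ vn w then f z w else 0) +
      (if vn w ≤ vn z then f w z else 0) := by
    intro z w
    rcases le_total (vn z) (vn w) with h | h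
    · rw [if_pos h]
      have : 0 ≤ (if vn w ≤ vn z then f w z else 0) := by split_ifs; exacts [hf0 _ _, le_rfl]
      linarith
    · rw [if_pos h, hsym z w]
      have : 0 ≤ (if vn z ≤ vn w then f w z else 0) := by split_ifs; exacts [hf0 _ _, le_rfl]
      linarith
  have hhalf : ∑ z ∈ box R, ∑ w ∈ box R, (if vn z ≤ vn w then f z w else 0) ≤ 216 * L ^ 3 := by
    have h1 : ∀ z ∈ box R, ∑ w ∈ box R, (if vn z ≤ vn w then f z w else 0) ≤
        6 * L * (Int.gcd z.1 z.2 / (vn z : ℝ) ^ 2 + 2 * L * (1 / (vn z : ℝ) ^ 2)) := by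
      intro z hz
      have hv := vn_pos (mem_box.1 hz).1
      have hvp : (0 : ℝ) < vn z := by exact_mod_cast hv
      rw [← Finset.sum_filter]
      have e : ∀ w, f z w = 1 / (vn z : ℝ) * (1 / (vn w : ℝ) * (1 / max 1 |(dt z w : ℝ)|)) := by
        intro w; simp only [hf]; rw [one_div_mul_one_div, one_div_mul_one_div, mul_assoc]
      simp only [e]
      rw [← Finset.mul_sum]
      refine (mul_le_mul_of_nonneg_left (sum_recip_dt_weighted hz) (by positivity)).trans ?_
      apply le_of_eq
      field_simp
      ring
    refine (Finset.sum_le_sum h1).trans ?_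
    rw [← Finset.mul_sum, Finset.sum_add_distrib, ← Finset.mul_sum]
    have g1 := sum_box_gcd R
    have g2 := sum_box_inv_sq R
    have g3 : hs R ^ 2 ≤ L ^ 2 := pow_le_pow_left₀ (hs_nonneg R) hLR 2
    have g4 : 2 * L * ∑ z ∈ box R, 1 / (vn z : ℝ) ^ 2 ≤ 2 * L * (12 * L) :=
      mul_le_mul_of_nonneg_left (by linarith) (by positivity)
    calc 6 * L * _ ≤ 6 * L * (36 * L ^ 2) := by
          apply mul_le_mul_of_nonneg_left _ (by positivity); nlinarith
      _ = 216 * L ^ 3 := by ring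
  calc ∑ z ∈ box R, ∑ w ∈ box R, f z w ≤ ∑ z ∈ box R, ∑ w ∈ box R,
        ((if vn z ≤ vn w then f z w else 0) + (if vn w ≤ vn z then f w z else 0)) :=
        Finset.sum_le_sum fun z _ => Finset.sum_le_sum fun w _ => hsplit z w
    _ = ∑ z ∈ box R, ∑ w ∈ box R, (if vn z ≤ vn w then f z w else 0) +
        ∑ z ∈ box R, ∑ w ∈ box R, (if vn w ≤ vn z then f w z else 0) := by
        simp only [Finset.sum_add_distrib]
    _ = ∑ z ∈ box R, ∑ w ∈ box R, (if vn z ≤ vn w then f z w else 0) +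
        ∑ z ∈ box R, ∑ w ∈ box R, (if vn z ≤ vn w then f z w else 0) := by
        congr 1; rw [Finset.sum_comm]
    _ ≤ 432 * L ^ 3 := by linarith

/-- The harmonic sums grow slower than any power. -/
theorem hs_le_rpow {ε : ℝ} (hε : 0 < ε) (n : ℕ) (hn : 1 ≤ n) :
    hs n ≤ (1 + 1 / ε) * (n : ℝ) ^ ε := by
  have h1 : hs n ≤ 1 + Real.log n := by
    have := harmonic_le_one_add_log n
    have e : (harmonic n : ℝ) = hs n := by
      rw [harmonic_eq_sum_Icc, hs]; push_cast; simp
    rwa [e] at this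
  have hn1 : (1 : ℝ) ≤ n := by exact_mod_cast hn
  have h2 : (1 : ℝ) ≤ (n : ℝ) ^ ε := Real.one_le_rpow hn1 hε.le
  have h3 := Real.log_le_rpow_div (by linarith : (0 : ℝ) ≤ n) hε
  rw [add_mul, one_mul, one_div_mul_eq_div]
  linarith

/-- The binary quadratic form `m² + b m n + c n²` with real arguments. -/
def Qr (β p : ℝ × ℝ) : ℝ := p.1 ^ 2 + β.1 * p.1 * p.2 + β.2 * p.2 ^ 2

/-- The symmetric bilinear form attached to `Qr`. -/
noncomputable def Br (β u v : ℝ × ℝ) : ℝ :=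
  u.1 * v.1 + β.1 * ((u.1 * v.2 + u.2 * v.1) / 2) + β.2 * (u.2 * v.2)

/-- The determinant of two real vectors. -/
def rd (u v : ℝ × ℝ) : ℝ := u.1 * v.2 - u.2 * v.1

/-- Minus the discriminant of `Qr`. -/
def disc (β : ℝ × ℝ) : ℝ := 4 * β.2 - β.1 ^ 2

/-- A rectangle of parameters of positive definite forms. -/
def Kp (M : ℝ) : Set (ℝ × ℝ) := Set.Icc (-(1 / 2)) (3 / 2) ×ˢ Set.Icc (5 / 8) M

/-- The Jacobian of `β ↦ (Br β u v, Br β u' v')`. -/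
noncomputable def jac (u v u' v' : ℝ × ℝ) : ℝ :=
  (u.1 * v.2 + u.2 * v.1) / 2 * (u'.2 * v'.2) - u.2 * v.2 * ((u'.1 * v'.2 + u'.2 * v'.1) / 2)

theorem lintegral_affine (a b c d e f : ℝ) (h : a * d - b * c ≠ 0) (g : ℝ × ℝ → ENNReal)
    (hg : Measurable g) :
    ∫⁻ β : ℝ × ℝ, g (a * β.1 + b * β.2 + e, c * β.1 + d * β.2 + f) =
      ENNReal.ofReal |a * d - b * c|⁻¹ * ∫⁻ β, g β := by
  set T : ℝ × ℝ →ₗ[ℝ] ℝ × ℝ :=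
    Matrix.toLin (Module.Basis.finTwoProd ℝ) (Module.Basis.finTwoProd ℝ) !![a, b; c, d] with hT
  have hTa : ∀ β : ℝ × ℝ, T β = (a * β.1 + b * β.2, c * β.1 + d * β.2) := by
    intro β; rw [hT, Matrix.toLin_finTwoProd_apply]
  have hdet : LinearMap.det T = a * d - b * c := by
    rw [hT, LinearMap.det_toLin, Matrix.det_fin_two_of]
  have hmap := Measure.map_linearMap_addHaar_eq_smul_addHaar
    (volume : Measure (ℝ × ℝ)) (f := T) (by rw [hdet]; exact h)
  have hTm : Measurable T := T.continuous_of_finiteDimensional.measurable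
  have e1 : ∫⁻ β : ℝ × ℝ, g (a * β.1 + b * β.2 + e, c * β.1 + d * β.2 + f) =
      ∫⁻ β, (fun y => g (y + (e, f))) (T β) := by
    apply lintegral_congr
    intro β
    simp only [hTa, Prod.mk_add_mk]
  have hgm : Measurable fun y => g (y + (e, f)) := hg.comp (measurable_id.add_const _)
  rw [e1, ← lintegral_map hgm hTm, hmap, lintegral_smul_measure,
    lintegral_add_right_eq_self (fun y => g y) (e, f), hdet, abs_inv]
  rfl

theorem volume_parallelogram_le (a b c d e f s t s' t' : ℝ) (h : a * d - b * c ≠ 0) :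
    volume {β : ℝ × ℝ | (s ≤ a * β.1 + b * β.2 + e ∧ a * β.1 + b * β.2 + e ≤ t) ∧
      (s' ≤ c * β.1 + d * β.2 + f ∧ c * β.1 + d * β.2 + f ≤ t')} ≤
      ENNReal.ofReal ((t - s) * |t' - s'| / |a * d - b * c|) := by
  have hm : MeasurableSet (Set.Icc s t ×ˢ Set.Icc s' t') := measurableSet_Icc.prod measurableSet_Icc
  have key := lintegral_affine a b c d e f h ((Set.Icc s t ×ˢ Set.Icc s' t').indicator 1)
    (measurable_one.indicator hm)
  rw [lintegral_indicator_one hm] at key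
  have hmT : Measurable fun β : ℝ × ℝ => (a * β.1 + b * β.2 + e, c * β.1 + d * β.2 + f) := by
    fun_prop
  have e2 : ∫⁻ β : ℝ × ℝ, (Set.Icc s t ×ˢ Set.Icc s' t').indicator (1 : ℝ × ℝ → ENNReal)
      (a * β.1 + b * β.2 + e, c * β.1 + d * β.2 + f) =
      volume ((fun β : ℝ × ℝ => (a * β.1 + b * β.2 + e, c * β.1 + d * β.2 + f)) ⁻¹'
        (Set.Icc s t ×ˢ Set.Icc s' t')) := by
    rw [← lintegral_indicator_one (hmT hm)]
    rfl
  rw [e2] at key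
  have e3 : {β : ℝ × ℝ | (s ≤ a * β.1 + b * β.2 + e ∧ a * β.1 + b * β.2 + e ≤ t) ∧
      (s' ≤ c * β.1 + d * β.2 + f ∧ c * β.1 + d * β.2 + f ≤ t')} =
      (fun β : ℝ × ℝ => (a * β.1 + b * β.2 + e, c * β.1 + d * β.2 + f)) ⁻¹'
        (Set.Icc s t ×ˢ Set.Icc s' t') := by
    ext β; simp only [Set.mem_ofPred_eq, Set.mem_preimage, Set.mem_prod, Set.mem_Icc]
  rw [e3, key, Measure.volume_eq_prod, Measure.prod_prod, Real.volume_Icc, Real.volume_Icc]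
  calc _ ≤ ENNReal.ofReal |a * d - b * c|⁻¹ * (ENNReal.ofReal (t - s) * ENNReal.ofReal |t' - s'|) := by
        gcongr; exact le_abs_self _
    _ = _ := by
        rw [← ENNReal.ofReal_mul' (abs_nonneg _), ← ENNReal.ofReal_mul (by positivity)]
        congr 1
        ring

section geometry

variable {M : ℝ} {β : ℝ × ℝ}

theorem abs_fst_le (u : ℝ × ℝ) : |u.1| ≤ ‖u‖ := norm_fst_le u

theorem abs_snd_le (u : ℝ × ℝ) : |u.2| ≤ ‖u‖ := norm_snd_le u

theorem norm_sq_le_max (u : ℝ × ℝ) (T : ℝ) (h1 : u.1 ^ 2 ≤ T) (h2 : u.2 ^ 2 ≤ T) : ‖u‖ ^ 2 ≤ T := by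
  have h : ‖u‖ = max |u.1| |u.2| := Prod.norm_def u
  rw [h]
  rcases max_cases |u.1| |u.2| with ⟨h3, _⟩ | ⟨h3, _⟩ <;> rw [h3, sq_abs] <;> assumption

theorem Kp_bounds (hβ : β ∈ Kp M) : -(1 / 2) ≤ β.1 ∧ β.1 ≤ 3 / 2 ∧ 5 / 8 ≤ β.2 ∧ β.2 ≤ M :=
  ⟨hβ.1.1, hβ.1.2, hβ.2.1, hβ.2.2⟩

theorem disc_lower (hβ : β ∈ Kp M) : 1 / 4 ≤ disc β := by
  obtain ⟨h1, h2, h3, h4⟩ := Kp_bounds hβ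
  unfold disc; nlinarith

theorem disc_upper (hβ : β ∈ Kp M) : disc β ≤ 4 * M := by
  obtain ⟨h1, h2, h3, h4⟩ := Kp_bounds hβ
  unfold disc; nlinarith [sq_nonneg β.1]

theorem norm_sq_le_Qr (hM : 1 ≤ M) (hβ : β ∈ Kp M) (p : ℝ × ℝ) : ‖p‖ ^ 2 ≤ 16 * M * Qr β p := by
  obtain ⟨h1, h2, h3, h4⟩ := Kp_bounds hβ
  have hd := disc_lower hβ
  unfold disc at hd
  have e1 : 4 * Qr β p = (2 * p.1 + β.1 * p.2) ^ 2 + (4 * β.2 - β.1 ^ 2) * p.2 ^ 2 := by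
    unfold Qr; ring
  have e2 : 4 * β.2 * Qr β p = (2 * β.2 * p.2 + β.1 * p.1) ^ 2 + (4 * β.2 - β.1 ^ 2) * p.1 ^ 2 := by
    unfold Qr; ring
  have g1 : p.2 ^ 2 ≤ 16 * Qr β p := by nlinarith [sq_nonneg (2 * p.1 + β.1 * p.2), sq_nonneg p.2]
  have g0 : 0 ≤ Qr β p := by nlinarith [sq_nonneg p.2]
  have g2 : p.1 ^ 2 ≤ 16 * β.2 * Qr β p := by
    nlinarith [sq_nonneg (2 * β.2 * p.2 + β.1 * p.1), sq_nonneg p.1]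
  apply norm_sq_le_max
  · nlinarith
  · nlinarith

theorem Qr_nonneg (hM : 1 ≤ M) (hβ : β ∈ Kp M) (p : ℝ × ℝ) : 0 ≤ Qr β p := by
  have := norm_sq_le_Qr hM hβ p
  nlinarith [sq_nonneg ‖p‖]

theorem Br_sq_add (u v : ℝ × ℝ) :
    Qr β u * Qr β v = Br β u v ^ 2 + disc β / 4 * rd u v ^ 2 := by
  unfold Qr Br disc rd; ring

theorem abs_rd_le (u v : ℝ × ℝ) : |rd u v| ≤ 2 * (‖u‖ * ‖v‖) := by
  unfold rd
  have h1 : |u.1 * v.2| ≤ ‖u‖ * ‖v‖ := by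
    rw [abs_mul]; exact mul_le_mul (abs_fst_le u) (abs_snd_le v) (abs_nonneg _) (norm_nonneg _)
  have h2 : |u.2 * v.1| ≤ ‖u‖ * ‖v‖ := by
    rw [abs_mul]; exact mul_le_mul (abs_snd_le u) (abs_fst_le v) (abs_nonneg _) (norm_nonneg _)
  have := abs_sub (u.1 * v.2) (u.2 * v.1)
  linarith

/-- Nearly orthogonal vectors are far from parallel. -/
theorem rd_sq_ge_Qr (hM : 1 ≤ M) (hβ : β ∈ Kp M) {u v : ℝ × ℝ} {Y : ℝ}
    (hY : Y ≤ ‖u‖ * ‖v‖ / (32 * M)) (hB : |Br β u v| ≤ Y) :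
    3 * (Qr β u * Qr β v) ≤ 4 * M * rd u v ^ 2 := by
  have h1 := norm_sq_le_Qr hM hβ u
  have h2 := norm_sq_le_Qr hM hβ v
  have h3 := Br_sq_add (β := β) u v
  have h4 := disc_upper hβ
  have h5 : (‖u‖ * ‖v‖) ^ 2 ≤ 256 * M ^ 2 * (Qr β u * Qr β v) := by
    calc (‖u‖ * ‖v‖) ^ 2 = ‖u‖ ^ 2 * ‖v‖ ^ 2 := by ring
      _ ≤ (16 * M * Qr β u) * (16 * M * Qr β v) :=
        mul_le_mul h1 h2 (by positivity) ((sq_nonneg _).trans h1)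
      _ = _ := by ring
  have h6 : Br β u v ^ 2 ≤ (‖u‖ * ‖v‖ / (32 * M)) ^ 2 := by
    rw [← sq_abs (Br β u v)]
    exact pow_le_pow_left₀ (abs_nonneg _) (hB.trans hY) 2
  have h7 : (‖u‖ * ‖v‖ / (32 * M)) ^ 2 ≤ Qr β u * Qr β v / 4 := by
    rw [div_pow, div_le_iff₀ (by positivity)]
    linarith
  have h8 : disc β / 4 * rd u v ^ 2 ≤ M * rd u v ^ 2 := by
    apply mul_le_mul_of_nonneg_right _ (sq_nonneg _); linarith
  linarith

theorem rd_sq_ge (hM : 1 ≤ M) (hβ : β ∈ Kp M) {u v : ℝ × ℝ} {Y : ℝ}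
    (hY : Y ≤ ‖u‖ * ‖v‖ / (32 * M)) (hB : |Br β u v| ≤ Y) :
    (‖u‖ * ‖v‖) ^ 2 ≤ 400 * M ^ 3 * rd u v ^ 2 := by
  have h0 := rd_sq_ge_Qr hM hβ hY hB
  have h1 := norm_sq_le_Qr hM hβ u
  have h2 := norm_sq_le_Qr hM hβ v
  calc (‖u‖ * ‖v‖) ^ 2 = ‖u‖ ^ 2 * ‖v‖ ^ 2 := by ring
    _ ≤ (16 * M * Qr β u) * (16 * M * Qr β v) :=
      mul_le_mul h1 h2 (by positivity) ((sq_nonneg _).trans h1)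
    _ = 256 / 3 * M ^ 2 * (3 * (Qr β u * Qr β v)) := by ring
    _ ≤ 256 / 3 * M ^ 2 * (4 * M * rd u v ^ 2) := by gcongr
    _ ≤ _ := by
      have : 0 ≤ M ^ 3 * rd u v ^ 2 := by positivity
      nlinarith

theorem volume_Kp_le (M : ℝ) : volume (Kp M) ≤ ENNReal.ofReal (2 * M) := by
  rw [Kp, Measure.volume_eq_prod, Measure.prod_prod, Real.volume_Icc, Real.volume_Icc,
    ← ENNReal.ofReal_mul (by norm_num)]
  apply ENNReal.ofReal_le_ofReal
  linarith

/-- The set of parameters for which two given vectors are nearly orthogonal is small. -/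
theorem volume_strip_le (hM : 1 ≤ M) {u v : ℝ × ℝ} (hu : u ≠ 0) (hv : v ≠ 0) {Y : ℝ} (hY0 : 0 ≤ Y) :
    volume {β | β ∈ Kp M ∧ 0 ≤ Br β u v ∧ Br β u v ≤ Y} ≤
      ENNReal.ofReal (6400 * M ^ 4 * Y / (‖u‖ * ‖v‖)) := by
  have hu' : 0 < ‖u‖ := norm_pos_iff.2 hu
  have hv' : 0 < ‖v‖ := norm_pos_iff.2 hv
  set W := ‖u‖ * ‖v‖ with hW
  have hWp : 0 < W := by positivity
  have hM4 : M ≤ M ^ 4 := by nlinarith [one_le_pow₀ hM (n := 3)]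
  have hM24 : M ^ 2 ≤ M ^ 4 := pow_le_pow_right₀ hM (by norm_num)
  rcases lt_or_ge (W / (32 * M)) Y with hlt | hle
  · refine (measure_mono (t := Kp M) fun β hβ => hβ.1).trans ((volume_Kp_le M).trans ?_)
    apply ENNReal.ofReal_le_ofReal
    rw [div_lt_iff₀ (by positivity)] at hlt
    rw [le_div_iff₀ hWp]
    calc 2 * M * W ≤ 2 * M * (Y * (32 * M)) := by gcongr
      _ = 64 * M ^ 2 * Y := by ring
      _ ≤ _ := by gcongr; norm_num
  rcases Set.eq_empty_or_nonempty {β | β ∈ Kp M ∧ 0 ≤ Br β u v ∧ Br β u v ≤ Y} with hemp | ⟨β0, hβ0, hb1, hb2⟩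
  · rw [hemp]; simp
  have hr := rd_sq_ge hM hβ0 hle (by rw [abs_of_nonneg hb1]; exact hb2)
  rw [← hW] at hr
  set x1 := u.1 * v.1 with hx1
  set x2 := (u.1 * v.2 + u.2 * v.1) / 2 with hx2
  set x3 := u.2 * v.2 with hx3
  have hid : rd u v ^ 2 = 4 * x2 ^ 2 - 4 * x1 * x3 := by
    rw [hx1, hx2, hx3]; unfold rd; ring
  have hx1b : |x1| ≤ W := by
    rw [hx1, abs_mul]
    exact mul_le_mul (abs_fst_le u) (abs_fst_le v) (abs_nonneg _) (norm_nonneg _)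
  have hM3 : 1 ≤ M ^ 3 := one_le_pow₀ hM
  have hcase : W ≤ 3200 * M ^ 3 * |x3| ∨ W ≤ 3200 * M ^ 3 * |x2| := by
    by_contra hcon
    push Not at hcon
    obtain ⟨c1, c2⟩ := hcon
    have t1 : -(x1 * x3) ≤ W * |x3| := by
      calc -(x1 * x3) ≤ |x1 * x3| := neg_le_abs _
        _ = |x1| * |x3| := abs_mul _ _
        _ ≤ _ := by gcongr
    have t2 : 3200 * M ^ 3 * (-(x1 * x3)) ≤ W * W := by
      calc 3200 * M ^ 3 * (-(x1 * x3)) ≤ 3200 * M ^ 3 * (W * |x3|) := by gcongr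
        _ = W * (3200 * M ^ 3 * |x3|) := by ring
        _ ≤ _ := by gcongr
    have t3 : (3200 * M ^ 3) ^ 2 * x2 ^ 2 ≤ W ^ 2 := by
      rw [← sq_abs x2, ← mul_pow]
      exact pow_le_pow_left₀ (by positivity) c2.le 2
    have t4 : 3200 * M ^ 3 * (x2 ^ 2 * 3200) ≤ W ^ 2 := by
      refine le_trans ?_ t3
      have : 0 ≤ M ^ 3 * x2 ^ 2 := by positivity
      nlinarith
    nlinarith
  rcases hcase with h | h
  · have h3 : 0 < |x3| := by
      by_contra hc
      have : |x3| = 0 := le_antisymm (not_lt.1 hc) (abs_nonneg _)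
      rw [this] at h; linarith
    have := volume_parallelogram_le x2 x3 1 0 x1 0 0 Y (-(1 / 2)) (3 / 2)
      (by simpa using (abs_pos.1 h3))
    refine (measure_mono ?_).trans (this.trans ?_)
    · rintro β ⟨hβ, h1, h2⟩
      have e : x2 * β.1 + x3 * β.2 + x1 = Br β u v := by rw [hx1, hx2, hx3]; unfold Br; ring
      obtain ⟨k1, k2, k3, k4⟩ := Kp_bounds hβ
      refine ⟨by rw [e]; exact ⟨h1, h2⟩, by linarith, by linarith⟩
    · apply ENNReal.ofReal_le_ofReal
      rw [show x2 * 0 - x3 * 1 = -x3 by ring, abs_neg]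
      norm_num
      rw [div_le_div_iff₀ h3 hWp]
      calc Y * 2 * W ≤ Y * 2 * (3200 * M ^ 3 * |x3|) := by gcongr
        _ = 6400 * M ^ 3 * Y * |x3| := by ring
        _ ≤ _ := by gcongr; linarith
  · have h3 : 0 < |x2| := by
      by_contra hc
      have : |x2| = 0 := le_antisymm (not_lt.1 hc) (abs_nonneg _)
      rw [this] at h; linarith
    have := volume_parallelogram_le x2 x3 0 1 x1 0 0 Y 0 M
      (by simpa using (abs_pos.1 h3))
    refine (measure_mono ?_).trans (this.trans ?_)
    · rintro β ⟨hβ, h1, h2⟩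
      have e : x2 * β.1 + x3 * β.2 + x1 = Br β u v := by rw [hx1, hx2, hx3]; unfold Br; ring
      obtain ⟨k1, k2, k3, k4⟩ := Kp_bounds hβ
      refine ⟨by rw [e]; exact ⟨h1, h2⟩, by linarith, by linarith⟩
    · apply ENNReal.ofReal_le_ofReal
      rw [show x2 * 1 - x3 * 0 = x2 by ring, sub_zero, sub_zero, abs_of_pos (by linarith : 0 < M)]
      rw [div_le_div_iff₀ h3 hWp]
      calc Y * M * W ≤ Y * M * (3200 * M ^ 3 * |x2|) := by gcongr
        _ = 3200 * M ^ 4 * Y * |x2| := by ring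
        _ ≤ _ := by gcongr; linarith

end geometry

/-- The weight attached to a pair of integer vectors. -/
noncomputable def tw (u v : ℝ × ℝ) : ℝ := 1 / (‖u‖ * ‖v‖ * max 1 |rd u v|)

theorem tw_nonneg (u v : ℝ × ℝ) : 0 ≤ tw u v := by unfold tw; positivity

section

variable {M : ℝ} {β : ℝ × ℝ}

theorem Br_transfer (u v u' v' : ℝ × ℝ) :
    rd u v' * rd u u' * Qr β v + rd v u' * rd v v' * Qr β u =
      rd u v ^ 2 * Br β u' v' + Br β u v * (rd u v' * rd v u' + rd u u' * rd v v') := by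
  unfold rd Qr Br; ring

theorem jac_transfer (u v u' v' : ℝ × ℝ) :
    2 * rd u v * jac u v u' v' =
      rd u v' * rd u u' * v.2 ^ 2 - rd v u' * rd v v' * u.2 ^ 2 := by
  unfold rd jac; ring

theorem rd_plucker (u v u' v' : ℝ × ℝ) :
    rd u u' * rd v v' - rd u v' * rd v u' = rd u v * rd u' v' := by
  unfold rd; ring

theorem opposite_of_sum_small {P Q : ℝ} (h : 2 * |P + Q| < |P| + |Q|) :
    P * Q < 0 ∧ P ^ 2 + Q ^ 2 ≤ 10 / 3 * |P * Q| := by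
  have h2 : (2 * |P + Q|) ^ 2 < (|P| + |Q|) ^ 2 := pow_lt_pow_left₀ h (by positivity) (by norm_num)
  have e1 : (2 * |P + Q|) ^ 2 = 4 * (P + Q) ^ 2 := by rw [mul_pow, sq_abs]; norm_num
  have e2 : (|P| + |Q|) ^ 2 = P ^ 2 + 2 * |P * Q| + Q ^ 2 := by
    rw [add_sq, sq_abs, sq_abs, abs_mul]; ring
  rw [e1, e2] at h2
  have hneg : P * Q < 0 := by
    by_contra hc
    push Not at hc
    rw [abs_of_nonneg hc] at h2
    nlinarith [sq_nonneg P, sq_nonneg Q, sq_nonneg (P - Q)]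
  refine ⟨hneg, ?_⟩
  rw [abs_of_neg hneg] at h2 ⊢
  nlinarith

theorem weighted_sq_ge {α ε s t : ℝ} (hα0 : 0 ≤ α) (hε0 : 0 ≤ ε) (hs0 : 0 ≤ s) (ht0 : 0 ≤ t)
    (hαε : α ^ 2 + ε ^ 2 ≤ 10 / 3 * (α * ε)) :
    3 / 10 * (α * ε) * (s + t) ^ 2 ≤ (α * s + ε * t) ^ 2 := by
  have k1 : 3 / 10 * (α * ε) ≤ α ^ 2 := by
    rcases eq_or_lt_of_le hε0 with h0 | h0
    · rw [← h0]; simp; positivity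
    · have : 3 * ε ≤ 10 * α := by
        by_contra hc
        push Not at hc
        nlinarith
      nlinarith
  have k2 : 3 / 10 * (α * ε) ≤ ε ^ 2 := by
    rcases eq_or_lt_of_le hα0 with h0 | h0
    · rw [← h0]; simp; positivity
    · have : 3 * α ≤ 10 * ε := by
        by_contra hc
        push Not at hc
        nlinarith
      nlinarith
  have k3 : 0 ≤ s * t := by positivity
  have k4 : 3 / 10 * (α * ε) * s ^ 2 ≤ α ^ 2 * s ^ 2 := by gcongr
  have k5 : 3 / 10 * (α * ε) * t ^ 2 ≤ ε ^ 2 * t ^ 2 := by gcongr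
  have k6 : 0 ≤ α * ε * (s * t) := by positivity
  nlinarith

/-- In the transversal case, the Jacobian is bounded below. -/
theorem jac_sq_ge (hM : 1 ≤ M) (hβ : β ∈ Kp M) {u v u' v' : ℝ × ℝ} {Y : ℝ}
    (hu : u ≠ 0) (hv : v ≠ 0)
    (hY : Y ≤ ‖u‖ * ‖v‖ / (32 * M)) (hB : |Br β u v| ≤ Y)
    (h : 2 * |rd u v' * rd u u' * Qr β v + rd v u' * rd v v' * Qr β u| <
      |rd u v' * rd u u'| * Qr β v + |rd v u' * rd v v'| * Qr β u) :
    |rd u v' * rd u u' * (rd v u' * rd v v')| ≤ 22000 * M ^ 3 * jac u v u' v' ^ 2 ∧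
      rd u v' * rd u u' * (rd v u' * rd v v') ≠ 0 := by
  set a := rd u v' * rd u u' with ha
  set e := rd v u' * rd v v' with he
  set δ := rd u v with hδ
  set d := jac u v u' v' with hd
  have hqu : 0 < Qr β u := by
    have := norm_sq_le_Qr hM hβ u
    have h2 : 0 < ‖u‖ := norm_pos_iff.2 hu
    by_contra hc
    push Not at hc
    nlinarith [pow_pos h2 2]
  have hqv : 0 < Qr β v := by
    have := norm_sq_le_Qr hM hβ v
    have h2 : 0 < ‖v‖ := norm_pos_iff.2 hv
    by_contra hc
    push Not at hc
    nlinarith [pow_pos h2 2]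
  set qu := Qr β u with hqu'
  set qv := Qr β v with hqv'
  have hδ2 := rd_sq_ge_Qr hM hβ hY hB
  rw [← hδ, ← hqu', ← hqv'] at hδ2
  have hδpos : 0 < δ ^ 2 := by
    have : 0 < qu * qv := mul_pos hqu hqv
    by_contra hc
    have : δ ^ 2 = 0 := le_antisymm (not_lt.1 hc) (sq_nonneg _)
    rw [this] at hδ2; linarith
  have habs : |a| * qv + |e| * qu = |a * qv| + |e * qu| := by
    rw [abs_mul a, abs_mul e, abs_of_pos hqv, abs_of_pos hqu]
  have jtr := jac_transfer u v u' v'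
  rw [← hδ, ← hd, ← ha, ← he] at jtr
  have hδσ : δ ^ 2 ≤ 32 * M * (qu * v.2 ^ 2 + qv * u.2 ^ 2) := by
    have n1 := norm_sq_le_Qr hM hβ u
    have n2 := norm_sq_le_Qr hM hβ v
    have n3 : u.1 ^ 2 ≤ ‖u‖ ^ 2 := by rw [← sq_abs u.1]; exact pow_le_pow_left₀ (abs_nonneg _) (abs_fst_le u) 2
    have n4 : v.1 ^ 2 ≤ ‖v‖ ^ 2 := by rw [← sq_abs v.1]; exact pow_le_pow_left₀ (abs_nonneg _) (abs_fst_le v) 2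
    have n5 : u.1 ^ 2 * v.2 ^ 2 ≤ 16 * M * qu * v.2 ^ 2 :=
      mul_le_mul_of_nonneg_right (n3.trans n1) (sq_nonneg _)
    have n6 : v.1 ^ 2 * u.2 ^ 2 ≤ 16 * M * qv * u.2 ^ 2 :=
      mul_le_mul_of_nonneg_right (n4.trans n2) (sq_nonneg _)
    have n7 : δ ^ 2 ≤ 2 * (u.1 ^ 2 * v.2 ^ 2 + v.1 ^ 2 * u.2 ^ 2) := by
      rw [hδ]; unfold rd; nlinarith [sq_nonneg (u.1 * v.2 + u.2 * v.1)]
    linarith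
  clear_value a e δ d qu qv
  rw [habs] at h
  obtain ⟨o1, o2⟩ := opposite_of_sum_small h
  have hae : a * e < 0 := by
    by_contra hc
    push Not at hc
    have : 0 ≤ a * e * (qu * qv) := by positivity
    nlinarith
  refine ⟨?_, hae.ne⟩
  -- the quantity `σ`
  set σ := qu * v.2 ^ 2 + qv * u.2 ^ 2 with hσ
  have hσ0 : 0 ≤ σ := by rw [hσ]; positivity

  clear_value σ
  have hσq : 3 * (qu * qv) ≤ 128 * M ^ 2 * σ := by nlinarith
  -- compare the two terms
  set α := |a| * qv with hα
  set ε := |e| * qu with hε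
  have hα0 : 0 ≤ α := by positivity
  have hε0 : 0 ≤ ε := by positivity
  have hαε : α ^ 2 + ε ^ 2 ≤ 10 / 3 * (α * ε) := by
    have i1 : α ^ 2 = (a * qv) ^ 2 := by rw [hα, mul_pow, mul_pow, sq_abs]
    have i2 : ε ^ 2 = (e * qu) ^ 2 := by rw [hε, mul_pow, mul_pow, sq_abs]
    have i3 : α * ε = |a * qv * (e * qu)| := by
      rw [hα, hε, abs_mul, abs_mul a, abs_mul e, abs_of_pos hqv, abs_of_pos hqu]
    rw [i1, i2, i3]; exact o2
  have hJ : 4 * δ ^ 2 * d ^ 2 = (|a| * v.2 ^ 2 + |e| * u.2 ^ 2) ^ 2 := by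
    have j2 : 4 * δ ^ 2 * d ^ 2 = (a * v.2 ^ 2 - e * u.2 ^ 2) ^ 2 := by rw [← jtr]; ring
    rw [j2]
    rcases lt_trichotomy a 0 with h0 | h0 | h0
    · have : 0 < e := by
        by_contra hc
        exact absurd (mul_nonneg_of_nonpos_of_nonpos h0.le (not_lt.1 hc)) (not_le.2 hae)
      rw [abs_of_neg h0, abs_of_pos this]; ring
    · rw [h0] at hae; simp at hae
    · have : e < 0 := by
        by_contra hc
        exact absurd (mul_nonneg h0.le (not_lt.1 hc)) (not_le.2 hae)
      rw [abs_of_pos h0, abs_of_neg this]; ring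
  have hmain : 3 / 10 * (α * ε) * σ ^ 2 ≤ (α * (qu * v.2 ^ 2) + ε * (qv * u.2 ^ 2)) ^ 2 := by
    rw [hσ]
    exact weighted_sq_ge hα0 hε0 (by positivity) (by positivity) hαε
  have hid : (α * (qu * v.2 ^ 2) + ε * (qv * u.2 ^ 2)) ^ 2 = (qu * qv) ^ 2 * (4 * δ ^ 2 * d ^ 2) := by
    rw [hJ, hα, hε]; ring
  have hαe : α * ε = |a * e| * (qu * qv) := by rw [hα, hε, abs_mul]; ring
  rw [hid, hαe] at hmain
  have hq : 0 < qu * qv := mul_pos hqu hqv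
  have hchain : |a * e| * δ ^ 2 * (qu * qv) ^ 2 ≤ 22000 * M ^ 3 * d ^ 2 * δ ^ 2 * (qu * qv) ^ 2 := by
    have hnn : 0 ≤ |a * e| * (qu * qv) := by positivity
    have s2 : (qu * qv) * δ ^ 2 ≤ (128 * M ^ 2 * σ / 3) * (32 * M * σ) := by
      apply mul_le_mul (by linarith) hδσ (sq_nonneg _) (by positivity)
    calc |a * e| * δ ^ 2 * (qu * qv) ^ 2 = |a * e| * (qu * qv) * ((qu * qv) * δ ^ 2) := by ring
      _ ≤ |a * e| * (qu * qv) * ((128 * M ^ 2 * σ / 3) * (32 * M * σ)) := by gcongr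
      _ = 40960 / 9 * M ^ 3 * (3 / 10 * (|a * e| * (qu * qv)) * σ ^ 2) := by ring
      _ ≤ 40960 / 9 * M ^ 3 * ((qu * qv) ^ 2 * (4 * δ ^ 2 * d ^ 2)) := by gcongr
      _ = 163840 / 9 * (M ^ 3 * d ^ 2 * δ ^ 2 * (qu * qv) ^ 2) := by ring
      _ ≤ 22000 * (M ^ 3 * d ^ 2 * δ ^ 2 * (qu * qv) ^ 2) := by gcongr; norm_num
      _ = _ := by ring
  have hq2 : 0 < (qu * qv) ^ 2 := by positivity
  exact le_of_mul_le_mul_right (le_of_mul_le_mul_right hchain hq2) hδpos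

end

/-- The constant in the bound for pairs with small Jacobian. -/
noncomputable def badK (M : ℝ) : ℝ := 17600000 * M ^ 6 + 6400 * M ^ 4 * (1 + 819200 * M ^ 4) ^ 2

theorem badK_pos {M : ℝ} (hM : 1 ≤ M) : 0 < badK M := by
  unfold badK; positivity

section

variable {M : ℝ} {β : ℝ × ℝ}

theorem ofReal_le_tw {K V Y R Tr W C E : ℝ} (hW : 0 < W)
    (hV : V * (W * (max 1 C * max 1 E)) ≤ K * (Y ^ 2 * Tr + Y * R ^ 2)) :
    ENNReal.ofReal V ≤ ENNReal.ofReal (K * (Y ^ 2 * Tr + Y * R ^ 2) * (1 / (W * (max 1 C * max 1 E)))) := by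
  apply ENNReal.ofReal_le_ofReal
  have : 0 < W * (max 1 C * max 1 E) := by positivity
  rw [mul_one_div, le_div_iff₀ this]
  exact hV

set_option maxHeartbeats 2000000 in
theorem bad_bound_half (hM : 1 ≤ M) {u v u' v' : ℝ × ℝ} {R Y Tr : ℝ}
    (hu : 1 ≤ ‖u‖) (hv : 1 ≤ ‖v‖) (hu' : 1 ≤ ‖u'‖) (hv' : 1 ≤ ‖v'‖)
    (huR : ‖u‖ ≤ R) (hvR : ‖v‖ ≤ R) (huR' : ‖u'‖ ≤ R) (hvR' : ‖v'‖ ≤ R)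
    (hY0 : 0 ≤ Y) (hY : Y ≤ 1 / (32 * M)) (hd : |jac u v u' v'| ≤ Tr)
    (hC : rd u v' ≠ 0 → 1 ≤ |rd u v'|) (hE : rd v u' ≠ 0 → 1 ≤ |rd v u'|)
    (hle : |rd u v' * rd v u'| ≤ |rd u u' * rd v v'|) :
    volume {β | β ∈ Kp M ∧ (0 ≤ Br β u v ∧ Br β u v ≤ Y) ∧ (0 ≤ Br β u' v' ∧ Br β u' v' ≤ Y)} ≤
      ENNReal.ofReal (badK M * (Y ^ 2 * Tr + Y * R ^ 2) * (tw u v' * tw v u')) := by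
  rcases Set.eq_empty_or_nonempty
    {β | β ∈ Kp M ∧ (0 ≤ Br β u v ∧ Br β u v ≤ Y) ∧ (0 ≤ Br β u' v' ∧ Br β u' v' ≤ Y)} with
    hemp | ⟨β, hβ, ⟨hb1, hb2⟩, hb3, hb4⟩
  · rw [hemp]; simp
  have hTr : 0 ≤ Tr := (abs_nonneg _).trans hd
  have hu0 : u ≠ 0 := norm_pos_iff.1 (by linarith)
  have hv0 : v ≠ 0 := norm_pos_iff.1 (by linarith)
  have hu0' : u' ≠ 0 := norm_pos_iff.1 (by linarith)
  have hv0' : v' ≠ 0 := norm_pos_iff.1 (by linarith)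
  have hY1 : Y ≤ 1 := hY.trans (by rw [div_le_one (by positivity)]; linarith)
  have hYuv : Y ≤ ‖u‖ * ‖v‖ / (32 * M) := hY.trans (by gcongr; nlinarith)
  have hYuv' : Y ≤ ‖u'‖ * ‖v'‖ / (32 * M) := hY.trans (by gcongr; nlinarith)
  have hB : |Br β u v| ≤ Y := by rw [abs_of_nonneg hb1]; exact hb2
  have hB' : |Br β u' v'| ≤ Y := by rw [abs_of_nonneg hb3]; exact hb4
  have hδ := rd_sq_ge hM hβ hYuv hB
  have hδ' := rd_sq_ge hM hβ hYuv' hB'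
  have hpl := rd_plucker u v u' v'
  have htr := Br_transfer (β := β) u v u' v'
  have htw : tw u v' * tw v u' =
      1 / (‖u‖ * ‖v‖ * (‖u'‖ * ‖v'‖) * (max 1 |rd u v'| * max 1 |rd v u'|)) := by
    unfold tw; rw [one_div_mul_one_div]; congr 1; ring
  rw [htw]
  have hAle := abs_rd_le u u'
  have hBle := abs_rd_le v v'
  have hCle := abs_rd_le u v'
  have hEle := abs_rd_le v u'
  have hδle := abs_rd_le u v
  have hqv := norm_sq_le_Qr hM hβ v
  have hqu := norm_sq_le_Qr hM hβ u
  have hqv0 := Qr_nonneg hM hβ v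
  have hqu0 := Qr_nonneg hM hβ u
  have hjs := jac_sq_ge hM hβ (u' := u') (v' := v') hu0 hv0 hYuv hB
  have hpar := volume_parallelogram_le ((u.1 * v.2 + u.2 * v.1) / 2) (u.2 * v.2)
    ((u'.1 * v'.2 + u'.2 * v'.1) / 2) (u'.2 * v'.2) (u.1 * v.1) (u'.1 * v'.1) 0 Y 0 Y
  have hst := volume_strip_le hM hu0 hv0 hY0
  have hst' := volume_strip_le hM hu0' hv0' hY0
  set A := rd u u' with hAdef
  set B := rd v v' with hBdef
  set C := rd u v' with hCdef
  set E := rd v u' with hEdef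
  set δ := rd u v with hδdef
  set δ' := rd u' v' with hδ'def
  set a := ‖u‖ with hadef
  set b := ‖v‖ with hbdef
  set a' := ‖u'‖ with ha'def
  set b' := ‖v'‖ with hb'def
  clear_value A B C E δ δ' a b a' b'
  have ha0 : 0 < a := by linarith
  have hb0 : 0 < b := by linarith
  have ha0' : 0 < a' := by linarith
  have hb0' : 0 < b' := by linarith
  have hM0 : 0 < M := by linarith
  have hW : 0 < a * b * (a' * b') := by positivity
  have hWAB : a * b * (a' * b') ≤ 800 * M ^ 3 * (|A| * |B|) := by
    have h1 : (a * b * (a' * b')) ^ 2 ≤ (400 * M ^ 3 * |δ * δ'|) ^ 2 := by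
      calc (a * b * (a' * b')) ^ 2 = (a * b) ^ 2 * (a' * b') ^ 2 := by ring
        _ ≤ (400 * M ^ 3 * δ ^ 2) * (400 * M ^ 3 * δ' ^ 2) := by gcongr
        _ = (400 * M ^ 3 * |δ * δ'|) ^ 2 := by rw [mul_pow, sq_abs]; ring
    have h2 := abs_le_of_sq_le_sq h1 (by positivity)
    have h3 : |δ * δ'| ≤ 2 * (|A| * |B|) := by
      rw [← hpl, ← abs_mul A B]
      have := abs_sub (A * B) (C * E)
      linarith
    calc a * b * (a' * b') ≤ 400 * M ^ 3 * |δ * δ'| := (le_abs_self _).trans h2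
      _ ≤ 400 * M ^ 3 * (2 * (|A| * |B|)) := by gcongr
      _ = _ := by ring
  by_cases hcase : 2 * |C * A * Qr β v + E * B * Qr β u| < |C * A| * Qr β v + |E * B| * Qr β u
  · obtain ⟨hj1, hj2⟩ := hjs hcase
    have hC0 : C ≠ 0 := fun h => hj2 (by rw [h]; ring)
    have hE0 : E ≠ 0 := fun h => hj2 (by rw [h]; ring)
    have hd0 : jac u v u' v' ≠ 0 := by
      intro h
      rw [h] at hj1
      have := abs_pos.2 hj2
      linarith [show 22000 * M ^ 3 * (0 : ℝ) ^ 2 = 0 by ring]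
    refine (measure_mono ?_).trans ((hpar hd0).trans ?_)
    · rintro γ ⟨_, ⟨g1, g2⟩, g3, g4⟩
      have e1 : (u.1 * v.2 + u.2 * v.1) / 2 * γ.1 + u.2 * v.2 * γ.2 + u.1 * v.1 = Br γ u v := by
        unfold Br; ring
      have e2 : (u'.1 * v'.2 + u'.2 * v'.1) / 2 * γ.1 + u'.2 * v'.2 * γ.2 + u'.1 * v'.1 =
          Br γ u' v' := by
        unfold Br; ring
      exact ⟨by rw [e1]; exact ⟨g1, g2⟩, by rw [e2]; exact ⟨g3, g4⟩⟩
    · apply ofReal_le_tw hW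
      rw [max_eq_right (hC hC0), max_eq_right (hE hE0), sub_zero, abs_of_nonneg hY0]
      change Y * Y / |jac u v u' v'| * _ ≤ _
      set d := jac u v u' v' with hddef
      have hdp : 0 < |d| := abs_pos.2 hd0
      rw [div_mul_eq_mul_div, div_le_iff₀ hdp]
      have hCA : |C * A * (E * B)| = |A| * |B| * (|C| * |E|) := by
        simp only [abs_mul]; ring
      rw [hCA] at hj1
      have f1 : a * b * (a' * b') * (|C| * |E|) ≤ 17600000 * M ^ 6 * (|d| * |d|) := by
        calc a * b * (a' * b') * (|C| * |E|) ≤ 800 * M ^ 3 * (|A| * |B|) * (|C| * |E|) := by gcongr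
          _ = 800 * M ^ 3 * (|A| * |B| * (|C| * |E|)) := by ring
          _ ≤ 800 * M ^ 3 * (22000 * M ^ 3 * d ^ 2) := by gcongr
          _ = 17600000 * M ^ 6 * (|d| * |d|) := by rw [← sq_abs d]; ring
      have f2 : 17600000 * M ^ 6 ≤ badK M := by unfold badK; linarith [show 0 ≤ 6400 * M ^ 4 * (1 + 819200 * M ^ 4) ^ 2 by positivity]
      have hbK := (badK_pos hM).le
      calc Y * Y * (a * b * (a' * b') * (|C| * |E|)) ≤ Y * Y * (17600000 * M ^ 6 * (|d| * |d|)) := by gcongr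
        _ ≤ Y * Y * (badK M * (Tr * |d|)) := by gcongr
        _ = badK M * (Y ^ 2 * Tr + 0) * |d| := by ring
        _ ≤ badK M * (Y ^ 2 * Tr + Y * R ^ 2) * |d| := by
          have := (badK_pos hM).le
          gcongr; positivity
  · push Not at hcase
    set S := a * b + a' * b' with hS
    have hSp : 0 < S := by positivity
    have herr : |C * A| * Qr β v + |E * B| * Qr β u ≤ 16 * Y * (a * b) * S := by
      refine hcase.trans ?_
      rw [htr]
      have h1 : |δ ^ 2 * Br β u' v' + Br β u v * (C * E + A * B)| ≤
          δ ^ 2 * Y + Y * (|C| * |E| + |A| * |B|) := by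
        refine (abs_add_le _ _).trans (add_le_add ?_ ?_)
        · rw [abs_mul, abs_of_nonneg (sq_nonneg δ)]; gcongr
        · rw [abs_mul]
          apply mul_le_mul hB _ (abs_nonneg _) hY0
          rw [← abs_mul, ← abs_mul]; exact abs_add_le _ _
      have h2 : δ ^ 2 ≤ 4 * (a * b) ^ 2 := by
        rw [← sq_abs δ]
        calc |δ| ^ 2 ≤ (2 * (a * b)) ^ 2 := by gcongr
          _ = _ := by ring
      have h3 : |C| * |E| ≤ 4 * (a * b * (a' * b')) := by
        calc |C| * |E| ≤ (2 * (a * b')) * (2 * (b * a')) := by gcongr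
          _ = _ := by ring
      have h4 : |A| * |B| ≤ 4 * (a * b * (a' * b')) := by
        calc |A| * |B| ≤ (2 * (a * a')) * (2 * (b * b')) := by gcongr
          _ = _ := by ring
      calc 2 * |δ ^ 2 * Br β u' v' + Br β u v * (C * E + A * B)|
          ≤ 2 * (δ ^ 2 * Y + Y * (|C| * |E| + |A| * |B|)) := by gcongr
        _ ≤ 2 * (4 * (a * b) ^ 2 * Y + Y * (4 * (a * b * (a' * b')) + 4 * (a * b * (a' * b')))) := by
          gcongr
        _ ≤ 16 * Y * (a * b) * S := by
          rw [hS]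
          have : 0 ≤ Y * (a * b) ^ 2 := by positivity
          nlinarith
    have hA : a * a' ≤ 1600 * M ^ 3 * |A| := by
      have h1 : a * a' * (b * b') ≤ 1600 * M ^ 3 * |A| * (b * b') := by
        calc a * a' * (b * b') = a * b * (a' * b') := by ring
          _ ≤ 800 * M ^ 3 * (|A| * |B|) := hWAB
          _ ≤ 800 * M ^ 3 * (|A| * (2 * (b * b'))) := by gcongr
          _ = _ := by ring
      exact le_of_mul_le_mul_right h1 (by positivity)
    have hBb : b * b' ≤ 1600 * M ^ 3 * |B| := by
      have h1 : b * b' * (a * a') ≤ 1600 * M ^ 3 * |B| * (a * a') := by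
        calc b * b' * (a * a') = a * b * (a' * b') := by ring
          _ ≤ 800 * M ^ 3 * (|A| * |B|) := hWAB
          _ ≤ 800 * M ^ 3 * ((2 * (a * a')) * |B|) := by gcongr
          _ = _ := by ring
      exact le_of_mul_le_mul_right h1 (by positivity)
    have hCb : |C| * (a' * b) ≤ 409600 * M ^ 4 * Y * S := by
      have h0 : |C * A| * Qr β v ≤ 16 * Y * (a * b) * S := by
        have : 0 ≤ |E * B| * Qr β u := by positivity
        linarith
      have h1 : |C| * (a' * b) * (a * b) ≤ 409600 * M ^ 4 * Y * S * (a * b) := by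
        calc |C| * (a' * b) * (a * b) = |C| * (a * a') * b ^ 2 := by ring
          _ ≤ |C| * (1600 * M ^ 3 * |A|) * (16 * M * Qr β v) := by gcongr
          _ = 25600 * M ^ 4 * (|C * A| * Qr β v) := by rw [abs_mul]; ring
          _ ≤ 25600 * M ^ 4 * (16 * Y * (a * b) * S) := by gcongr
          _ = _ := by ring
      exact le_of_mul_le_mul_right h1 (by positivity)
    have hEb : |E| * (b' * a) ≤ 409600 * M ^ 4 * Y * S := by
      have h0 : |E * B| * Qr β u ≤ 16 * Y * (a * b) * S := by
        have : 0 ≤ |C * A| * Qr β v := by positivity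
        linarith
      have h1 : |E| * (b' * a) * (a * b) ≤ 409600 * M ^ 4 * Y * S * (a * b) := by
        calc |E| * (b' * a) * (a * b) = |E| * (b * b') * a ^ 2 := by ring
          _ ≤ |E| * (1600 * M ^ 3 * |B|) * (16 * M * Qr β u) := by gcongr
          _ = 25600 * M ^ 4 * (|E * B| * Qr β u) := by rw [abs_mul]; ring
          _ ≤ 25600 * M ^ 4 * (16 * Y * (a * b) * S) := by gcongr
          _ = _ := by ring
      exact le_of_mul_le_mul_right h1 (by positivity)
    set K2 := 409600 * M ^ 4 with hK2
    have hK2p : 0 < K2 := by positivity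
    have hR0 : 0 < R := by linarith
    have hmC : a' * b * max 1 |C| ≤ a' * b + K2 * Y * S := by
      have : max 1 |C| ≤ 1 + |C| := max_le (by linarith [abs_nonneg C]) (by linarith)
      calc a' * b * max 1 |C| ≤ a' * b * (1 + |C|) := by gcongr
        _ = a' * b + |C| * (a' * b) := by ring
        _ ≤ _ := by gcongr
    have hmE : b' * a * max 1 |E| ≤ b' * a + K2 * Y * S := by
      have : max 1 |E| ≤ 1 + |E| := max_le (by linarith [abs_nonneg E]) (by linarith)
      calc b' * a * max 1 |E| ≤ b' * a * (1 + |E|) := by gcongr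
        _ = b' * a + |E| * (b' * a) := by ring
        _ ≤ _ := by gcongr
    have hWmm : a * b * (a' * b') * (max 1 |C| * max 1 |E|) ≤
        (a' * b + K2 * Y * S) * (b' * a + K2 * Y * S) := by
      calc a * b * (a' * b') * (max 1 |C| * max 1 |E|) =
          (a' * b * max 1 |C|) * (b' * a * max 1 |E|) := by ring
        _ ≤ _ := by gcongr
    have hexp : ∀ T, 0 < T → S ≤ 2 * T → a * b * (a' * b') ≤ R ^ 2 * T →
        (a' * b + K2 * Y * S) * (b' * a + K2 * Y * S) ≤ (1 + 2 * K2) ^ 2 * R ^ 2 * T := by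
      intro T hT hST hWT
      have hS2 : S ≤ 2 * R ^ 2 := by
        have h1 : a * b ≤ R * R := by gcongr
        have h2 : a' * b' ≤ R * R := by gcongr
        rw [hS]; nlinarith
      have h1 : a' * b ≤ R ^ 2 := by rw [sq]; gcongr
      have h2 : b' * a ≤ R ^ 2 := by rw [sq]; gcongr
      have h3 : Y * S ≤ 2 * T := by
        calc Y * S ≤ 1 * S := by gcongr
          _ ≤ _ := by linarith
      have h4 : Y * S ≤ 2 * R ^ 2 := by
        calc Y * S ≤ 1 * S := by gcongr
          _ ≤ _ := by linarith
      calc (a' * b + K2 * Y * S) * (b' * a + K2 * Y * S) =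
          a * b * (a' * b') + K2 * (a' * b * (Y * S)) + K2 * (b' * a * (Y * S)) +
            K2 ^ 2 * ((Y * S) * (Y * S)) := by ring
        _ ≤ R ^ 2 * T + K2 * (R ^ 2 * (2 * T)) + K2 * (R ^ 2 * (2 * T)) +
            K2 ^ 2 * ((2 * R ^ 2) * (2 * T)) := by gcongr
        _ = _ := by ring
    have hfin : ∀ T, 0 < T → S ≤ 2 * T → a * b * (a' * b') ≤ R ^ 2 * T →
        6400 * M ^ 4 * Y / T * (a * b * (a' * b') * (max 1 |C| * max 1 |E|)) ≤
          badK M * (Y ^ 2 * Tr + Y * R ^ 2) := by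
      intro T hT hST hWT
      rw [div_mul_eq_mul_div, div_le_iff₀ hT]
      calc 6400 * M ^ 4 * Y * (a * b * (a' * b') * (max 1 |C| * max 1 |E|)) ≤
          6400 * M ^ 4 * Y * ((1 + 2 * K2) ^ 2 * R ^ 2 * T) := by
            exact mul_le_mul_of_nonneg_left (hWmm.trans (hexp T hT hST hWT)) (by positivity)
        _ = 6400 * M ^ 4 * (1 + 819200 * M ^ 4) ^ 2 * (0 + Y * R ^ 2) * T := by rw [hK2]; ring
        _ ≤ badK M * (Y ^ 2 * Tr + Y * R ^ 2) * T := by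
            unfold badK; gcongr
            · have : 0 ≤ 17600000 * M ^ 6 := by positivity
              linarith
            · positivity
    rcases le_total (a' * b') (a * b) with hab | hab
    · refine (measure_mono ?_).trans (hst.trans (ofReal_le_tw hW ?_))
      · rintro γ ⟨g0, g1, g2⟩; exact ⟨g0, g1⟩
      · refine hfin _ (by positivity) (by linarith) ?_
        have : a' * b' ≤ R ^ 2 := by rw [sq]; gcongr
        calc a * b * (a' * b') ≤ a * b * R ^ 2 := by gcongr
          _ = _ := by ring
    · refine (measure_mono ?_).trans (hst'.trans (ofReal_le_tw hW ?_))
      · rintro γ ⟨g0, g1, g2⟩; exact ⟨g0, g2⟩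
      · refine hfin _ (by positivity) (by linarith) ?_
        have : a * b ≤ R ^ 2 := by rw [sq]; gcongr
        gcongr

theorem Br_comm (β u v : ℝ × ℝ) : Br β u v = Br β v u := by unfold Br; ring

/-- Pairs with small Jacobian contribute little. -/
theorem bad_bound (hM : 1 ≤ M) {u v u' v' : ℝ × ℝ} {R Y Tr : ℝ}
    (hu : 1 ≤ ‖u‖) (hv : 1 ≤ ‖v‖) (hu' : 1 ≤ ‖u'‖) (hv' : 1 ≤ ‖v'‖)
    (huR : ‖u‖ ≤ R) (hvR : ‖v‖ ≤ R) (huR' : ‖u'‖ ≤ R) (hvR' : ‖v'‖ ≤ R)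
    (hY0 : 0 ≤ Y) (hY : Y ≤ 1 / (32 * M)) (hd : |jac u v u' v'| ≤ Tr)
    (hC : rd u v' ≠ 0 → 1 ≤ |rd u v'|) (hE : rd v u' ≠ 0 → 1 ≤ |rd v u'|)
    (hA : rd u u' ≠ 0 → 1 ≤ |rd u u'|) (hB : rd v v' ≠ 0 → 1 ≤ |rd v v'|) :
    volume {β | β ∈ Kp M ∧ (0 ≤ Br β u v ∧ Br β u v ≤ Y) ∧ (0 ≤ Br β u' v' ∧ Br β u' v' ≤ Y)} ≤
      ENNReal.ofReal (badK M * (Y ^ 2 * Tr + Y * R ^ 2) *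
        (tw u v' * tw v u' + tw u u' * tw v v')) := by
  have hTr : 0 ≤ Tr := (abs_nonneg _).trans hd
  have hK : 0 ≤ badK M * (Y ^ 2 * Tr + Y * R ^ 2) := by
    have := (badK_pos hM).le
    positivity
  have t1 : 0 ≤ tw u v' * tw v u' := mul_nonneg (tw_nonneg _ _) (tw_nonneg _ _)
  have t2 : 0 ≤ tw u u' * tw v v' := mul_nonneg (tw_nonneg _ _) (tw_nonneg _ _)
  rcases le_total |rd u v' * rd v u'| |rd u u' * rd v v'| with hle | hle
  · refine (bad_bound_half hM hu hv hu' hv' huR hvR huR' hvR' hY0 hY hd hC hE hle).trans ?_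
    apply ENNReal.ofReal_le_ofReal
    gcongr; linarith
  · have hd' : |jac u v v' u'| ≤ Tr := by
      have : jac u v v' u' = jac u v u' v' := by unfold jac; ring
      rw [this]; exact hd
    have := bad_bound_half hM hu hv hv' hu' huR hvR hvR' huR' hY0 hY hd' hA hB hle
    simp only [Br_comm _ v' u'] at this
    refine this.trans ?_
    apply ENNReal.ofReal_le_ofReal
    gcongr; linarith

end

/-- The value of the affine functional with coefficients `x` at `β`. -/
def aff (x : ℝ × ℝ × ℝ) (β : ℝ × ℝ) : ℝ := x.1 + x.2.1 * β.1 + x.2.2 * β.2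

/-- The determinant of the linear parts of two affine functionals. -/
def det2 (x y : ℝ × ℝ × ℝ) : ℝ := x.2.1 * y.2.2 - x.2.2 * y.2.1

/-- The set of parameters carrying the weights. -/
def K1 (M : ℝ) : Set (ℝ × ℝ) := Set.Icc (-(1 / 4)) (5 / 4) ×ˢ Set.Icc (3 / 4) (M - 1 / 4)

theorem det2_sub_le {x y x' y' : ℝ × ℝ × ℝ} {A H : ℝ} (hH : 0 ≤ H) (hA : 0 ≤ A)
    (hx' : ‖x'‖ ≤ A) (hy : ‖y‖ ≤ A) (hdx : ‖x - x'‖ ≤ H) (hdy : ‖y - y'‖ ≤ H) :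
    |det2 x y - det2 x' y'| ≤ 4 * A * H := by
  have c2 : ∀ z : ℝ × ℝ × ℝ, |z.2.1| ≤ ‖z‖ := fun z =>
    (le_max_left |z.2.1| |z.2.2|).trans (le_max_right |z.1| _)
  have c3 : ∀ z : ℝ × ℝ × ℝ, |z.2.2| ≤ ‖z‖ := fun z =>
    (le_max_right |z.2.1| |z.2.2|).trans (le_max_right |z.1| _)
  have e : det2 x y - det2 x' y' = (x - x').2.1 * y.2.2 + x'.2.1 * (y - y').2.2 +
      -((x - x').2.2 * y.2.1) + -(x'.2.2 * (y - y').2.1) := by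
    simp only [det2, Prod.fst_sub, Prod.snd_sub]; ring
  have key : ∀ p q P Q : ℝ, |p| ≤ P → |q| ≤ Q → 0 ≤ P → |p * q| ≤ P * Q := by
    intro p q P Q h1 h2 h3
    rw [abs_mul]; exact mul_le_mul h1 h2 (abs_nonneg _) h3
  rw [e]
  have k1 := key _ _ _ _ ((c2 _).trans hdx) ((c3 _).trans hy) hH
  have k2 := key _ _ _ _ ((c2 _).trans hx') ((c3 _).trans hdy) hA
  have k3 := key _ _ _ _ ((c3 _).trans hdx) ((c2 _).trans hy) hH
  have k4 := key _ _ _ _ ((c3 _).trans hx') ((c2 _).trans hdy) hA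
  rw [abs_le] at *
  constructor <;> linarith [k1.1, k1.2, k2.1, k2.2, k3.1, k3.2, k4.1, k4.2]

theorem aff_sub_le {M : ℝ} (hM : 1 ≤ M) {β : ℝ × ℝ} (hβ : β ∈ K1 M) {z : ℝ × ℝ × ℝ} {H : ℝ}
    (hz : ‖z‖ ≤ H) : |aff z β| ≤ H * (3 + M) := by
  have c1 : |z.1| ≤ H := (le_max_left |z.1| _).trans hz
  have c2 : |z.2.1| ≤ H := ((le_max_left |z.2.1| |z.2.2|).trans (le_max_right |z.1| _)).trans hz
  have c3 : |z.2.2| ≤ H := ((le_max_right |z.2.1| |z.2.2|).trans (le_max_right |z.1| _)).trans hz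
  obtain ⟨⟨b1, b2⟩, b3, b4⟩ := hβ
  have d1 : |β.1| ≤ 2 := by rw [abs_le]; constructor <;> linarith
  have d2 : |β.2| ≤ M := by rw [abs_le]; constructor <;> linarith
  have hH : 0 ≤ H := (abs_nonneg _).trans c1
  calc |aff z β| ≤ |z.1 + z.2.1 * β.1| + |z.2.2 * β.2| := abs_add_le _ _
    _ ≤ |z.1| + |z.2.1 * β.1| + |z.2.2 * β.2| := by gcongr; exact abs_add_le _ _
    _ = |z.1| + |z.2.1| * |β.1| + |z.2.2| * |β.2| := by rw [abs_mul, abs_mul]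
    _ ≤ H + H * 2 + H * M := by gcongr
    _ = _ := by ring

/-- Moving the coefficients of two transversal affine functionals moves the level sets by a small
affine map. -/
theorem coupling {M K s : ℝ} (hM : 1 ≤ M) (hs : 1 ≤ s) (hsK : 8 * K ^ 2 ≤ s)
    {x y x' y' : ℝ × ℝ × ℝ} (hx' : ‖x'‖ ≤ K * s ^ 4) (hy : ‖y‖ ≤ K * s ^ 4)
    (hy' : ‖y'‖ ≤ K * s ^ 4) (hdx : ‖x - x'‖ ≤ K * s ^ 2) (hdy : ‖y - y'‖ ≤ K * s ^ 2)
    (hd : s ^ 7 ≤ |det2 x y|) {f g : ℝ × ℝ → ENNReal} (hg : Measurable g)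
    (hf : ∀ β, f β ≠ 0 → β ∈ K1 M)
    (hfg : ∀ β β', β ∈ K1 M → ‖β' - β‖ ≤ 4 * K ^ 2 * (3 + M) / s → aff x' β' = aff x β →
      aff y' β' = aff y β → f β ≤ g β') :
    ∫⁻ β, f β ≤ ENNReal.ofReal (1 + 4 * K ^ 2 / s) * ∫⁻ β, g β := by
  have hs0 : 0 < s := by linarith
  have hKs : 0 ≤ K * s ^ 2 := (norm_nonneg _).trans hdx
  have hK : 0 ≤ K := by
    by_contra hc
    have : K * s ^ 2 < 0 := mul_neg_of_neg_of_pos (not_le.1 hc) (by positivity)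
    linarith
  have hdd := det2_sub_le hKs (by positivity) hx' hy hdx hdy
  set d := det2 x y with hd_def
  set d' := det2 x' y' with hd'_def
  have hdd2 : |d - d'| ≤ 4 * K ^ 2 / s * |d| := by
    refine hdd.trans ?_
    calc 4 * (K * s ^ 4) * (K * s ^ 2) = 4 * K ^ 2 / s * s ^ 7 := by field_simp
      _ ≤ _ := by gcongr
  have hsm : 4 * K ^ 2 / s ≤ 1 / 2 := by
    rw [div_le_div_iff₀ hs0 (by norm_num)]; linarith
  have hdpos : 0 < |d| := lt_of_lt_of_le (by positivity) hd
  have hd'1 : |d| / 2 ≤ |d'| := by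
    have h1 : |d - d'| ≤ 1 / 2 * |d| := hdd2.trans (by gcongr)
    have h2 := abs_sub_abs_le_abs_sub d d'
    linarith
  have hd'pos : 0 < |d'| := by linarith
  have hd0 : d ≠ 0 := abs_pos.1 hdpos
  have hd'0 : d' ≠ 0 := abs_pos.1 hd'pos
  have hratio : |d'| / |d| ≤ 1 + 4 * K ^ 2 / s := by
    rw [div_le_iff₀ hdpos]
    have h2 := abs_sub_abs_le_abs_sub d' d
    rw [abs_sub_comm] at h2
    linarith
  -- the affine map
  set a := 1 + ((x.2.1 - x'.2.1) * y'.2.2 - (y.2.1 - y'.2.1) * x'.2.2) / d' with ha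
  set b := ((x.2.2 - x'.2.2) * y'.2.2 - (y.2.2 - y'.2.2) * x'.2.2) / d' with hb
  set e := ((x.1 - x'.1) * y'.2.2 - (y.1 - y'.1) * x'.2.2) / d' with he
  set a₂ := (x'.2.1 * (y.2.1 - y'.2.1) - y'.2.1 * (x.2.1 - x'.2.1)) / d' with ha₂
  set b₂ := 1 + (x'.2.1 * (y.2.2 - y'.2.2) - y'.2.1 * (x.2.2 - x'.2.2)) / d' with hb₂
  set e₂ := (x'.2.1 * (y.1 - y'.1) - y'.2.1 * (x.1 - x'.1)) / d' with he₂
  have hdet : a * b₂ - b * a₂ = d / d' := by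
    have hd'e : d' = x'.2.1 * y'.2.2 - x'.2.2 * y'.2.1 := rfl
    have hde : d = x.2.1 * y.2.2 - x.2.2 * y.2.1 := rfl
    clear_value d d'
    have hz : d' * (a * b₂ - b * a₂) * d' = d * d' := by
      have t1 : d' * a = d' + ((x.2.1 - x'.2.1) * y'.2.2 - (y.2.1 - y'.2.1) * x'.2.2) := by
        rw [ha]; field_simp
      have t2 : b₂ * d' = d' + (x'.2.1 * (y.2.2 - y'.2.2) - y'.2.1 * (x.2.2 - x'.2.2)) := by
        rw [hb₂]; field_simp
      have t3 : d' * b = (x.2.2 - x'.2.2) * y'.2.2 - (y.2.2 - y'.2.2) * x'.2.2 := by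
        rw [hb]; field_simp
      have t4 : a₂ * d' = x'.2.1 * (y.2.1 - y'.2.1) - y'.2.1 * (x.2.1 - x'.2.1) := by
        rw [ha₂]; field_simp
      calc d' * (a * b₂ - b * a₂) * d' = (d' * a) * (b₂ * d') - (d' * b) * (a₂ * d') := by ring
        _ = d * d' := by rw [t1, t2, t3, t4, hd'e, hde]; ring
    field_simp
    have := mul_right_cancel₀ hd'0 hz
    linarith
  have hdet0 : a * b₂ - b * a₂ ≠ 0 := by rw [hdet]; exact div_ne_zero hd0 hd'0
  have hle : ∀ β : ℝ × ℝ, f β ≤ g (a * β.1 + b * β.2 + e, a₂ * β.1 + b₂ * β.2 + e₂) := by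
    intro β
    by_cases h0 : f β = 0
    · rw [h0]; exact zero_le
    have hβ := hf β h0
    have r1 := aff_sub_le hM hβ hdx
    have r2 := aff_sub_le hM hβ hdy
    set r := aff (x - x') β with hr
    set r' := aff (y - y') β with hr'
    have er : r = (x.1 - x'.1) + (x.2.1 - x'.2.1) * β.1 + (x.2.2 - x'.2.2) * β.2 := rfl
    have er' : r' = (y.1 - y'.1) + (y.2.1 - y'.2.1) * β.1 + (y.2.2 - y'.2.2) * β.2 := rfl
    have s1 : a * β.1 + b * β.2 + e = β.1 + (r * y'.2.2 - r' * x'.2.2) / d' := by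
      rw [ha, hb, he, er, er']; field_simp; ring
    have s2 : a₂ * β.1 + b₂ * β.2 + e₂ = β.2 + (x'.2.1 * r' - y'.2.1 * r) / d' := by
      rw [ha₂, hb₂, he₂, er, er']; field_simp; ring
    rw [s1, s2]
    have c2 : ∀ z : ℝ × ℝ × ℝ, |z.2.1| ≤ ‖z‖ := fun z =>
      (le_max_left |z.2.1| |z.2.2|).trans (le_max_right |z.1| _)
    have c3 : ∀ z : ℝ × ℝ × ℝ, |z.2.2| ≤ ‖z‖ := fun z =>
      (le_max_right |z.2.1| |z.2.2|).trans (le_max_right |z.1| _)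
    have hb1 : ∀ p q : ℝ, |p| ≤ K * s ^ 4 → |q| ≤ K * s ^ 4 →
        |(r * p - r' * q) / d'| ≤ 4 * K ^ 2 * (3 + M) / s := by
      intro p q hp hq
      rw [abs_div, div_le_iff₀ hd'pos]
      have h7 : s ^ 7 / 2 ≤ |d'| := by linarith
      calc |r * p - r' * q| ≤ |r * p| + |r' * q| := abs_sub _ _
        _ = |r| * |p| + |r'| * |q| := by rw [abs_mul, abs_mul]
        _ ≤ K * s ^ 2 * (3 + M) * (K * s ^ 4) + K * s ^ 2 * (3 + M) * (K * s ^ 4) := by gcongr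
        _ = 4 * K ^ 2 * (3 + M) / s * (s ^ 7 / 2) := by field_simp; ring
        _ ≤ _ := by gcongr
    apply hfg β _ hβ
    · have e1 : (β.1 + (r * y'.2.2 - r' * x'.2.2) / d', β.2 + (x'.2.1 * r' - y'.2.1 * r) / d') - β =
          ((r * y'.2.2 - r' * x'.2.2) / d', (x'.2.1 * r' - y'.2.1 * r) / d') := by
        ext <;> simp
      rw [e1, Prod.norm_def]
      apply max_le
      · exact hb1 _ _ ((c3 _).trans hy') ((c3 _).trans hx')
      · have := hb1 _ _ ((c2 _).trans hy') ((c2 _).trans hx')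
        have e3 : -((x'.2.1 * r' - y'.2.1 * r) / d') = (r * y'.2.1 - r' * x'.2.1) / d' := by ring
        rw [Real.norm_eq_abs, ← abs_neg, e3]
        exact this
    · have hd'e : d' = x'.2.1 * y'.2.2 - x'.2.2 * y'.2.1 := rfl
      have : aff x' (β.1 + (r * y'.2.2 - r' * x'.2.2) / d', β.2 + (x'.2.1 * r' - y'.2.1 * r) / d') =
          aff x' β + r * (x'.2.1 * y'.2.2 - x'.2.2 * y'.2.1) / d' := by
        simp only [aff]; field_simp; ring
      rw [this, ← hd'e, mul_div_cancel_right₀ _ hd'0, er]; simp only [aff]; ring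
    · have hd'e : d' = x'.2.1 * y'.2.2 - x'.2.2 * y'.2.1 := rfl
      have : aff y' (β.1 + (r * y'.2.2 - r' * x'.2.2) / d', β.2 + (x'.2.1 * r' - y'.2.1 * r) / d') =
          aff y' β + r' * (x'.2.1 * y'.2.2 - x'.2.2 * y'.2.1) / d' := by
        simp only [aff]; field_simp; ring
      rw [this, ← hd'e, mul_div_cancel_right₀ _ hd'0, er']; simp only [aff]; ring
  calc ∫⁻ β, f β ≤ ∫⁻ β : ℝ × ℝ, g (a * β.1 + b * β.2 + e, a₂ * β.1 + b₂ * β.2 + e₂) :=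
        lintegral_mono hle
    _ = ENNReal.ofReal |a * b₂ - b * a₂|⁻¹ * ∫⁻ β, g β := lintegral_affine a b a₂ b₂ e e₂ hdet0 g hg
    _ ≤ _ := by
      rw [hdet, abs_div, inv_div]
      gcongr

section Area

theorem volume_disc_real (t : ℝ) :
    volume {p : ℝ × ℝ | p.1 ^ 2 + p.2 ^ 2 ≤ t} = ENNReal.ofReal (Real.pi * t) ∧
    volume {p : ℝ × ℝ | p.1 ^ 2 + p.2 ^ 2 < t} = ENNReal.ofReal (Real.pi * t) := by
  rcases lt_or_ge t 0 with ht | ht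
  · have h1 : {p : ℝ × ℝ | p.1 ^ 2 + p.2 ^ 2 ≤ t} = ∅ := by
      ext p; simp only [Set.mem_ofPred_eq, Set.mem_empty_iff_false, iff_false, not_le]
      nlinarith [sq_nonneg p.1, sq_nonneg p.2]
    have h2 : {p : ℝ × ℝ | p.1 ^ 2 + p.2 ^ 2 < t} = ∅ := by
      ext p; simp only [Set.mem_ofPred_eq, Set.mem_empty_iff_false, iff_false, not_lt]
      nlinarith [sq_nonneg p.1, sq_nonneg p.2]
    rw [h1, h2, measure_empty, ENNReal.ofReal_of_nonpos
      (mul_nonpos_of_nonneg_of_nonpos Real.pi_pos.le ht.le)]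
    exact ⟨rfl, rfl⟩
  · have hmp := Complex.volume_preserving_equiv_real_prod
    have nrm : ∀ z : ℂ, z.re ^ 2 + z.im ^ 2 = ‖z‖ ^ 2 := fun z => by
      rw [Complex.sq_norm, Complex.normSq_apply]; ring
    have hst : Real.sqrt t ^ 2 = t := Real.sq_sqrt ht
    have e : ENNReal.ofReal (Real.sqrt t) ^ 2 * NNReal.pi = ENNReal.ofReal (Real.pi * t) := by
      rw [← ENNReal.ofReal_pow (Real.sqrt_nonneg t), hst, mul_comm Real.pi,
        ENNReal.ofReal_mul ht]
      congr 1
      rw [ENNReal.ofReal]; congr 1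
      ext; simp [NNReal.coe_real_pi, Real.pi_pos.le]
    constructor
    · rw [← hmp.measure_preimage_equiv]
      have : Complex.measurableEquivRealProd ⁻¹' {p : ℝ × ℝ | p.1 ^ 2 + p.2 ^ 2 ≤ t} =
          Metric.closedBall 0 (Real.sqrt t) := by
        ext z
        simp only [Set.mem_preimage, Set.mem_ofPred_eq, Complex.measurableEquivRealProd_apply,
          Metric.mem_closedBall, dist_zero_right]
        rw [nrm, Real.le_sqrt (norm_nonneg _) ht]
      rw [this, Complex.volume_closedBall, e]
    · rw [← hmp.measure_preimage_equiv]
      have : Complex.measurableEquivRealProd ⁻¹' {p : ℝ × ℝ | p.1 ^ 2 + p.2 ^ 2 < t} =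
          Metric.ball 0 (Real.sqrt t) := by
        ext z
        simp only [Set.mem_preimage, Set.mem_ofPred_eq, Complex.measurableEquivRealProd_apply,
          Metric.mem_ball, dist_zero_right]
        rw [nrm, Real.lt_sqrt (norm_nonneg _)]
      rw [this, Complex.volume_ball, e]

theorem Qr_measurable_right (β : ℝ × ℝ) : Measurable (Qr β) := by
  unfold Qr; fun_prop

/-- The area of the unit ellipse. -/
noncomputable def kap (β : ℝ × ℝ) : ℝ := 2 * Real.pi / Real.sqrt (disc β)

theorem volume_ellipse {β : ℝ × ℝ} (hβ : 0 < disc β) (t : ℝ) :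
    volume {p : ℝ × ℝ | Qr β p ≤ t} = ENNReal.ofReal (kap β * t) ∧
    volume {p : ℝ × ℝ | Qr β p < t} = ENNReal.ofReal (kap β * t) := by
  have hs : 0 < Real.sqrt (disc β) := Real.sqrt_pos.2 hβ
  have hq : ∀ p, Qr β p = (1 * p.1 + β.1 / 2 * p.2 + 0) ^ 2 +
      (0 * p.1 + Real.sqrt (disc β) / 2 * p.2 + 0) ^ 2 := by
    intro p
    have : (0 * p.1 + Real.sqrt (disc β) / 2 * p.2 + 0) ^ 2 = disc β / 4 * p.2 ^ 2 := by
      rw [show (0 * p.1 + Real.sqrt (disc β) / 2 * p.2 + 0) ^ 2 =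
        Real.sqrt (disc β) ^ 2 / 4 * p.2 ^ 2 by ring, Real.sq_sqrt hβ.le]
    rw [this]; unfold Qr disc; ring
  have key : ∀ S : Set (ℝ × ℝ), MeasurableSet S → volume {p : ℝ × ℝ |
      (1 * p.1 + β.1 / 2 * p.2 + 0, 0 * p.1 + Real.sqrt (disc β) / 2 * p.2 + 0) ∈ S} =
      ENNReal.ofReal (2 / Real.sqrt (disc β)) * volume S := by
    intro S hS
    have h := lintegral_affine 1 (β.1 / 2) 0 (Real.sqrt (disc β) / 2) 0 0
      (by simp; exact hs.ne') (S.indicator 1) (measurable_one.indicator hS)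
    have hm : Measurable fun p : ℝ × ℝ =>
      (1 * p.1 + β.1 / 2 * p.2 + 0, 0 * p.1 + Real.sqrt (disc β) / 2 * p.2 + 0) := by fun_prop
    rw [lintegral_indicator_one hS] at h
    have h2 : ∫⁻ p : ℝ × ℝ, S.indicator (1 : ℝ × ℝ → ENNReal)
        (1 * p.1 + β.1 / 2 * p.2 + 0, 0 * p.1 + Real.sqrt (disc β) / 2 * p.2 + 0) =
        volume ((fun p : ℝ × ℝ =>
      (1 * p.1 + β.1 / 2 * p.2 + 0, 0 * p.1 + Real.sqrt (disc β) / 2 * p.2 + 0)) ⁻¹' S) := by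
      rw [← lintegral_indicator_one (hm hS)]; rfl
    rw [h2] at h
    rw [show |1 * (Real.sqrt (disc β) / 2) - β.1 / 2 * 0|⁻¹ = 2 / Real.sqrt (disc β) by
      rw [mul_zero, sub_zero, one_mul, abs_of_pos (by positivity), inv_div]] at h
    exact h
  have e : ENNReal.ofReal (2 / Real.sqrt (disc β)) * ENNReal.ofReal (Real.pi * t) =
      ENNReal.ofReal (kap β * t) := by
    rw [← ENNReal.ofReal_mul (by positivity)]; congr 1; unfold kap; ring
  constructor
  · have := key {p | p.1 ^ 2 + p.2 ^ 2 ≤ t} (measurableSet_le (by fun_prop) measurable_const)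
    rw [(volume_disc_real t).1, e] at this
    rw [← this]; congr 1; ext p; simp only [Set.mem_ofPred_eq]; rw [hq]
  · have := key {p | p.1 ^ 2 + p.2 ^ 2 < t} (measurableSet_lt (by fun_prop) measurable_const)
    rw [(volume_disc_real t).2, e] at this
    rw [← this]; congr 1; ext p; simp only [Set.mem_ofPred_eq]; rw [hq]

theorem kap_nonneg (β : ℝ × ℝ) : 0 ≤ kap β := by unfold kap; positivity

theorem volume_annulus {β : ℝ × ℝ} (hβ : 0 < disc β) {s t : ℝ} (hs : 0 ≤ s) (hst : s ≤ t) :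
    volume {p : ℝ × ℝ | s ≤ Qr β p ∧ Qr β p ≤ t} = ENNReal.ofReal (kap β * (t - s)) := by
  have e : {p : ℝ × ℝ | s ≤ Qr β p ∧ Qr β p ≤ t} = {p | Qr β p ≤ t} \ {p | Qr β p < s} := by
    ext p; simp [and_comm]
  have hsub : {p | Qr β p < s} ⊆ {p | Qr β p ≤ t} := fun p hp => by
    simp only [Set.mem_ofPred_eq] at hp ⊢; linarith
  rw [e, measure_sdiff hsub
    (measurableSet_lt (Qr_measurable_right β) measurable_const).nullMeasurableSet
    (by rw [(volume_ellipse hβ s).2]; exact ENNReal.ofReal_ne_top),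
    (volume_ellipse hβ s).2, (volume_ellipse hβ t).1, mul_sub,
    ENNReal.ofReal_sub _ (mul_nonneg (kap_nonneg β) hs)]

theorem Qr_nonneg' {β : ℝ × ℝ} (hβ : 0 < disc β) (p : ℝ × ℝ) : 0 ≤ Qr β p := by
  have : Qr β p = (p.1 + β.1 / 2 * p.2) ^ 2 + disc β / 4 * p.2 ^ 2 := by unfold Qr disc; ring
  rw [this]; positivity

theorem volume_annulus_le {β : ℝ × ℝ} (hβ : 0 < disc β) {Y : ℝ} (hY : 0 ≤ Y) (t : ℝ) :
    volume {p : ℝ × ℝ | t - Y ≤ Qr β p ∧ Qr β p ≤ t} ≤ ENNReal.ofReal (kap β * Y) := by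
  rcases lt_or_ge t 0 with ht | ht
  · have : {p : ℝ × ℝ | t - Y ≤ Qr β p ∧ Qr β p ≤ t} = ∅ := by
      ext p; simp only [Set.mem_ofPred_eq, Set.mem_empty_iff_false, iff_false, not_and, not_le]
      intro _; exact ht.trans_le (Qr_nonneg' hβ p)
    rw [this]; simp
  · refine (measure_mono (t := {p : ℝ × ℝ | max 0 (t - Y) ≤ Qr β p ∧ Qr β p ≤ t}) ?_).trans ?_
    · rintro p ⟨h1, h2⟩; exact ⟨max_le (Qr_nonneg' hβ p) h1, h2⟩
    · rw [volume_annulus hβ (le_max_left _ _) (max_le ht (by linarith))]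
      apply ENNReal.ofReal_le_ofReal
      have := le_max_right 0 (t - Y)
      exact mul_le_mul_of_nonneg_left (by linarith) (kap_nonneg β)

end Area

/-- Coefficients of `Qr · p - Qr · p'` as an affine functional. -/
def cf (z : (ℝ × ℝ) × (ℝ × ℝ)) : ℝ × ℝ × ℝ :=
  (z.1.1 ^ 2 - z.2.1 ^ 2, z.1.1 * z.1.2 - z.2.1 * z.2.2, z.1.2 ^ 2 - z.2.2 ^ 2)

/-- Pairs of points with close values of the form. -/
def Om (X Y : ℝ) (β : ℝ × ℝ) : Set ((ℝ × ℝ) × (ℝ × ℝ)) :=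
  {z | Qr β z.1 ≤ X ∧ 0 ≤ aff (cf z) β ∧ aff (cf z) β ≤ Y}

theorem aff_cf (z : (ℝ × ℝ) × (ℝ × ℝ)) (β : ℝ × ℝ) : aff (cf z) β = Qr β z.1 - Qr β z.2 := by
  unfold aff cf Qr; ring

theorem aff_cf_eq_Br (z : (ℝ × ℝ) × (ℝ × ℝ)) (β : ℝ × ℝ) :
    aff (cf z) β = Br β (z.1 - z.2) (z.1 + z.2) := by
  unfold aff cf Br; simp only [Prod.fst_sub, Prod.snd_sub, Prod.fst_add, Prod.snd_add]; ring

theorem det2_cf (z z' : (ℝ × ℝ) × (ℝ × ℝ)) :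
    det2 (cf z) (cf z') = jac (z.1 - z.2) (z.1 + z.2) (z'.1 - z'.2) (z'.1 + z'.2) := by
  unfold det2 cf jac; simp only [Prod.fst_sub, Prod.snd_sub, Prod.fst_add, Prod.snd_add]; ring

theorem Om_measurableSet (X Y : ℝ) :
    MeasurableSet {q : (ℝ × ℝ) × ((ℝ × ℝ) × (ℝ × ℝ)) | q.2 ∈ Om X Y q.1} := by
  have h1 : Measurable fun q : (ℝ × ℝ) × ((ℝ × ℝ) × (ℝ × ℝ)) => Qr q.1 q.2.1 := by
    unfold Qr; fun_prop
  have h2 : Measurable fun q : (ℝ × ℝ) × ((ℝ × ℝ) × (ℝ × ℝ)) => aff (cf q.2) q.1 := by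
    unfold aff cf; fun_prop
  exact (measurableSet_le h1 measurable_const).inter
    ((measurableSet_le measurable_const h2).inter (measurableSet_le h2 measurable_const))

theorem Om_measurableSet_left (X Y : ℝ) (β : ℝ × ℝ) : MeasurableSet (Om X Y β) :=
  (measurable_const.prodMk measurable_id : Measurable fun z => (β, z)) (Om_measurableSet X Y)

/-- The expected density of pairs. -/
noncomputable def wt (β : ℝ × ℝ) : ℝ := 4 * Real.pi ^ 2 / disc β

theorem kap_mul_kap {β : ℝ × ℝ} (hβ : 0 < disc β) : kap β * kap β = wt β := by
  unfold kap wt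
  rw [div_mul_div_comm, Real.mul_self_sqrt hβ.le]; ring

theorem volume_Om_le {β : ℝ × ℝ} (hβ : 0 < disc β) {X Y : ℝ} (hY : 0 ≤ Y) :
    volume (Om X Y β) ≤ ENNReal.ofReal (wt β * X * Y) := by
  rw [Measure.volume_eq_prod, Measure.prod_apply (Om_measurableSet_left X Y β)]
  have hle : ∀ p, volume (Prod.mk p ⁻¹' Om X Y β) ≤
      {p | Qr β p ≤ X}.indicator (fun _ => ENNReal.ofReal (kap β * Y)) p := by
    intro p
    by_cases hp : Qr β p ≤ X
    · rw [Set.indicator_of_mem (show p ∈ {p | Qr β p ≤ X} from hp)]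
      refine (measure_mono ?_).trans (volume_annulus_le hβ hY (Qr β p))
      rintro p' ⟨_, h1, h2⟩
      rw [aff_cf] at h1 h2
      constructor <;> simp only at * <;> linarith
    · have : Prod.mk p ⁻¹' Om X Y β = ∅ := by
        ext p'; simp only [Set.mem_preimage, Set.mem_empty_iff_false, iff_false]
        exact fun h => hp h.1
      rw [this, measure_empty]; exact zero_le
  refine (lintegral_mono hle).trans ?_
  rw [lintegral_indicator_const (measurableSet_le (Qr_measurable_right β) measurable_const),
    (volume_ellipse hβ X).1, ← ENNReal.ofReal_mul (mul_nonneg (kap_nonneg β) hY), ← kap_mul_kap hβ]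
  apply ENNReal.ofReal_le_ofReal
  apply le_of_eq; ring

theorem le_volume_Om {β : ℝ × ℝ} (hβ : 0 < disc β) {X Y : ℝ} (hY : 0 ≤ Y) (hYX : Y ≤ X) :
    ENNReal.ofReal (wt β * (X - Y) * Y) ≤ volume (Om X Y β) := by
  rw [Measure.volume_eq_prod, Measure.prod_apply (Om_measurableSet_left X Y β)]
  have hle : ∀ p, {p | Y ≤ Qr β p ∧ Qr β p ≤ X}.indicator
      (fun _ => ENNReal.ofReal (kap β * Y)) p ≤ volume (Prod.mk p ⁻¹' Om X Y β) := by
    intro p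
    apply Set.indicator_le'
    · rintro p ⟨h1, h2⟩
      have := volume_annulus hβ (s := Qr β p - Y) (t := Qr β p) (by linarith) (by linarith)
      rw [sub_sub_cancel] at this
      rw [← this]
      apply measure_mono
      rintro p' ⟨h3, h4⟩
      refine ⟨h2, ?_⟩
      rw [aff_cf]
      constructor <;> simp only <;> linarith
    · intros; exact zero_le
  refine le_trans ?_ (lintegral_mono hle)
  have hm : MeasurableSet {p | Y ≤ Qr β p ∧ Qr β p ≤ X} :=
    (measurableSet_le measurable_const (Qr_measurable_right β)).inter
      (measurableSet_le (Qr_measurable_right β) measurable_const)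
  rw [lintegral_indicator_const hm, volume_annulus hβ hY hYX,
    ← ENNReal.ofReal_mul (mul_nonneg (kap_nonneg β) hY), ← kap_mul_kap hβ]
  apply ENNReal.ofReal_le_ofReal
  apply le_of_eq; ring

/-- The integer part of a point of `ℝ⁴`. -/
noncomputable def fl (z : (ℝ × ℝ) × (ℝ × ℝ)) : (ℤ × ℤ) × (ℤ × ℤ) :=
  ((⌊z.1.1⌋, ⌊z.1.2⌋), (⌊z.2.1⌋, ⌊z.2.2⌋))

/-- The inclusion of `ℤ⁴` in `ℝ⁴`. -/
def cz (P : (ℤ × ℤ) × (ℤ × ℤ)) : (ℝ × ℝ) × (ℝ × ℝ) :=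
  (((P.1.1 : ℝ), (P.1.2 : ℝ)), ((P.2.1 : ℝ), (P.2.2 : ℝ)))

theorem fl_measurable : Measurable fl := by
  unfold fl
  exact (((Int.measurable_floor.comp (measurable_fst.comp measurable_fst))).prodMk
    (Int.measurable_floor.comp (measurable_snd.comp measurable_fst))).prodMk
    ((Int.measurable_floor.comp (measurable_fst.comp measurable_snd)).prodMk
    (Int.measurable_floor.comp (measurable_snd.comp measurable_snd)))

theorem volume_fl_preimage (P : (ℤ × ℤ) × (ℤ × ℤ)) : volume (fl ⁻¹' {P}) = 1 := by
  have e : fl ⁻¹' {P} = (Set.Ico (P.1.1 : ℝ) (P.1.1 + 1) ×ˢ Set.Ico (P.1.2 : ℝ) (P.1.2 + 1)) ×ˢ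
      (Set.Ico (P.2.1 : ℝ) (P.2.1 + 1) ×ˢ Set.Ico (P.2.2 : ℝ) (P.2.2 + 1)) := by
    ext z
    simp only [fl, Set.mem_preimage, Set.mem_singleton_iff, Prod.ext_iff, Int.floor_eq_iff,
      Set.mem_prod, Set.mem_Ico]
  rw [e]
  simp only [Measure.volume_eq_prod, Measure.prod_prod, Real.volume_Ico]
  norm_num

/-- Sums over `ℤ⁴` as integrals over `ℝ⁴`. -/
theorem lintegral_fl (f : (ℤ × ℤ) × (ℤ × ℤ) → ENNReal) : ∫⁻ z, f (fl z) = ∑' P, f P := by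
  have hm : Measurable f := measurable_of_countable f
  rw [← lintegral_map hm fl_measurable, lintegral_countable']
  congr 1; ext P
  rw [Measure.map_apply fl_measurable (measurableSet_singleton P), volume_fl_preimage, mul_one]

theorem dist_cz_fl (z : (ℝ × ℝ) × (ℝ × ℝ)) :
    ‖z.1 - (cz (fl z)).1‖ ≤ 1 ∧ ‖z.2 - (cz (fl z)).2‖ ≤ 1 := by
  have h : ∀ x : ℝ, |x - ⌊x⌋| ≤ 1 := fun x => by
    rw [abs_of_nonneg (sub_nonneg.2 (Int.floor_le x))]
    linarith [Int.lt_floor_add_one x]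
  constructor
  · exact max_le (h _) (h _)
  · exact max_le (h _) (h _)

/-- Admissible weights: bounded, Lipschitz, supported in `K1 M`. -/
structure IsWt (M L : ℝ) (ω : ℝ × ℝ → ℝ) : Prop where
  meas : Measurable ω
  nonneg : ∀ β, 0 ≤ ω β
  le : ∀ β, ω β ≤ L
  supp : ∀ β, ω β ≠ 0 → β ∈ K1 M
  lip : ∀ β β', β ∈ K1 M → ‖β' - β‖ ≤ 1 / 8 → ω β ≤ ω β' + L * ‖β' - β‖

theorem mem_Kp_of_near {M : ℝ} {β β' : ℝ × ℝ} (hβ : β ∈ K1 M) (h : ‖β' - β‖ ≤ 1 / 8) :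
    β' ∈ Kp M := by
  obtain ⟨⟨b1, b2⟩, b3, b4⟩ := hβ
  have h1 := abs_le.1 ((abs_fst_le (β' - β)).trans h)
  have h2 := abs_le.1 ((abs_snd_le (β' - β)).trans h)
  rw [Prod.fst_sub] at h1
  rw [Prod.snd_sub] at h2
  refine ⟨⟨?_, ?_⟩, ?_, ?_⟩ <;> linarith [h1.1, h1.2, h2.1, h2.2]

theorem K1_subset_Kp (M : ℝ) : K1 M ⊆ Kp M := fun β hβ =>
  mem_Kp_of_near (β' := β) hβ (by simp)

theorem norm_triple_le {x : ℝ × ℝ × ℝ} {A : ℝ} (h1 : |x.1| ≤ A) (h2 : |x.2.1| ≤ A)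
    (h3 : |x.2.2| ≤ A) : ‖x‖ ≤ A := max_le h1 (max_le h2 h3)

theorem cf_sub_le {z z' : (ℝ × ℝ) × (ℝ × ℝ)} {A H : ℝ} (hz1 : ‖z.1‖ ≤ A) (hz2 : ‖z.2‖ ≤ A)
    (hz1' : ‖z'.1‖ ≤ A) (hz2' : ‖z'.2‖ ≤ A) (h1 : ‖z.1 - z'.1‖ ≤ H) (h2 : ‖z.2 - z'.2‖ ≤ H) :
    ‖cf z - cf z'‖ ≤ 4 * A * H := by
  have key : ∀ a b a' b' : ℝ, |a| ≤ A → |b'| ≤ A → |a - a'| ≤ H → |b - b'| ≤ H →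
      |a * b - a' * b'| ≤ 2 * A * H := by
    intro a b a' b' ha hb' hda hdb
    have hA : 0 ≤ A := (abs_nonneg _).trans ha
    have hH : 0 ≤ H := (abs_nonneg _).trans hda
    calc |a * b - a' * b'| = |a * (b - b') + (a - a') * b'| := by congr 1; ring
      _ ≤ |a| * |b - b'| + |a - a'| * |b'| := by
        rw [← abs_mul, ← abs_mul]; exact abs_add_le _ _
      _ ≤ A * H + H * A := by gcongr
      _ = _ := by ring
  have f1 := (abs_fst_le _).trans hz1
  have f2 := (abs_fst_le _).trans hz2
  have f1' := (abs_fst_le _).trans hz1'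
  have f2' := (abs_fst_le _).trans hz2'
  have s1' := (abs_snd_le _).trans hz1'
  have s2' := (abs_snd_le _).trans hz2'
  have s1 := (abs_snd_le _).trans hz1
  have s2 := (abs_snd_le _).trans hz2
  have d1 : |z.1.1 - z'.1.1| ≤ H := (abs_fst_le (z.1 - z'.1)).trans h1
  have d2 : |z.1.2 - z'.1.2| ≤ H := (abs_snd_le (z.1 - z'.1)).trans h1
  have d3 : |z.2.1 - z'.2.1| ≤ H := (abs_fst_le (z.2 - z'.2)).trans h2
  have d4 : |z.2.2 - z'.2.2| ≤ H := (abs_snd_le (z.2 - z'.2)).trans h2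
  have comb : ∀ a b a' b' : ℝ, |a - a'| ≤ 2 * A * H → |b - b'| ≤ 2 * A * H →
      |(a - b) - (a' - b')| ≤ 4 * A * H := by
    intro a b a' b' h h'
    rw [abs_le] at *
    constructor <;> linarith [h.1, h.2, h'.1, h'.2]
  apply norm_triple_le
  · simp only [cf, Prod.fst_sub, sq]
    exact comb _ _ _ _ (key _ _ _ _ f1 f1' d1 d1) (key _ _ _ _ f2 f2' d3 d3)
  · simp only [cf, Prod.fst_sub, Prod.snd_sub]
    exact comb _ _ _ _ (key _ _ _ _ f1 s1' d1 d2) (key _ _ _ _ f2 s2' d3 d4)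
  · simp only [cf, Prod.snd_sub, sq]
    exact comb _ _ _ _ (key _ _ _ _ s1 s1' d2 d2) (key _ _ _ _ s2 s2' d4 d4)

theorem cf_le {z : (ℝ × ℝ) × (ℝ × ℝ)} {A : ℝ} (hz1 : ‖z.1‖ ≤ A) (hz2 : ‖z.2‖ ≤ A) :
    ‖cf z‖ ≤ 4 * A ^ 2 := by
  have hA : 0 ≤ A := (norm_nonneg _).trans hz1
  have h := cf_sub_le (z' := 0) hz1 hz2 (by simpa using hA) (by simpa using hA)
    (by simpa using hz1) (by simpa using hz2)
  have h0 : cf 0 = 0 := by simp [cf]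
  rw [h0, sub_zero] at h
  linarith [show 4 * A ^ 2 = 4 * A * A by ring]

theorem norm_le_of_mem_Om {M s Y : ℝ} {β : ℝ × ℝ} {z : (ℝ × ℝ) × (ℝ × ℝ)} (hM : 1 ≤ M)
    (hβ : β ∈ Kp M) (hz : z ∈ Om (s ^ 4) Y β) :
    ‖z.1‖ ≤ 4 * M * s ^ 2 ∧ ‖z.2‖ ≤ 4 * M * s ^ 2 := by
  obtain ⟨h1, h2, h3⟩ := hz
  rw [aff_cf] at h2
  have key : ∀ p, Qr β p ≤ s ^ 4 → ‖p‖ ≤ 4 * M * s ^ 2 := by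
    intro p hp
    have h := norm_sq_le_Qr hM hβ p
    apply le_of_sq_le_sq _ (by positivity)
    have : 16 * M * Qr β p ≤ 16 * M * s ^ 4 := by gcongr
    have h5 : 16 * M * s ^ 4 ≤ 16 * M ^ 2 * s ^ 4 := by gcongr; nlinarith
    calc ‖p‖ ^ 2 ≤ 16 * M ^ 2 * s ^ 4 := by linarith
      _ = _ := by ring
  exact ⟨key _ h1, key _ (by linarith)⟩

theorem Qr_sub_le {β β' p : ℝ × ℝ} : |Qr β' p - Qr β p| ≤ 2 * ‖β' - β‖ * ‖p‖ ^ 2 := by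
  have e : Qr β' p - Qr β p = (β' - β).1 * (p.1 * p.2) + (β' - β).2 * (p.2 * p.2) := by
    simp only [Qr, Prod.fst_sub, Prod.snd_sub]; ring
  rw [e]
  calc _ ≤ |(β' - β).1| * (|p.1| * |p.2|) + |(β' - β).2| * (|p.2| * |p.2|) := by
        rw [← abs_mul p.1, ← abs_mul p.2, ← abs_mul, ← abs_mul]; exact abs_add_le _ _
    _ ≤ ‖β' - β‖ * (‖p‖ * ‖p‖) + ‖β' - β‖ * (‖p‖ * ‖p‖) := by
        gcongr <;> first | exact abs_fst_le _ | exact abs_snd_le _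
    _ = _ := by ring

/-- The constant controlling the displacement of level sets. -/
noncomputable def cplK (M : ℝ) : ℝ := 4 * (256 * M ^ 2) ^ 2 * (3 + M)

/-- The constant controlling the growth of the region. -/
noncomputable def omK (M : ℝ) : ℝ := 128 * M ^ 2 * cplK M + 32 * M * (3 + M)

theorem cplK_pos {M : ℝ} (hM : 1 ≤ M) : 0 < cplK M := by unfold cplK; positivity

theorem omK_pos {M : ℝ} (hM : 1 ≤ M) : 0 < omK M := by
  have := cplK_pos hM
  unfold omK; positivity

theorem norm_near {M s : ℝ} (hM : 1 ≤ M) (hs : 1 ≤ s) {p p' : ℝ × ℝ} (h : ‖p‖ ≤ 4 * M * s ^ 2)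
    (h' : ‖p - p'‖ ≤ 1) : ‖p'‖ ≤ 8 * M * s ^ 2 := by
  have e : p' = p - (p - p') := by abel
  have : ‖p'‖ ≤ ‖p‖ + ‖p - p'‖ := by
    conv_lhs => rw [e]
    exact norm_sub_le _ _
  have h1 : 1 ≤ 4 * M * s ^ 2 := by nlinarith [one_le_pow₀ hs (n := 2)]
  linarith

theorem Om_transfer {M s Y : ℝ} (hM : 1 ≤ M) (hs : 1 ≤ s)
    {β β' : ℝ × ℝ} (hβ : β ∈ K1 M) (hd : ‖β' - β‖ ≤ cplK M / s)
    {z z' : (ℝ × ℝ) × (ℝ × ℝ)} (hz : z ∈ Om (s ^ 4) Y β) (h1 : ‖z.1 - z'.1‖ ≤ 1)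
    (haff : aff (cf z') β' = aff (cf z) β) : z' ∈ Om (s ^ 4 + omK M * s ^ 3) Y β' := by
  have hs0 : 0 < s := by linarith
  obtain ⟨n1, n2⟩ := norm_le_of_mem_Om hM (K1_subset_Kp M hβ) hz
  have n1' := norm_near hM hs n1 h1
  have hc := cplK_pos hM
  obtain ⟨g1, g2, g3⟩ := hz
  refine ⟨?_, by rw [haff]; exact g2, by rw [haff]; exact g3⟩
  have a1 : |Qr β' z'.1 - Qr β z'.1| ≤ 128 * M ^ 2 * cplK M * s ^ 3 := by
    refine Qr_sub_le.trans ?_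
    calc 2 * ‖β' - β‖ * ‖z'.1‖ ^ 2 ≤ 2 * (cplK M / s) * (8 * M * s ^ 2) ^ 2 := by gcongr
      _ = _ := by field_simp; ring
  have a2 : |Qr β z'.1 - Qr β z.1| ≤ 32 * M * (3 + M) * s ^ 3 := by
    have hle := n1.trans (show 4 * M * s ^ 2 ≤ 8 * M * s ^ 2 by gcongr; norm_num)
    have hn : ‖cf (z'.1, z.1)‖ ≤ 32 * M * s ^ 2 := by
      have h1' : ‖z'.1 - z.1‖ ≤ 1 := by rw [norm_sub_rev]; exact h1
      have := cf_sub_le (z := (z'.1, z.1)) (z' := (z.1, z.1)) n1' hle hle hle h1'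
        (by simp)
      have h0 : cf (z.1, z.1) = 0 := by simp [cf]
      rw [h0, sub_zero] at this
      linarith
    have := aff_sub_le hM hβ hn
    rw [aff_cf] at this
    refine this.trans ?_
    have : s ^ 2 ≤ s ^ 3 := pow_le_pow_right₀ hs (by norm_num)
    calc 32 * M * s ^ 2 * (3 + M) = 32 * M * (3 + M) * s ^ 2 := by ring
      _ ≤ _ := by gcongr
  have := (abs_le.1 a1).2
  have := (abs_le.1 a2).2
  have e : omK M * s ^ 3 = 128 * M ^ 2 * cplK M * s ^ 3 + 32 * M * (3 + M) * s ^ 3 := by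
    unfold omK; ring
  linarith

/-- Pairs of integer points not differing by a sign. -/
def NZ : Set ((ℤ × ℤ) × (ℤ × ℤ)) := {P | P.1 - P.2 ≠ 0 ∧ P.1 + P.2 ≠ 0}

/-- The indicator function of integer points of `Om`. -/
noncomputable def og (X Y : ℝ) (P : (ℤ × ℤ) × (ℤ × ℤ)) (β : ℝ × ℝ) : ENNReal :=
  {β | P ∈ NZ ∧ cz P ∈ Om X Y β}.indicator 1 β

/-- The number of integer points of `Om`. -/
noncomputable def Gf (X Y : ℝ) (β : ℝ × ℝ) : ENNReal := ∑' P, og X Y P β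

theorem og_measurable (X Y : ℝ) (P : (ℤ × ℤ) × (ℤ × ℤ)) : Measurable (og X Y P) := by
  apply measurable_one.indicator
  apply MeasurableSet.inter (MeasurableSet.const _)
  exact (measurable_id.prodMk measurable_const : Measurable fun β => (β, cz P))
    (Om_measurableSet X Y)

theorem Gf_measurable (X Y : ℝ) : Measurable (Gf X Y) :=
  Measurable.tsum (og_measurable X Y)

theorem og_ne_zero {X Y : ℝ} {P : (ℤ × ℤ) × (ℤ × ℤ)} {β : ℝ × ℝ} (h : og X Y P β ≠ 0) :
    P ∈ NZ ∧ cz P ∈ Om X Y β := by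
  by_contra hc
  exact h (Set.indicator_of_notMem (s := {β | P ∈ NZ ∧ cz P ∈ Om X Y β}) hc _)

theorem og_le_one (X Y : ℝ) (P : (ℤ × ℤ) × (ℤ × ℤ)) (β : ℝ × ℝ) : og X Y P β ≤ 1 :=
  Set.indicator_le' (fun _ _ => le_rfl) (fun _ _ => zero_le) β

/-- The indicator function of real points of `Om`. -/
noncomputable def oi (X Y : ℝ) (z : (ℝ × ℝ) × (ℝ × ℝ)) (β : ℝ × ℝ) : ENNReal :=
  (Om X Y β).indicator 1 z

theorem oi_of_mem {X Y : ℝ} {z : (ℝ × ℝ) × (ℝ × ℝ)} {β : ℝ × ℝ} (h : z ∈ Om X Y β) :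
    oi X Y z β = 1 := Set.indicator_of_mem h _

theorem oi_measurable (X Y : ℝ) :
    Measurable fun q : (ℝ × ℝ) × ((ℝ × ℝ) × (ℝ × ℝ)) => oi X Y q.2 q.1 := by
  have : (fun q : (ℝ × ℝ) × ((ℝ × ℝ) × (ℝ × ℝ)) => oi X Y q.2 q.1) =
      {q : (ℝ × ℝ) × ((ℝ × ℝ) × (ℝ × ℝ)) | q.2 ∈ Om X Y q.1}.indicator 1 := by
    ext q; rfl
  rw [this]
  exact measurable_one.indicator (Om_measurableSet X Y)

/-- The bounding weight. -/
noncomputable def bw (M L s : ℝ) (ω : ℝ × ℝ → ℝ) (β : ℝ × ℝ) : ENNReal :=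
  (Kp M).indicator (fun β => ENNReal.ofReal (ω β + L * (cplK M / s))) β

theorem Kp_measurableSet (M : ℝ) : MeasurableSet (Kp M) := measurableSet_Icc.prod measurableSet_Icc

theorem bw_measurable (M L s : ℝ) {ω : ℝ × ℝ → ℝ} (hω : Measurable ω) :
    Measurable (bw M L s ω) :=
  (hω.add_const _).ennreal_ofReal.indicator (Kp_measurableSet M)

theorem wt_le_bw {M L s : ℝ} {ω : ℝ × ℝ → ℝ} (hL : 0 ≤ L) (hω : IsWt M L ω)
    (hs8 : cplK M / s ≤ 1 / 8) {β β' : ℝ × ℝ} (hβ : β ∈ K1 M) (hd : ‖β' - β‖ ≤ cplK M / s) :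
    ENNReal.ofReal (ω β) ≤ bw M L s ω β' := by
  unfold bw
  rw [Set.indicator_of_mem (mem_Kp_of_near hβ (hd.trans hs8))]
  apply ENNReal.ofReal_le_ofReal
  have := hω.lip β β' hβ (hd.trans hs8)
  have h2 : L * ‖β' - β‖ ≤ L * (cplK M / s) := by gcongr
  linarith

theorem good_pair {M L s Y : ℝ} {ω : ℝ × ℝ → ℝ} (hM : 1 ≤ M) (hL : 0 ≤ L) (hω : IsWt M L ω)
    (hs : 8 * cplK M ≤ s) (z z' : (ℝ × ℝ) × (ℝ × ℝ))
    (hd : s ^ 7 ≤ |det2 (cf (cz (fl z))) (cf (cz (fl z')))|) :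
    ∫⁻ β, og (s ^ 4) Y (fl z) β * og (s ^ 4) Y (fl z') β * ENNReal.ofReal (ω β) ≤
      ENNReal.ofReal (1 + cplK M / s) * ∫⁻ β, oi (s ^ 4 + omK M * s ^ 3) Y z β *
        oi (s ^ 4 + omK M * s ^ 3) Y z' β * bw M L s ω β := by
  by_cases hne : ∃ β, og (s ^ 4) Y (fl z) β * og (s ^ 4) Y (fl z') β * ENNReal.ofReal (ω β) ≠ 0
  swap
  · push Not at hne
    simp only [hne, lintegral_zero]; exact zero_le
  obtain ⟨β₀, hβ₀⟩ := hne
  have hc := cplK_pos hM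
  have hsK : 8 * (256 * M ^ 2) ^ 2 ≤ s := by
    refine le_trans ?_ hs
    unfold cplK
    nlinarith [show 0 ≤ (256 * M ^ 2) ^ 2 * (3 + M) - (256 * M ^ 2) ^ 2 by
      nlinarith [sq_nonneg (256 * M ^ 2)]]
  have hs1 : 1 ≤ s := by
    refine le_trans ?_ hsK
    nlinarith [one_le_pow₀ hM (n := 4)]
  have hs0 : 0 < s := by linarith
  have hs8 : cplK M / s ≤ 1 / 8 := by
    rw [div_le_div_iff₀ hs0 (by norm_num)]; linarith
  have supp : ∀ β, og (s ^ 4) Y (fl z) β * og (s ^ 4) Y (fl z') β * ENNReal.ofReal (ω β) ≠ 0 →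
      cz (fl z) ∈ Om (s ^ 4) Y β ∧ cz (fl z') ∈ Om (s ^ 4) Y β ∧ β ∈ K1 M := by
    intro β h
    have h1 := left_ne_zero_of_mul h
    have h2 := right_ne_zero_of_mul h
    refine ⟨(og_ne_zero (left_ne_zero_of_mul h1)).2, (og_ne_zero (right_ne_zero_of_mul h1)).2,
      hω.supp β fun h0 => h2 (by rw [h0]; simp)⟩
  obtain ⟨p1, p2, p3⟩ := supp β₀ hβ₀
  obtain ⟨m1, m2⟩ := norm_le_of_mem_Om hM (K1_subset_Kp M p3) p1
  obtain ⟨m1', m2'⟩ := norm_le_of_mem_Om hM (K1_subset_Kp M p3) p2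
  obtain ⟨d1, d2⟩ := dist_cz_fl z
  obtain ⟨d1', d2'⟩ := dist_cz_fl z'
  rw [norm_sub_rev] at d1 d2 d1' d2'
  have hw : 4 * M * s ^ 2 ≤ 8 * M * s ^ 2 := by gcongr; norm_num
  have q1 := norm_near hM hs1 m1 d1
  have q2 := norm_near hM hs1 m2 d2
  have q1' := norm_near hM hs1 m1' d1'
  have q2' := norm_near hM hs1 m2' d2'
  have big : 4 * (8 * M * s ^ 2) ^ 2 ≤ 256 * M ^ 2 * s ^ 4 := le_of_eq (by ring)
  have small : 4 * (8 * M * s ^ 2) * 1 ≤ 256 * M ^ 2 * s ^ 2 := by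
    have : M ≤ M ^ 2 := by nlinarith
    have h2 : 0 ≤ s ^ 2 := by positivity
    nlinarith [mul_le_mul_of_nonneg_right this h2, mul_nonneg (by linarith : 0 ≤ M) h2]
  have hfac : ENNReal.ofReal (1 + 4 * (256 * M ^ 2) ^ 2 / s) ≤ ENNReal.ofReal (1 + cplK M / s) := by
    apply ENNReal.ofReal_le_ofReal
    gcongr
    unfold cplK
    nlinarith [show 0 ≤ (256 * M ^ 2) ^ 2 * (3 + M) - (256 * M ^ 2) ^ 2 by
      nlinarith [sq_nonneg (256 * M ^ 2)]]
  refine (coupling (K := 256 * M ^ 2) (x := cf (cz (fl z))) (y := cf (cz (fl z'))) (x' := cf z)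
    (y' := cf z') hM hs1 hsK ((cf_le q1 q2).trans big)
    ((cf_le (m1'.trans hw) (m2'.trans hw)).trans big) ((cf_le q1' q2').trans big)
    ((cf_sub_le (m1.trans hw) (m2.trans hw) q1 q2 d1 d2).trans small)
    ((cf_sub_le (m1'.trans hw) (m2'.trans hw) q1' q2' d1' d2').trans small) hd
    (g := fun β => oi (s ^ 4 + omK M * s ^ 3) Y z β *
        oi (s ^ 4 + omK M * s ^ 3) Y z' β * bw M L s ω β)
    ?_ (fun β h => (supp β h).2.2) ?_).trans (mul_le_mul_left hfac _)
  · have hmeas : ∀ z, Measurable fun β => oi (s ^ 4 + omK M * s ^ 3) Y z β := fun z =>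
      (oi_measurable _ _).comp (measurable_id.prodMk measurable_const : Measurable fun β => (β, z))
    exact ((hmeas z).mul (hmeas z')).mul (bw_measurable M L s hω.meas)
  · intro β β' hβ hd' e1 e2
    by_cases h0 : og (s ^ 4) Y (fl z) β * og (s ^ 4) Y (fl z') β * ENNReal.ofReal (ω β) = 0
    · rw [h0]; exact zero_le
    obtain ⟨r1, r2, _⟩ := supp β h0
    rw [oi_of_mem (Om_transfer hM hs1 hβ hd' r1 d1 e1),
      oi_of_mem (Om_transfer hM hs1 hβ hd' r2 d1' e2), one_mul, one_mul]
    calc _ ≤ 1 * 1 * ENNReal.ofReal (ω β) := by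
          gcongr <;> exact og_le_one _ _ _ _
      _ = ENNReal.ofReal (ω β) := by rw [one_mul, one_mul]
      _ ≤ _ := wt_le_bw hL hω hs8 hβ hd'

/-- Correlation of two pairs of integer points. -/
noncomputable def Jc (X Y : ℝ) (ω : ℝ × ℝ → ℝ) (P P' : (ℤ × ℤ) × (ℤ × ℤ)) : ENNReal :=
  ∫⁻ β, og X Y P β * og X Y P' β * ENNReal.ofReal (ω β)

theorem lintegral_Gf_sq (X Y : ℝ) {ω : ℝ × ℝ → ℝ} (hω : Measurable ω) :
    ∫⁻ β, Gf X Y β * Gf X Y β * ENNReal.ofReal (ω β) = ∑' P, ∑' P', Jc X Y ω P P' := by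
  have e : ∀ β, Gf X Y β * Gf X Y β * ENNReal.ofReal (ω β) =
      ∑' P, ∑' P', og X Y P β * og X Y P' β * ENNReal.ofReal (ω β) := by
    intro β
    unfold Gf
    rw [← ENNReal.tsum_mul_right, ← ENNReal.tsum_mul_right]
    congr 1; ext P
    rw [← ENNReal.tsum_mul_left, ← ENNReal.tsum_mul_right]
  have hm : ∀ P P', Measurable fun β => og X Y P β * og X Y P' β * ENNReal.ofReal (ω β) :=
    fun P P' => ((og_measurable X Y P).mul (og_measurable X Y P')).mul hω.ennreal_ofReal
  simp only [e]
  rw [lintegral_tsum fun P => (Measurable.tsum (hm P)).aemeasurable]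
  congr 1; ext P
  rw [lintegral_tsum fun P' => (hm P P').aemeasurable]
  rfl

theorem lintegral_oi (X Y : ℝ) (β : ℝ × ℝ) : ∫⁻ z, oi X Y z β = volume (Om X Y β) := by
  unfold oi
  exact lintegral_indicator_one (Om_measurableSet_left X Y β)

theorem lintegral_kernel_sq {E B : Type*} [MeasurableSpace E] [MeasurableSpace B]
    {μ : Measure E} {ν : Measure B} [SFinite μ] [SFinite ν] {k : E → B → ENNReal}
    (hk : Measurable (Function.uncurry k)) {g : B → ENNReal} (hg : Measurable g) :
    ∫⁻ z, ∫⁻ z', ∫⁻ β, k z β * k z' β * g β ∂ν ∂μ ∂μ =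
      ∫⁻ β, (∫⁻ z, k z β ∂μ) * (∫⁻ z, k z β ∂μ) * g β ∂ν := by
  have h1 : ∀ z, Measurable fun β => k z β := fun z => hk.comp (measurable_const.prodMk measurable_id)
  have h2 : ∀ β, Measurable fun z => k z β := fun β => hk.comp (measurable_id.prodMk measurable_const)
  have hV : Measurable fun β => ∫⁻ z, k z β ∂μ := hk.lintegral_prod_left'
  have inner : ∀ z, ∫⁻ z', ∫⁻ β, k z β * k z' β * g β ∂ν ∂μ =
      ∫⁻ β, k z β * ((∫⁻ z, k z β ∂μ) * g β) ∂ν := by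
    intro z
    rw [lintegral_lintegral_swap]
    · congr 1; ext β
      have : ∀ z', k z β * k z' β * g β = (k z β * g β) * k z' β := by
        intro z'; ring
      simp only [this]
      rw [lintegral_const_mul _ (h2 β)]; ring
    · exact ((((h1 z).comp measurable_snd).mul hk).mul (hg.comp measurable_snd)).aemeasurable
  simp only [inner]
  rw [lintegral_lintegral_swap]
  · congr 1; ext β
    rw [lintegral_mul_const _ (h2 β)]; ring
  · exact (hk.mul ((hV.mul hg).comp measurable_snd)).aemeasurable

theorem lintegral_oi_oi (X Y : ℝ) {g : ℝ × ℝ → ENNReal} (hg : Measurable g) :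
    ∫⁻ z, ∫⁻ z', ∫⁻ β, oi X Y z β * oi X Y z' β * g β =
      ∫⁻ β, volume (Om X Y β) * volume (Om X Y β) * g β := by
  have hk : Measurable (Function.uncurry (oi X Y)) :=
    (oi_measurable X Y).comp (measurable_snd.prodMk measurable_fst)
  rw [lintegral_kernel_sq hk hg]
  simp only [lintegral_oi]

/-- Transversal pairs of integer points. -/
def GP (s : ℝ) : Set (((ℤ × ℤ) × (ℤ × ℤ)) × ((ℤ × ℤ) × (ℤ × ℤ))) :=
  {q | s ^ 7 ≤ |det2 (cf (cz q.1)) (cf (cz q.2))|}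

theorem wt_nonneg {M : ℝ} {β : ℝ × ℝ} (hβ : β ∈ Kp M) : 0 ≤ wt β := by
  have := disc_lower hβ
  unfold wt; positivity

theorem wt_le {M : ℝ} {β : ℝ × ℝ} (hβ : β ∈ Kp M) : wt β ≤ 160 := by
  have := disc_lower hβ
  unfold wt
  rw [div_le_iff₀ (by linarith)]
  have := Real.pi_lt_d2
  have := Real.pi_pos
  nlinarith

theorem good_sum {M L s Y : ℝ} {ω : ℝ × ℝ → ℝ} (hM : 1 ≤ M) (hL : 0 ≤ L) (hω : IsWt M L ω)
    (hs : 8 * cplK M ≤ s) (hY : 0 ≤ Y) :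
    ∑' P, ∑' P', (GP s).indicator (fun q => Jc (s ^ 4) Y ω q.1 q.2) (P, P') ≤
      ENNReal.ofReal ((1 + cplK M / s) * (s ^ 4 + omK M * s ^ 3) ^ 2 * Y ^ 2) *
        ((∫⁻ β, ENNReal.ofReal (wt β ^ 2 * ω β)) +
          ENNReal.ofReal (160 ^ 2 * L * cplK M * (2 * M) / s)) := by
  have hc := cplK_pos hM
  have ho := omK_pos hM
  have hs0 : 0 < s := by linarith
  set X' := s ^ 4 + omK M * s ^ 3 with hX'
  have hX'0 : 0 ≤ X' := by positivity
  have hbw := bw_measurable M L s hω.meas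
  have e1 : ∑' P, ∑' P', (GP s).indicator (fun q => Jc (s ^ 4) Y ω q.1 q.2) (P, P') =
      ∫⁻ z, ∫⁻ z', (GP s).indicator (fun q => Jc (s ^ 4) Y ω q.1 q.2) (fl z, fl z') := by
    rw [← lintegral_fl]
    congr 1; ext z
    rw [← lintegral_fl]
  rw [e1]
  have e2 : ∀ z z', (GP s).indicator (fun q => Jc (s ^ 4) Y ω q.1 q.2) (fl z, fl z') ≤
      ENNReal.ofReal (1 + cplK M / s) * ∫⁻ β, oi X' Y z β * oi X' Y z' β * bw M L s ω β := by
    intro z z'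
    by_cases h : (fl z, fl z') ∈ GP s
    · rw [Set.indicator_of_mem h]
      exact good_pair hM hL hω hs z z' h
    · rw [Set.indicator_of_notMem h]; exact zero_le
  have hfin : ENNReal.ofReal (1 + cplK M / s) ≠ ⊤ := ENNReal.ofReal_ne_top
  calc _ ≤ ∫⁻ z, ∫⁻ z', ENNReal.ofReal (1 + cplK M / s) *
        ∫⁻ β, oi X' Y z β * oi X' Y z' β * bw M L s ω β :=
        lintegral_mono fun z => lintegral_mono fun z' => e2 z z'
    _ = ENNReal.ofReal (1 + cplK M / s) *
        ∫⁻ β, volume (Om X' Y β) * volume (Om X' Y β) * bw M L s ω β := by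
        rw [← lintegral_oi_oi X' Y hbw, ← lintegral_const_mul' _ _ hfin]
        congr 1; ext z
        rw [lintegral_const_mul' _ _ hfin]
    _ ≤ ENNReal.ofReal (1 + cplK M / s) * ∫⁻ β, ENNReal.ofReal (X' ^ 2 * Y ^ 2) *
        (ENNReal.ofReal (wt β ^ 2 * ω β) +
          (Kp M).indicator (fun _ => ENNReal.ofReal (160 ^ 2 * L * cplK M / s)) β) := by
        refine mul_le_mul_right (lintegral_mono fun β => ?_) _
        by_cases hβ : β ∈ Kp M
        · have hv := volume_Om_le (β := β) (by linarith [disc_lower hβ]) (X := X') hY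
          have hw0 := wt_nonneg hβ
          have hw1 := wt_le hβ
          have hn := hω.nonneg β
          unfold bw
          rw [Set.indicator_of_mem hβ, Set.indicator_of_mem hβ]
          calc _ ≤ ENNReal.ofReal (wt β * X' * Y) * ENNReal.ofReal (wt β * X' * Y) *
                ENNReal.ofReal (ω β + L * (cplK M / s)) := by gcongr
            _ = ENNReal.ofReal (X' ^ 2 * Y ^ 2) *
                ENNReal.ofReal (wt β ^ 2 * (ω β + L * (cplK M / s))) := by
              rw [← ENNReal.ofReal_mul (by positivity), ← ENNReal.ofReal_mul (by positivity),
                ← ENNReal.ofReal_mul (by positivity)]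
              congr 1; ring
            _ ≤ _ := by
              rw [← ENNReal.ofReal_add (by positivity) (by positivity)]
              gcongr
              have : wt β ^ 2 ≤ 160 ^ 2 := by gcongr
              have h3 : 0 ≤ L * (cplK M / s) := by positivity
              calc wt β ^ 2 * (ω β + L * (cplK M / s)) =
                  wt β ^ 2 * ω β + wt β ^ 2 * (L * (cplK M / s)) := by ring
                _ ≤ wt β ^ 2 * ω β + 160 ^ 2 * (L * (cplK M / s)) := by gcongr
                _ = _ := by ring
        · unfold bw
          rw [Set.indicator_of_notMem hβ, mul_zero]; exact zero_le
    _ ≤ _ := by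
      have hm1 : Measurable fun β => ENNReal.ofReal (wt β ^ 2 * ω β) := by
        have : Measurable wt := by unfold wt disc; fun_prop
        exact ((this.pow_const 2).mul hω.meas).ennreal_ofReal
      rw [lintegral_const_mul' _ _ ENNReal.ofReal_ne_top, ← mul_assoc,
        ← ENNReal.ofReal_mul (by positivity), ← mul_assoc (1 + cplK M / s), lintegral_add_left hm1,
        lintegral_indicator_const (Kp_measurableSet M)]
      gcongr
      calc _ ≤ ENNReal.ofReal (160 ^ 2 * L * cplK M / s) * ENNReal.ofReal (2 * M) := by
            gcongr; exact volume_Kp_le M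
        _ = _ := by
            rw [← ENNReal.ofReal_mul (by positivity)]; congr 1; ring

/-- The inclusion of `ℤ²` in `ℝ²`. -/
def ci (w : ℤ × ℤ) : ℝ × ℝ := ((w.1 : ℝ), (w.2 : ℝ))

theorem norm_ci (w : ℤ × ℤ) : ‖ci w‖ = vn w := by
  unfold ci vn
  rw [Prod.norm_def]
  simp only [Real.norm_eq_abs, Nat.cast_max, Nat.cast_natAbs, Int.cast_abs]

theorem rd_ci (w z : ℤ × ℤ) : rd (ci w) (ci z) = dt w z := by
  unfold rd ci dt; push_cast; ring

theorem one_le_abs_rd_ci {w z : ℤ × ℤ} (h : rd (ci w) (ci z) ≠ 0) : 1 ≤ |rd (ci w) (ci z)| := by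
  rw [rd_ci] at *
  have : dt w z ≠ 0 := by exact_mod_cast h
  have := Int.one_le_abs this
  exact_mod_cast this

theorem cz_sub (P : (ℤ × ℤ) × (ℤ × ℤ)) : (cz P).1 - (cz P).2 = ci (P.1 - P.2) := by
  unfold cz ci; ext <;> simp

theorem cz_add (P : (ℤ × ℤ) × (ℤ × ℤ)) : (cz P).1 + (cz P).2 = ci (P.1 + P.2) := by
  unfold cz ci; ext <;> simp

theorem mem_box_of_mem_Om {M s Y : ℝ} {β : ℝ × ℝ} {P : (ℤ × ℤ) × (ℤ × ℤ)} (hM : 1 ≤ M)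
    (hβ : β ∈ Kp M) (hP : P ∈ NZ) (hz : cz P ∈ Om (s ^ 4) Y β) :
    P.1 - P.2 ∈ box ⌊8 * M * s ^ 2⌋₊ ∧ P.1 + P.2 ∈ box ⌊8 * M * s ^ 2⌋₊ := by
  obtain ⟨h1, h2⟩ := norm_le_of_mem_Om hM hβ hz
  have k1 : ‖ci (P.1 - P.2)‖ ≤ 8 * M * s ^ 2 := by
    rw [← cz_sub]; refine (norm_sub_le _ _).trans (by linarith)
  have k2 : ‖ci (P.1 + P.2)‖ ≤ 8 * M * s ^ 2 := by
    rw [← cz_add]; refine (norm_add_le _ _).trans (by linarith)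
  rw [norm_ci] at k1 k2
  exact ⟨mem_box.2 ⟨hP.1, Nat.le_floor k1⟩, mem_box.2 ⟨hP.2, Nat.le_floor k2⟩⟩

theorem sum_sub_injective :
    Function.Injective fun P : (ℤ × ℤ) × (ℤ × ℤ) => (P.1 - P.2, P.1 + P.2) := by
  rintro ⟨⟨a, b⟩, c, d⟩ ⟨⟨a', b'⟩, c', d'⟩ h
  simp only [Prod.ext_iff, Prod.mk_sub_mk, Prod.mk_add_mk] at h ⊢
  omega

theorem Jc_eq_zero {M L s Y : ℝ} {ω : ℝ × ℝ → ℝ} (hM : 1 ≤ M) (hω : IsWt M L ω)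
    {P P' : (ℤ × ℤ) × (ℤ × ℤ)} (h : Jc (s ^ 4) Y ω P P' ≠ 0) :
    (P.1 - P.2 ∈ box ⌊8 * M * s ^ 2⌋₊ ∧ P.1 + P.2 ∈ box ⌊8 * M * s ^ 2⌋₊) ∧
    (P'.1 - P'.2 ∈ box ⌊8 * M * s ^ 2⌋₊ ∧ P'.1 + P'.2 ∈ box ⌊8 * M * s ^ 2⌋₊) := by
  by_contra hc
  apply h
  have : ∀ β, og (s ^ 4) Y P β * og (s ^ 4) Y P' β * ENNReal.ofReal (ω β) = 0 := by
    intro β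
    by_contra h0
    have h1 := left_ne_zero_of_mul h0
    obtain ⟨a1, a2⟩ := og_ne_zero (left_ne_zero_of_mul h1)
    obtain ⟨b1, b2⟩ := og_ne_zero (right_ne_zero_of_mul h1)
    have hβ : β ∈ Kp M := K1_subset_Kp M (hω.supp β fun h2 => h0 (by rw [h2]; simp))
    exact hc ⟨mem_box_of_mem_Om hM hβ a1 a2, mem_box_of_mem_Om hM hβ b1 b2⟩
  unfold Jc
  simp only [this, lintegral_zero]

theorem bad_pair {M L s Y : ℝ} {ω : ℝ × ℝ → ℝ} (hM : 1 ≤ M) (hL : 0 ≤ L) (hω : IsWt M L ω)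
    (hY0 : 0 ≤ Y) (hY : Y ≤ 1 / (32 * M)) {P P' : (ℤ × ℤ) × (ℤ × ℤ)} (hb : (P, P') ∉ GP s)
    (h : Jc (s ^ 4) Y ω P P' ≠ 0) :
    Jc (s ^ 4) Y ω P P' ≤ ENNReal.ofReal (L * (badK M * (Y ^ 2 * s ^ 7 + Y * (8 * M * s ^ 2) ^ 2)) *
      (tw (ci (P.1 - P.2)) (ci (P'.1 + P'.2)) * tw (ci (P.1 + P.2)) (ci (P'.1 - P'.2)) +
       tw (ci (P.1 - P.2)) (ci (P'.1 - P'.2)) * tw (ci (P.1 + P.2)) (ci (P'.1 + P'.2)))) := by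
  obtain ⟨⟨u1, v1⟩, u1', v1'⟩ := Jc_eq_zero hM hω h
  have lo : ∀ {w : ℤ × ℤ}, w ∈ box ⌊8 * M * s ^ 2⌋₊ → 1 ≤ ‖ci w‖ := fun hw => by
    rw [norm_ci]; exact_mod_cast vn_pos (mem_box.1 hw).1
  have hi : ∀ {w : ℤ × ℤ}, w ∈ box ⌊8 * M * s ^ 2⌋₊ → ‖ci w‖ ≤ 8 * M * s ^ 2 := fun hw => by
    rw [norm_ci]
    exact (Nat.cast_le.2 (mem_box.1 hw).2).trans (Nat.floor_le (by positivity))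
  have hd : |jac (ci (P.1 - P.2)) (ci (P.1 + P.2)) (ci (P'.1 - P'.2)) (ci (P'.1 + P'.2))| ≤ s ^ 7 := by
    have : ¬ (s ^ 7 ≤ |det2 (cf (cz P)) (cf (cz P'))|) := hb
    rw [det2_cf, cz_sub, cz_add, cz_sub, cz_add] at this
    exact (not_le.1 this).le
  have key := bad_bound hM (lo u1) (lo v1) (lo u1') (lo v1') (hi u1) (hi v1) (hi u1') (hi v1')
    hY0 hY hd one_le_abs_rd_ci one_le_abs_rd_ci one_le_abs_rd_ci one_le_abs_rd_ci
  rw [mul_assoc L, ENNReal.ofReal_mul hL]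
  refine le_trans ?_ (mul_le_mul_right key _)
  set S := {β | β ∈ Kp M ∧
    (0 ≤ Br β (ci (P.1 - P.2)) (ci (P.1 + P.2)) ∧ Br β (ci (P.1 - P.2)) (ci (P.1 + P.2)) ≤ Y) ∧
    (0 ≤ Br β (ci (P'.1 - P'.2)) (ci (P'.1 + P'.2)) ∧
      Br β (ci (P'.1 - P'.2)) (ci (P'.1 + P'.2)) ≤ Y)} with hS
  have hSm : MeasurableSet S := by
    have hBm : ∀ u v : ℝ × ℝ, Measurable fun β => Br β u v := fun u v => by unfold Br; fun_prop
    exact (Kp_measurableSet M).inter (((measurableSet_le measurable_const (hBm _ _)).inter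
      (measurableSet_le (hBm _ _) measurable_const)).inter
      ((measurableSet_le measurable_const (hBm _ _)).inter
      (measurableSet_le (hBm _ _) measurable_const)))
  rw [← lintegral_indicator_const hSm]
  apply lintegral_mono
  intro β
  by_cases h0 : og (s ^ 4) Y P β * og (s ^ 4) Y P' β * ENNReal.ofReal (ω β) = 0
  · simp only [h0]; exact zero_le
  have h1 := left_ne_zero_of_mul h0
  obtain ⟨-, a2⟩ := og_ne_zero (left_ne_zero_of_mul h1)
  obtain ⟨-, b2⟩ := og_ne_zero (right_ne_zero_of_mul h1)
  have hβ : β ∈ Kp M := K1_subset_Kp M (hω.supp β fun h2 => h0 (by rw [h2]; simp))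
  have hmem : β ∈ S := by
    refine ⟨hβ, ?_, ?_⟩
    · rw [← cz_sub, ← cz_add, ← aff_cf_eq_Br]; exact a2.2
    · rw [← cz_sub, ← cz_add, ← aff_cf_eq_Br]; exact b2.2
  rw [Set.indicator_of_mem hmem]
  calc _ ≤ 1 * 1 * ENNReal.ofReal L := by
        exact mul_le_mul' (mul_le_mul' (og_le_one _ _ _ _) (og_le_one _ _ _ _))
          (ENNReal.ofReal_le_ofReal (hω.le β))
    _ = _ := by rw [one_mul, one_mul]

theorem tw_ci (w z : ℤ × ℤ) : tw (ci w) (ci z) = 1 / ((vn w : ℝ) * vn z * max 1 |(dt w z : ℝ)|) := by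
  unfold tw; rw [norm_ci, norm_ci, rd_ci]

theorem sum_tw_le (n : ℕ) : ∑ z ∈ box n, ∑ w ∈ box n, tw (ci z) (ci w) ≤ 432 * hs (2 * n * n) ^ 3 := by
  simp only [tw_ci]; exact sum_sum_recip n

theorem bad_sum {M L s Y : ℝ} {ω : ℝ × ℝ → ℝ} (hM : 1 ≤ M) (hL : 0 ≤ L) (hω : IsWt M L ω)
    (hs0 : 0 ≤ s) (hY0 : 0 ≤ Y) (hY : Y ≤ 1 / (32 * M)) :
    ∑' P, ∑' P', (GP s)ᶜ.indicator (fun q => Jc (s ^ 4) Y ω q.1 q.2) (P, P') ≤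
      ENNReal.ofReal (L * (badK M * (Y ^ 2 * s ^ 7 + Y * (8 * M * s ^ 2) ^ 2)) *
        (2 * (432 * hs (2 * ⌊8 * M * s ^ 2⌋₊ * ⌊8 * M * s ^ 2⌋₊) ^ 3) ^ 2)) := by
  set n := ⌊8 * M * s ^ 2⌋₊ with hn
  set C := L * (badK M * (Y ^ 2 * s ^ 7 + Y * (8 * M * s ^ 2) ^ 2)) with hC
  have hC0 : 0 ≤ C := by have := badK_pos hM; positivity
  have tw0 : ∀ a b, 0 ≤ tw a b := fun a b => by unfold tw; positivity
  -- the majorant as a function of the sums and differences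
  set h : ((ℤ × ℤ) × (ℤ × ℤ)) → ((ℤ × ℤ) × (ℤ × ℤ)) → ℝ := fun p q =>
    tw (ci p.1) (ci q.2) * tw (ci p.2) (ci q.1) + tw (ci p.1) (ci q.1) * tw (ci p.2) (ci q.2) with hh
  set B : Finset ((ℤ × ℤ) × (ℤ × ℤ)) := box n ×ˢ box n with hB
  set g : ((ℤ × ℤ) × (ℤ × ℤ)) → ((ℤ × ℤ) × (ℤ × ℤ)) → ENNReal := fun p q =>
    if p ∈ B ∧ q ∈ B then ENNReal.ofReal (C * h p q) else 0 with hg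
  have hh0 : ∀ p q, 0 ≤ h p q := fun p q =>
    add_nonneg (mul_nonneg (tw0 _ _) (tw0 _ _)) (mul_nonneg (tw0 _ _) (tw0 _ _))
  set j : ((ℤ × ℤ) × (ℤ × ℤ)) → ((ℤ × ℤ) × (ℤ × ℤ)) := fun P => (P.1 - P.2, P.1 + P.2) with hj
  have hpt : ∀ P P', (GP s)ᶜ.indicator (fun q => Jc (s ^ 4) Y ω q.1 q.2) (P, P') ≤
      g (j P) (j P') := by
    intro P P'
    by_cases hb : (P, P') ∈ GP s
    · rw [Set.indicator_of_notMem (by simpa using hb)]; exact zero_le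
    rw [Set.indicator_of_mem (by simpa using hb)]
    by_cases h0 : Jc (s ^ 4) Y ω P P' = 0
    · simp only [h0]; exact zero_le
    obtain ⟨b1, b2⟩ := Jc_eq_zero hM hω h0
    have : j P ∈ B ∧ j P' ∈ B :=
      ⟨Finset.mem_product.2 b1, Finset.mem_product.2 b2⟩
    simp only [hg]
    rw [if_pos this]
    exact bad_pair hM hL hω hY0 hY hb h0
  have e1 : ∑' p, ∑' q, g p q = ENNReal.ofReal (∑ p ∈ B, ∑ q ∈ B, C * h p q) := by
    have hz : ∀ p, p ∉ B → ∑' q, g p q = 0 := by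
      intro p hp
      simp [hg, hp]
    rw [tsum_eq_sum fun p hp => hz p hp, ENNReal.ofReal_sum_of_nonneg
      fun p _ => Finset.sum_nonneg fun q _ => mul_nonneg hC0 (hh0 p q)]
    refine Finset.sum_congr rfl fun p hp => ?_
    rw [tsum_eq_sum (s := B) fun q hq => by simp [hg, hq], ENNReal.ofReal_sum_of_nonneg
      fun q _ => mul_nonneg hC0 (hh0 p q)]
    refine Finset.sum_congr rfl fun q hq => ?_
    simp [hg, hp, hq]
  have e2 : ∑ p ∈ B, ∑ q ∈ B, h p q =
      2 * (∑ z ∈ box n, ∑ w ∈ box n, tw (ci z) (ci w)) ^ 2 := by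
    simp only [hB, hh, Finset.sum_product, Finset.sum_add_distrib, two_mul, sq]
    congr 1
    · calc _ = ∑ x ∈ box n, ∑ y ∈ box n, (∑ w ∈ box n, tw (ci y) (ci w)) *
            (∑ w ∈ box n, tw (ci x) (ci w)) := by
            refine Finset.sum_congr rfl fun x _ => Finset.sum_congr rfl fun y _ => ?_
            rw [Finset.sum_mul_sum]
            refine Finset.sum_congr rfl fun z _ => Finset.sum_congr rfl fun w _ => mul_comm _ _
        _ = _ := by
            rw [Finset.sum_mul_sum]
            refine Finset.sum_congr rfl fun x _ => Finset.sum_congr rfl fun y _ => mul_comm _ _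
    · calc _ = ∑ x ∈ box n, ∑ y ∈ box n, (∑ w ∈ box n, tw (ci x) (ci w)) *
            (∑ w ∈ box n, tw (ci y) (ci w)) := by
            refine Finset.sum_congr rfl fun x _ => Finset.sum_congr rfl fun y _ => ?_
            rw [Finset.sum_mul_sum]
        _ = _ := by
            rw [Finset.sum_mul_sum]
  calc _ ≤ ∑' P, ∑' P', g (j P) (j P') :=
        ENNReal.tsum_le_tsum fun P => ENNReal.tsum_le_tsum fun P' => hpt P P'
    _ ≤ ∑' P, ∑' q, g (j P) q :=
        ENNReal.tsum_le_tsum fun P => ENNReal.tsum_comp_le_tsum_of_injective sum_sub_injective _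
    _ ≤ ∑' p, ∑' q, g p q :=
        ENNReal.tsum_comp_le_tsum_of_injective sum_sub_injective fun p => ∑' q, g p q
    _ ≤ _ := by
        rw [e1]
        apply ENNReal.ofReal_le_ofReal
        simp only [← Finset.mul_sum]
        rw [e2]
        have h0 : 0 ≤ ∑ z ∈ box n, ∑ w ∈ box n, tw (ci z) (ci w) :=
          Finset.sum_nonneg fun _ _ => Finset.sum_nonneg fun _ _ => tw0 _ _
        have := sum_tw_le n
        gcongr

theorem cf_cz_eq_zero {P : (ℤ × ℤ) × (ℤ × ℤ)} (h : P ∉ NZ) : cf (cz P) = 0 := by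
  obtain ⟨⟨a, b⟩, c, d⟩ := P
  have : (a = c ∧ b = d) ∨ (a = -c ∧ b = -d) := by
    by_contra hc
    apply h
    simp only [NZ, Set.mem_ofPred_eq, ne_eq, Prod.ext_iff, Prod.mk_sub_mk, Prod.mk_add_mk,
      Prod.fst_zero, Prod.snd_zero]
    omega
  rcases this with ⟨rfl, rfl⟩ | ⟨rfl, rfl⟩ <;> simp [cf, cz]

theorem eight_le_of_cplK_le {M s : ℝ} (hM : 1 ≤ M) (hs : 8 * cplK M ≤ s) :
    8 * (256 * M ^ 2) ^ 2 ≤ s := by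
  refine le_trans ?_ hs
  unfold cplK
  nlinarith [show 0 ≤ (256 * M ^ 2) ^ 2 * (3 + M) - (256 * M ^ 2) ^ 2 by
    nlinarith [sq_nonneg (256 * M ^ 2)]]

theorem good_single {M L s Y : ℝ} {ω : ℝ × ℝ → ℝ} (hM : 1 ≤ M) (hL : 0 ≤ L) (hω : IsWt M L ω)
    (hs : 8 * cplK M ≤ s) (z : (ℝ × ℝ) × (ℝ × ℝ))
    (hd : s ^ 3 ≤ |(cf z).2.1| ∨ s ^ 3 ≤ |(cf z).2.2|) :
    ∫⁻ β, oi (s ^ 4) Y z β * ENNReal.ofReal (ω β) ≤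
      ENNReal.ofReal (1 + cplK M / s) *
        ∫⁻ β, og (s ^ 4 + omK M * s ^ 3) Y (fl z) β * bw M L s ω β := by
  by_cases hne : ∃ β, oi (s ^ 4) Y z β * ENNReal.ofReal (ω β) ≠ 0
  swap
  · push Not at hne
    simp only [hne, lintegral_zero]; exact zero_le
  obtain ⟨β₀, hβ₀⟩ := hne
  have hc := cplK_pos hM
  have hsK := eight_le_of_cplK_le hM hs
  have hM4 : 1 ≤ M ^ 4 := one_le_pow₀ hM
  have hs1 : 1 ≤ s := by nlinarith
  have hs0 : 0 < s := by linarith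
  have hs8 : cplK M / s ≤ 1 / 8 := by
    rw [div_le_div_iff₀ hs0 (by norm_num)]; linarith
  have supp : ∀ β, oi (s ^ 4) Y z β * ENNReal.ofReal (ω β) ≠ 0 →
      z ∈ Om (s ^ 4) Y β ∧ β ∈ K1 M := by
    intro β h
    have h1 := left_ne_zero_of_mul h
    have h2 := right_ne_zero_of_mul h
    refine ⟨by_contra fun hc => h1 (Set.indicator_of_notMem hc _),
      hω.supp β fun h0 => h2 (by rw [h0]; simp)⟩
  obtain ⟨p1, p3⟩ := supp β₀ hβ₀
  obtain ⟨m1, m2⟩ := norm_le_of_mem_Om hM (K1_subset_Kp M p3) p1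
  obtain ⟨d1, d2⟩ := dist_cz_fl z
  have hw : 4 * M * s ^ 2 ≤ 8 * M * s ^ 2 := by gcongr; norm_num
  have q1 := norm_near hM hs1 m1 d1
  have q2 := norm_near hM hs1 m2 d2
  have big : 4 * (8 * M * s ^ 2) ^ 2 ≤ 256 * M ^ 2 * s ^ 4 := le_of_eq (by ring)
  have small : 4 * (8 * M * s ^ 2) * 1 ≤ 256 * M ^ 2 * s ^ 2 := by
    have : M ≤ M ^ 2 := by nlinarith
    have h2 : 0 ≤ s ^ 2 := by positivity
    nlinarith [mul_le_mul_of_nonneg_right this h2, mul_nonneg (by linarith : 0 ≤ M) h2]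
  have hdx := (cf_sub_le (m1.trans hw) (m2.trans hw) q1 q2 d1 d2).trans small
  have hNZ : fl z ∈ NZ := by
    by_contra hc
    rw [cf_cz_eq_zero hc, sub_zero] at hdx
    have h3 : 256 * M ^ 2 * s ^ 2 < s ^ 3 := by
      have : 256 * M ^ 2 < s := by nlinarith [one_le_pow₀ hM (n := 2)]
      have h2 : 0 < s ^ 2 := by positivity
      nlinarith [mul_lt_mul_of_pos_right this h2]
    have e1 : |(cf z).2.1| ≤ ‖cf z‖ := (abs_fst_le _).trans (le_max_right _ _)
    have e2 : |(cf z).2.2| ≤ ‖cf z‖ := (abs_snd_le _).trans (le_max_right _ _)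
    rcases hd with hd | hd <;> linarith
  have hfac : ENNReal.ofReal (1 + 4 * (256 * M ^ 2) ^ 2 / s) ≤ ENNReal.ofReal (1 + cplK M / s) := by
    apply ENNReal.ofReal_le_ofReal
    gcongr
    unfold cplK
    nlinarith [show 0 ≤ (256 * M ^ 2) ^ 2 * (3 + M) - (256 * M ^ 2) ^ 2 by
      nlinarith [sq_nonneg (256 * M ^ 2)]]
  have hy : ∃ y : ℝ × ℝ × ℝ, ‖y‖ ≤ 256 * M ^ 2 * s ^ 4 ∧ s ^ 7 ≤ |det2 (cf z) y| := by
    have hb : s ^ 4 ≤ 256 * M ^ 2 * s ^ 4 := by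
      have : 1 ≤ 256 * M ^ 2 := by nlinarith [one_le_pow₀ hM (n := 2)]
      nlinarith [show 0 ≤ s ^ 4 by positivity]
    have h4 : |s ^ 4| = s ^ 4 := abs_of_nonneg (by positivity)
    have h0 : |(0 : ℝ)| ≤ s ^ 4 := by rw [abs_zero]; positivity
    have e7 : s ^ 7 = s ^ 3 * s ^ 4 := by ring
    rcases hd with hd | hd
    · refine ⟨(0, 0, s ^ 4), (norm_triple_le h0 h0 h4.le).trans hb, ?_⟩
      simp only [det2, mul_zero, sub_zero]
      rw [abs_mul, h4, e7]; gcongr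
    · refine ⟨(0, s ^ 4, 0), (norm_triple_le h0 h4.le h0).trans hb, ?_⟩
      simp only [det2, mul_zero, zero_sub]
      rw [abs_neg, abs_mul, h4, e7]; gcongr
  obtain ⟨y, hy1, hy2⟩ := hy
  refine (coupling (K := 256 * M ^ 2) (x := cf z) (y := y) (x' := cf (cz (fl z)))
    (y' := y) hM hs1 hsK ((cf_le q1 q2).trans big) hy1 hy1 hdx
    (by rw [sub_self, norm_zero]; positivity) hy2
    (g := fun β => og (s ^ 4 + omK M * s ^ 3) Y (fl z) β * bw M L s ω β)
    ?_ (fun β h => (supp β h).2) ?_).trans (mul_le_mul_left hfac _)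
  · exact (og_measurable _ _ _).mul (bw_measurable M L s hω.meas)
  · intro β β' hβ hd' e1 _
    by_cases h0 : oi (s ^ 4) Y z β * ENNReal.ofReal (ω β) = 0
    · rw [h0]; exact zero_le
    obtain ⟨r1, _⟩ := supp β h0
    have hmem := Om_transfer hM hs1 hβ hd' r1 d1 e1
    have : og (s ^ 4 + omK M * s ^ 3) Y (fl z) β' = 1 :=
      Set.indicator_of_mem (s := {β | fl z ∈ NZ ∧ cz (fl z) ∈ Om _ Y β}) ⟨hNZ, hmem⟩ _
    rw [this, oi_of_mem r1, one_mul, one_mul]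
    exact wt_le_bw hL hω hs8 hβ hd'

/-- The first moment of the counting function is at most of the expected order. -/
theorem lintegral_Gf_le {M s Y : ℝ} (hM : 1 ≤ M) (hY : 0 ≤ Y) :
    ∫⁻ β in Kp M, Gf (s ^ 4) Y β ≤ ENNReal.ofReal (6400 * 9216 * M ^ 6 * s ^ 4 * Y) := by
  set n := ⌊8 * M * s ^ 2⌋₊ with hn
  have hnle : (n : ℝ) ≤ 8 * M * s ^ 2 := Nat.floor_le (by positivity)
  set B : Finset ((ℤ × ℤ) × (ℤ × ℤ)) := box n ×ˢ box n with hB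
  set g : ((ℤ × ℤ) × (ℤ × ℤ)) → ENNReal := fun p =>
    if p ∈ B then ENNReal.ofReal (6400 * M ^ 4 * Y * (1 / (vn p.1 : ℝ) * (1 / (vn p.2 : ℝ)))) else 0
    with hg
  set j : ((ℤ × ℤ) × (ℤ × ℤ)) → ((ℤ × ℤ) × (ℤ × ℤ)) := fun P => (P.1 - P.2, P.1 + P.2) with hj
  unfold Gf
  rw [lintegral_tsum fun P => (og_measurable _ _ P).aemeasurable]
  have hpt : ∀ P, ∫⁻ β in Kp M, og (s ^ 4) Y P β ≤ g (j P) := by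
    intro P
    by_cases h : ∃ β ∈ Kp M, og (s ^ 4) Y P β ≠ 0
    swap
    · push Not at h
      rw [setLIntegral_congr_fun (Kp_measurableSet M) (g := fun _ => 0) fun β hβ => h β hβ]
      simp
    obtain ⟨β₀, hβ₀, h0⟩ := h
    obtain ⟨a1, a2⟩ := og_ne_zero h0
    have hb := mem_box_of_mem_Om hM hβ₀ a1 a2
    have : j P ∈ B := Finset.mem_product.2 hb
    simp only [hg]
    rw [if_pos this]
    have hu : ci (P.1 - P.2) ≠ 0 := by
      rw [← norm_pos_iff, norm_ci]; exact_mod_cast vn_pos a1.1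
    have hv : ci (P.1 + P.2) ≠ 0 := by
      rw [← norm_pos_iff, norm_ci]; exact_mod_cast vn_pos a1.2
    have key := volume_strip_le hM hu hv hY
    rw [norm_ci, norm_ci] at key
    refine le_trans ?_ (key.trans (ENNReal.ofReal_le_ofReal (le_of_eq ?_)))
    · have hS : MeasurableSet {β | β ∈ Kp M ∧ 0 ≤ Br β (ci (P.1 - P.2)) (ci (P.1 + P.2)) ∧
          Br β (ci (P.1 - P.2)) (ci (P.1 + P.2)) ≤ Y} := by
        have hBm : ∀ u v : ℝ × ℝ, Measurable fun β => Br β u v := fun u v => by unfold Br; fun_prop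
        exact (Kp_measurableSet M).inter ((measurableSet_le measurable_const (hBm _ _)).inter
          (measurableSet_le (hBm _ _) measurable_const))
      rw [← lintegral_indicator_one hS, ← lintegral_indicator (Kp_measurableSet M)]
      apply lintegral_mono
      intro β
      by_cases hβ : β ∈ Kp M
      · rw [Set.indicator_of_mem hβ]
        by_cases h1 : og (s ^ 4) Y P β = 0
        · rw [h1]; exact zero_le
        obtain ⟨-, b2⟩ := og_ne_zero h1
        rw [Set.indicator_of_mem]
        · exact og_le_one _ _ _ _
        · refine ⟨hβ, ?_⟩
          rw [← cz_sub, ← cz_add, ← aff_cf_eq_Br]; exact b2.2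
      · rw [Set.indicator_of_notMem hβ]; exact zero_le
    · simp only [hj]
      rw [one_div_mul_one_div, mul_one_div]
  calc _ ≤ ∑' P, g (j P) := ENNReal.tsum_le_tsum hpt
    _ ≤ ∑' p, g p := ENNReal.tsum_comp_le_tsum_of_injective sum_sub_injective _
    _ = ENNReal.ofReal (∑ p ∈ B, 6400 * M ^ 4 * Y * (1 / (vn p.1 : ℝ) * (1 / (vn p.2 : ℝ)))) := by
      rw [tsum_eq_sum (s := B) fun q hq => by simp [hg, hq], ENNReal.ofReal_sum_of_nonneg
        fun q _ => by positivity]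
      refine Finset.sum_congr rfl fun q hq => ?_
      simp [hg, hq]
    _ ≤ _ := by
      apply ENNReal.ofReal_le_ofReal
      rw [← Finset.mul_sum, hB, Finset.sum_product]
      simp only
      rw [← Finset.sum_mul_sum]
      have h := sum_box_inv n
      have h0 : 0 ≤ ∑ z ∈ box n, 1 / (vn z : ℝ) := Finset.sum_nonneg fun _ _ => by positivity
      calc _ ≤ 6400 * M ^ 4 * Y * ((12 * n) * (12 * n)) := by gcongr
        _ ≤ 6400 * M ^ 4 * Y * ((12 * (8 * M * s ^ 2)) * (12 * (8 * M * s ^ 2))) := by gcongr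
        _ = _ := by ring

theorem lintegral_abs_rpow_le {A : ℝ} (hA : 0 ≤ A) :
    ∫⁻ t in Set.Icc (-A) A, ENNReal.ofReal |t| ^ (-(1 / 2) : ℝ) ≤ ENNReal.ofReal (4 * A ^ (1 / 2 : ℝ)) := by
  set k : ℝ → ENNReal := fun t => ENNReal.ofReal |t| ^ (-(1 / 2) : ℝ) with hk
  have hkm : Measurable k := by fun_prop
  have pos : ∫⁻ t in Set.Ioc 0 A, k t = ENNReal.ofReal (2 * A ^ (1 / 2 : ℝ)) := by
    have h1 : ∫ t in (0 : ℝ)..A, t ^ (-(1 / 2) : ℝ) = 2 * A ^ (1 / 2 : ℝ) := by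
      rw [integral_rpow (Or.inl (by norm_num))]
      norm_num
      ring
    have hi : IntervalIntegrable (fun t : ℝ => t ^ (-(1 / 2) : ℝ)) volume 0 A :=
      intervalIntegral.intervalIntegrable_rpow' (by norm_num)
    rw [intervalIntegral.integral_of_le hA] at h1
    rw [← h1, ofReal_integral_eq_lintegral_ofReal hi.1]
    · refine setLIntegral_congr_fun measurableSet_Ioc fun t ht => ?_
      simp only [hk]
      rw [abs_of_pos ht.1, ENNReal.ofReal_rpow_of_pos ht.1]
    · refine (ae_restrict_iff' measurableSet_Ioc).2 (Filter.Eventually.of_forall fun t ht => ?_)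
      exact Real.rpow_nonneg ht.1.le _
  have neg : ∫⁻ t in Set.Ico (-A) 0, k t = ENNReal.ofReal (2 * A ^ (1 / 2 : ℝ)) := by
    rw [← pos]
    have hmp : MeasurePreserving (fun t : ℝ => -t) := Measure.measurePreserving_neg volume
    have := hmp.setLIntegral_comp_preimage (s := Set.Ioc 0 A) measurableSet_Ioc hkm
    rw [← this]
    have hs : (fun t : ℝ => -t) ⁻¹' Set.Ioc 0 A = Set.Ico (-A) 0 := by
      ext t; simp only [Set.mem_preimage, Set.mem_Ioc, Set.mem_Ico]
      constructor <;> rintro ⟨h1, h2⟩ <;> constructor <;> linarith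
    rw [hs]
    simp only [hk, abs_neg]
  have hsub : Set.Icc (-A) A ⊆ Set.Ico (-A) 0 ∪ ({0} ∪ Set.Ioc 0 A) := by
    intro t ht
    rcases lt_trichotomy t 0 with h | h | h
    · exact Or.inl ⟨ht.1, h⟩
    · exact Or.inr (Or.inl h)
    · exact Or.inr (Or.inr ⟨h, ht.2⟩)
  calc _ ≤ ∫⁻ t in Set.Ico (-A) 0 ∪ ({0} ∪ Set.Ioc 0 A), k t := lintegral_mono_set hsub
    _ ≤ (∫⁻ t in Set.Ico (-A) 0, k t) + ((∫⁻ t in ({0} : Set ℝ), k t) + ∫⁻ t in Set.Ioc 0 A, k t) :=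
        (lintegral_union_le _ _ _).trans (add_le_add le_rfl (lintegral_union_le _ _ _))
    _ = _ := by
        have h0 : ∫⁻ t in ({0} : Set ℝ), k t = 0 := by
          apply setLIntegral_measure_zero; simp
        rw [neg, pos, h0, zero_add, ← ENNReal.ofReal_add (by positivity) (by positivity)]
        congr 1; ring

/-- The truncated inverse norm. -/
noncomputable def iv (A : ℝ) (u : ℝ × ℝ) : ENNReal :=
  {u : ℝ × ℝ | ‖u‖ ≤ A}.indicator (fun u => (ENNReal.ofReal ‖u‖)⁻¹) u

theorem iv_measurable (A : ℝ) : Measurable (iv A) := by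
  apply Measurable.indicator
  · fun_prop
  · exact measurableSet_le measurable_norm measurable_const

theorem lintegral_iv_le {A : ℝ} (hA : 0 ≤ A) : ∫⁻ u, iv A u ≤ ENNReal.ofReal (16 * A) := by
  set k : ℝ → ENNReal := fun t => ENNReal.ofReal |t| ^ (-(1 / 2) : ℝ) with hk
  have hkm : Measurable k := by fun_prop
  set f : ℝ → ENNReal := (Set.Icc (-A) A).indicator k with hf
  have hfm : Measurable f := hkm.indicator measurableSet_Icc
  have k0 : ∀ t, k t ≠ 0 := by
    intro t
    simp only [hk, ne_eq, ENNReal.rpow_eq_zero_iff]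
    norm_num
  have ktop : k 0 = ⊤ := by simp [hk]
  have hle : ∀ u, iv A u ≤ f u.1 * f u.2 := by
    intro u
    by_cases hu : ‖u‖ ≤ A
    swap
    · unfold iv
      rw [Set.indicator_of_notMem (by exact hu)]; exact zero_le
    have h1 : u.1 ∈ Set.Icc (-A) A := abs_le.1 ((abs_fst_le u).trans hu)
    have h2 : u.2 ∈ Set.Icc (-A) A := abs_le.1 ((abs_snd_le u).trans hu)
    unfold iv
    rw [Set.indicator_of_mem (by exact hu), hf, Set.indicator_of_mem h1, Set.indicator_of_mem h2]
    by_cases z1 : u.1 = 0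
    · rw [z1, ktop, ENNReal.top_mul (k0 _)]; exact le_top
    by_cases z2 : u.2 = 0
    · rw [z2, ktop, ENNReal.mul_top (k0 _)]; exact le_top
    have p1 : 0 < |u.1| := abs_pos.2 z1
    have p2 : 0 < |u.2| := abs_pos.2 z2
    simp only [hk]
    rw [ENNReal.ofReal_rpow_of_pos p1, ENNReal.ofReal_rpow_of_pos p2,
      ← ENNReal.ofReal_mul (by positivity)]
    have hn : 0 < ‖u‖ := p1.trans_le (abs_fst_le u)
    rw [← ENNReal.ofReal_inv_of_pos hn, ← one_div]
    apply ENNReal.ofReal_le_ofReal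
    have e : (1 : ℝ) / ‖u‖ = ‖u‖ ^ (-(1 / 2) : ℝ) * ‖u‖ ^ (-(1 / 2) : ℝ) := by
      rw [← Real.rpow_add hn]; norm_num [Real.rpow_neg_one]
    rw [e]
    exact mul_le_mul
      (Real.rpow_le_rpow_of_nonpos p1 (abs_fst_le u) (by norm_num))
      (Real.rpow_le_rpow_of_nonpos p2 (abs_snd_le u) (by norm_num)) (by positivity) (by positivity)
  calc _ ≤ ∫⁻ u : ℝ × ℝ, f u.1 * f u.2 := lintegral_mono hle
    _ = (∫⁻ t, f t) * ∫⁻ t, f t := by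
        rw [Measure.volume_eq_prod, lintegral_prod_mul hfm.aemeasurable hfm.aemeasurable]
    _ ≤ ENNReal.ofReal (4 * A ^ (1 / 2 : ℝ)) * ENNReal.ofReal (4 * A ^ (1 / 2 : ℝ)) := by
        have : ∫⁻ t, f t ≤ ENNReal.ofReal (4 * A ^ (1 / 2 : ℝ)) := by
          rw [hf, lintegral_indicator measurableSet_Icc]; exact lintegral_abs_rpow_le hA
        exact mul_le_mul' this this
    _ = _ := by
        rw [← ENNReal.ofReal_mul (by positivity)]
        congr 1
        rw [← Real.sqrt_eq_rpow]
        nlinarith [Real.mul_self_sqrt hA]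

theorem lintegral_sub_add {f g : ℝ × ℝ → ENNReal} (hf : Measurable f) (hg : Measurable g) :
    ∫⁻ z : (ℝ × ℝ) × (ℝ × ℝ), f (z.1 - z.2) * g (z.1 + z.2) =
      ENNReal.ofReal (1 / 4) * ((∫⁻ u, f u) * ∫⁻ v, g v) := by
  have hm : Measurable fun z : (ℝ × ℝ) × (ℝ × ℝ) => f (z.1 - z.2) * g (z.1 + z.2) := by fun_prop
  have hm2 : Measurable fun z : (ℝ × ℝ) × (ℝ × ℝ) => f z.1 * g (z.1 + 2 • z.2) := by fun_prop
  rw [Measure.volume_eq_prod, lintegral_prod_symm' _ hm]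
  have e1 : ∀ y : ℝ × ℝ, ∫⁻ x, f (x - y) * g (x + y) = ∫⁻ x, f x * g (x + 2 • y) := by
    intro y
    rw [← lintegral_add_right_eq_self (fun x => f (x - y) * g (x + y)) y]
    congr 1; ext x
    rw [add_sub_cancel_right, two_smul, add_assoc]
  simp only [e1]
  rw [lintegral_lintegral_swap]
  · have e2 : ∀ x : ℝ × ℝ, ∫⁻ y, f x * g (x + 2 • y) = ENNReal.ofReal (1 / 4) * (∫⁻ v, g v) * f x := by
      intro x
      have hgx : Measurable fun y : ℝ × ℝ => g (x + 2 • y) := by fun_prop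
      rw [lintegral_const_mul _ hgx]
      have := lintegral_affine 2 0 0 2 x.1 x.2 (by norm_num) g hg
      norm_num at this
      have e3 : ∀ y : ℝ × ℝ, g (x + 2 • y) = g (2 * y.1 + x.1, 2 * y.2 + x.2) := by
        intro y; congr 1; ext <;> simp [add_comm]
      simp only [e3]
      rw [this]
      norm_num
      ring
    simp only [e2]
    rw [lintegral_const_mul _ hf]; ring
  · exact (hm2.comp measurable_swap).aemeasurable

theorem norm_mul_norm_le {u v : ℝ × ℝ} {H : ℝ} (h1 : |u.1 * v.1| ≤ H)
    (h2 : |u.1 * v.2 + u.2 * v.1| ≤ 2 * H) (h3 : |u.2 * v.2| ≤ H) : ‖u‖ * ‖v‖ ≤ 4 * H := by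
  have hH : 0 ≤ H := (abs_nonneg _).trans h1
  have key : ∀ a b c d : ℝ, |b| ≤ |a| → |c| ≤ |d| → |a * d + b * c| ≤ 2 * H → |b * d| ≤ H →
      |a| * |d| ≤ 4 * H := by
    intro a b c d hba hcd hs hbd
    by_contra! hc
    have e1 : |a| * |d| - |b| * |c| ≤ 2 * H := by
      have := abs_sub_abs_le_abs_sub (a * d) (-(b * c))
      rw [abs_neg, abs_mul, abs_mul, sub_neg_eq_add] at this
      linarith
    rw [abs_mul] at hbd
    have : |b| * |c| ≤ |b| * |d| := mul_le_mul_of_nonneg_left hcd (abs_nonneg _)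
    linarith
  rw [Prod.norm_def u, Prod.norm_def v]
  simp only [Real.norm_eq_abs]
  rcases le_total |u.1| |u.2| with hu | hu <;> rcases le_total |v.1| |v.2| with hv | hv
  · rw [max_eq_right hu, max_eq_right hv, ← abs_mul]; linarith
  · rw [max_eq_right hu, max_eq_left hv]
    refine key u.2 u.1 v.2 v.1 hu hv ?_ h1
    rwa [add_comm]
  · rw [max_eq_left hu, max_eq_right hv]
    exact key u.1 u.2 v.1 v.2 hu hv h2 h3
  · rw [max_eq_left hu, max_eq_left hv, ← abs_mul]; linarith

theorem regular_or_near {M s Y : ℝ} (hM : 1 ≤ M) (hs : 1 ≤ s) (hY : Y ≤ 1) {β : ℝ × ℝ}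
    (hβ : β ∈ Kp M) {z : (ℝ × ℝ) × (ℝ × ℝ)} (hz : z ∈ Om (s ^ 4) Y β) :
    (s ^ 3 ≤ |(cf z).2.1| ∨ s ^ 3 ≤ |(cf z).2.2|) ∨
      (‖z.1 - z.2‖ ≤ √(4 * (3 + M) * s ^ 3) ∨ ‖z.1 + z.2‖ ≤ √(4 * (3 + M) * s ^ 3)) := by
  by_contra! hc
  obtain ⟨⟨c1, c2⟩, c3, c4⟩ := hc
  obtain ⟨-, g2, g3⟩ := hz
  obtain ⟨⟨b1, b2⟩, b3, b4⟩ := hβ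
  have hs3 : 1 ≤ s ^ 3 := one_le_pow₀ hs
  have hb1 : |β.1| ≤ 3 / 2 := abs_le.2 ⟨by linarith, b2⟩
  have hb2 : |β.2| ≤ M := abs_le.2 ⟨by linarith, b4⟩
  have hx1 : |(cf z).1| ≤ (3 + M) * s ^ 3 := by
    have e : (cf z).1 = aff (cf z) β - (cf z).2.1 * β.1 - (cf z).2.2 * β.2 := by unfold aff; ring
    have t1 : |(cf z).2.1 * β.1| ≤ s ^ 3 * (3 / 2) := by rw [abs_mul]; gcongr
    have t2 : |(cf z).2.2 * β.2| ≤ s ^ 3 * M := by rw [abs_mul]; gcongr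
    have t1' := abs_le.1 t1
    have t2' := abs_le.1 t2
    rw [e, abs_le]
    constructor <;> nlinarith [t1'.1, t1'.2, t2'.1, t2'.2]
  have hM3 : s ^ 3 ≤ (3 + M) * s ^ 3 := by nlinarith
  have hprod : ‖z.1 - z.2‖ * ‖z.1 + z.2‖ ≤ 4 * ((3 + M) * s ^ 3) := by
    apply norm_mul_norm_le
    · convert hx1 using 2
      simp only [cf, Prod.fst_sub, Prod.fst_add]; ring
    · have e : (z.1 - z.2).1 * (z.1 + z.2).2 + (z.1 - z.2).2 * (z.1 + z.2).1 = 2 * (cf z).2.1 := by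
        simp only [cf, Prod.fst_sub, Prod.fst_add, Prod.snd_sub, Prod.snd_add]; ring
      rw [e, abs_mul, abs_two]
      linarith
    · have e : (z.1 - z.2).2 * (z.1 + z.2).2 = (cf z).2.2 := by
        simp only [cf, Prod.snd_sub, Prod.snd_add]; ring
      rw [e]; linarith
  have hlt := mul_lt_mul'' c3 c4 (Real.sqrt_nonneg _) (Real.sqrt_nonneg _)
  rw [Real.mul_self_sqrt (by positivity)] at hlt
  linarith

theorem near_single {M L s Y : ℝ} {ω : ℝ × ℝ → ℝ} (hM : 1 ≤ M) (hL : 0 ≤ L) (hω : IsWt M L ω)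
    (hY0 : 0 < Y) {A : ℝ} (z : (ℝ × ℝ) × (ℝ × ℝ))
    (hA : ‖z.1 - z.2‖ ≤ A ∨ ‖z.1 + z.2‖ ≤ A) :
    ∫⁻ β, oi (s ^ 4) Y z β * ENNReal.ofReal (ω β) ≤ ENNReal.ofReal (L * (6400 * M ^ 4 * Y)) *
      (iv A (z.1 - z.2) * iv (8 * M * s ^ 2) (z.1 + z.2) +
        iv (8 * M * s ^ 2) (z.1 - z.2) * iv A (z.1 + z.2)) := by
  have supp : ∀ β, oi (s ^ 4) Y z β * ENNReal.ofReal (ω β) ≠ 0 →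
      z ∈ Om (s ^ 4) Y β ∧ β ∈ Kp M := by
    intro β h
    have h1 := left_ne_zero_of_mul h
    have h2 := right_ne_zero_of_mul h
    refine ⟨by_contra fun hc => h1 (Set.indicator_of_notMem hc _),
      K1_subset_Kp M (hω.supp β fun h0 => h2 (by rw [h0]; simp))⟩
  by_cases hne : ∃ β, oi (s ^ 4) Y z β * ENNReal.ofReal (ω β) ≠ 0
  swap
  · push Not at hne
    simp only [hne, lintegral_zero]; exact zero_le
  obtain ⟨β₀, hβ₀⟩ := hne
  obtain ⟨p1, p2⟩ := supp β₀ hβ₀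
  obtain ⟨m1, m2⟩ := norm_le_of_mem_Om hM p2 p1
  have k1 : ‖z.1 - z.2‖ ≤ 8 * M * s ^ 2 := (norm_sub_le _ _).trans (by linarith)
  have k2 : ‖z.1 + z.2‖ ≤ 8 * M * s ^ 2 := (norm_add_le _ _).trans (by linarith)
  have hL0 : 0 < L := by
    rcases hL.lt_or_eq with h | h
    · exact h
    · exfalso
      apply hβ₀
      have := hω.le β₀
      rw [← h] at this
      rw [ENNReal.ofReal_of_nonpos this, mul_zero]
  set u := z.1 - z.2 with hu
  set v := z.1 + z.2 with hv
  have hvol : ∫⁻ β, oi (s ^ 4) Y z β * ENNReal.ofReal (ω β) ≤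
      ENNReal.ofReal (L * (6400 * M ^ 4 * Y)) * ((ENNReal.ofReal ‖u‖)⁻¹ * (ENNReal.ofReal ‖v‖)⁻¹) := by
    have hC : ENNReal.ofReal (L * (6400 * M ^ 4 * Y)) ≠ 0 := by
      rw [ne_eq, ENNReal.ofReal_eq_zero, not_le]; positivity
    by_cases hu0 : u = 0
    · rw [hu0]; simp only [norm_zero, ENNReal.ofReal_zero, ENNReal.inv_zero]
      rw [ENNReal.top_mul (ENNReal.inv_ne_zero.2 ENNReal.ofReal_ne_top), ENNReal.mul_top hC]
      exact le_top
    by_cases hv0 : v = 0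
    · rw [hv0]; simp only [norm_zero, ENNReal.ofReal_zero, ENNReal.inv_zero]
      rw [ENNReal.mul_top (ENNReal.inv_ne_zero.2 ENNReal.ofReal_ne_top), ENNReal.mul_top hC]
      exact le_top
    have hu' : 0 < ‖u‖ := norm_pos_iff.2 hu0
    have hv' : 0 < ‖v‖ := norm_pos_iff.2 hv0
    have key := volume_strip_le hM hu0 hv0 hY0.le
    set S := {β | β ∈ Kp M ∧ 0 ≤ Br β u v ∧ Br β u v ≤ Y} with hS
    have hSm : MeasurableSet S := by
      have hBm : ∀ u v : ℝ × ℝ, Measurable fun β => Br β u v := fun u v => by unfold Br; fun_prop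
      exact (Kp_measurableSet M).inter ((measurableSet_le measurable_const (hBm _ _)).inter
        (measurableSet_le (hBm _ _) measurable_const))
    calc _ ≤ ∫⁻ β, S.indicator (fun _ => ENNReal.ofReal L) β := by
          apply lintegral_mono
          intro β
          by_cases h0 : oi (s ^ 4) Y z β * ENNReal.ofReal (ω β) = 0
          · simp only [h0]; exact zero_le
          obtain ⟨q1, q2⟩ := supp β h0
          have hmem : β ∈ S := by
            refine ⟨q2, ?_⟩
            rw [← aff_cf_eq_Br]; exact q1.2
          rw [Set.indicator_of_mem hmem]
          simp only
          rw [oi_of_mem q1, one_mul]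
          exact ENNReal.ofReal_le_ofReal (hω.le β)
      _ = ENNReal.ofReal L * volume S := lintegral_indicator_const hSm _
      _ ≤ ENNReal.ofReal L * ENNReal.ofReal (6400 * M ^ 4 * Y / (‖u‖ * ‖v‖)) :=
          mul_le_mul_right key _
      _ = _ := by
          rw [← ENNReal.ofReal_inv_of_pos hu', ← ENNReal.ofReal_inv_of_pos hv',
            ← ENNReal.ofReal_mul (by positivity), ← ENNReal.ofReal_mul (by positivity),
            ← ENNReal.ofReal_mul (by positivity)]
          congr 1; field_simp
  refine hvol.trans (mul_le_mul_right ?_ _)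
  have i1 : ∀ {B : ℝ} {w : ℝ × ℝ}, ‖w‖ ≤ B → iv B w = (ENNReal.ofReal ‖w‖)⁻¹ := fun h =>
    Set.indicator_of_mem (s := {u : ℝ × ℝ | ‖u‖ ≤ _}) h _
  rcases hA with h | h
  · rw [i1 h, i1 k2]; exact le_self_add
  · rw [i1 k1, i1 h]; exact le_add_self

theorem lintegral_oi_mul (X Y : ℝ) {g : ℝ × ℝ → ENNReal} (hg : Measurable g) :
    ∫⁻ z, ∫⁻ β, oi X Y z β * g β = ∫⁻ β, volume (Om X Y β) * g β := by
  have hk : Measurable (Function.uncurry (oi X Y)) :=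
    (oi_measurable X Y).comp (measurable_snd.prodMk measurable_fst)
  rw [lintegral_lintegral_swap (hk.mul (hg.comp measurable_snd)).aemeasurable]
  congr 1; ext β
  have h2 : Measurable fun z => oi X Y z β := hk.comp (measurable_id.prodMk measurable_const)
  rw [lintegral_mul_const _ h2, lintegral_oi]

theorem first_moment_aux {M L s Y : ℝ} {ω : ℝ × ℝ → ℝ} (hM : 1 ≤ M) (hL : 0 ≤ L)
    (hω : IsWt M L ω) (hs : 8 * cplK M ≤ s) (hY0 : 0 < Y) (hY : Y ≤ 1) :
    ∫⁻ β, volume (Om (s ^ 4) Y β) * ENNReal.ofReal (ω β) ≤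
      ENNReal.ofReal (1 + cplK M / s) *
        (∫⁻ β, Gf (s ^ 4 + omK M * s ^ 3) Y β * bw M L s ω β) +
      ENNReal.ofReal (L * (6400 * M ^ 4 * Y) * (1024 * M * √(4 * (3 + M) * s ^ 3) * s ^ 2)) := by
  have hsK := eight_le_of_cplK_le hM hs
  have hM4 : 1 ≤ M ^ 4 := one_le_pow₀ hM
  have hs1 : 1 ≤ s := by nlinarith
  set A := √(4 * (3 + M) * s ^ 3) with hA
  have hA0 : 0 ≤ A := Real.sqrt_nonneg _
  set R := 8 * M * s ^ 2 with hR
  set X' := s ^ 4 + omK M * s ^ 3 with hX'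
  have hbw := bw_measurable M L s hω.meas
  rw [← lintegral_oi_mul _ _ hω.meas.ennreal_ofReal]
  set F : ((ℤ × ℤ) × (ℤ × ℤ)) → ENNReal := fun P => ∫⁻ β, og X' Y P β * bw M L s ω β with hF
  set H : (ℝ × ℝ) × (ℝ × ℝ) → ENNReal := fun z =>
    iv A (z.1 - z.2) * iv R (z.1 + z.2) + iv R (z.1 - z.2) * iv A (z.1 + z.2) with hH
  have i1 : ∀ B C : ℝ, Measurable fun z : (ℝ × ℝ) × (ℝ × ℝ) => iv B (z.1 - z.2) * iv C (z.1 + z.2) :=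
    fun B C => ((iv_measurable B).comp (measurable_fst.sub measurable_snd)).mul
      ((iv_measurable C).comp (measurable_fst.add measurable_snd))
  have hHm : Measurable H := (i1 A R).add (i1 R A)
  have hpt : ∀ z, ∫⁻ β, oi (s ^ 4) Y z β * ENNReal.ofReal (ω β) ≤
      ENNReal.ofReal (1 + cplK M / s) * F (fl z) + ENNReal.ofReal (L * (6400 * M ^ 4 * Y)) * H z := by
    intro z
    by_cases h1 : s ^ 3 ≤ |(cf z).2.1| ∨ s ^ 3 ≤ |(cf z).2.2|
    · exact (good_single hM hL hω hs z h1).trans le_self_add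
    by_cases h2 : ‖z.1 - z.2‖ ≤ A ∨ ‖z.1 + z.2‖ ≤ A
    · exact (near_single hM hL hω hY0 z h2).trans le_add_self
    have : ∀ β, oi (s ^ 4) Y z β * ENNReal.ofReal (ω β) = 0 := by
      intro β
      by_contra h
      have a1 := left_ne_zero_of_mul h
      have a2 := right_ne_zero_of_mul h
      have hz : z ∈ Om (s ^ 4) Y β := by_contra fun hc => a1 (Set.indicator_of_notMem hc _)
      have hβ := K1_subset_Kp M (hω.supp β fun h0 => a2 (by rw [h0]; simp))
      rcases regular_or_near hM hs1 hY hβ hz with h | h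
      · exact h1 h
      · exact h2 h
    simp only [this, lintegral_zero]; exact zero_le
  have hFm : Measurable fun z => F (fl z) := (measurable_of_countable F).comp fl_measurable
  calc _ ≤ ∫⁻ z, (ENNReal.ofReal (1 + cplK M / s) * F (fl z) +
        ENNReal.ofReal (L * (6400 * M ^ 4 * Y)) * H z) := lintegral_mono hpt
    _ = ENNReal.ofReal (1 + cplK M / s) * ∑' P, F P +
        ENNReal.ofReal (L * (6400 * M ^ 4 * Y)) * ∫⁻ z, H z := by
        rw [lintegral_add_left (hFm.const_mul _), lintegral_const_mul _ hFm,
          lintegral_const_mul _ hHm, lintegral_fl]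
    _ ≤ _ := by
        apply add_le_add
        · apply le_of_eq
          congr 1
          have e : ∀ β, Gf X' Y β * bw M L s ω β = ∑' P, og X' Y P β * bw M L s ω β :=
            fun β => ENNReal.tsum_mul_right.symm
          simp only [e]
          exact (lintegral_tsum (f := fun P β => og X' Y P β * bw M L s ω β)
            fun P => ((og_measurable _ _ P).mul hbw).aemeasurable).symm
        · have hR0 : 0 ≤ R := by positivity
          have j1 := lintegral_iv_le hA0
          have j2 := lintegral_iv_le hR0
          have : ∫⁻ z, H z ≤ ENNReal.ofReal (1024 * M * A * s ^ 2) := by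
            simp only [hH]
            rw [lintegral_add_left (i1 A R), lintegral_sub_add (iv_measurable A) (iv_measurable R),
              lintegral_sub_add (iv_measurable R) (iv_measurable A)]
            calc _ ≤ ENNReal.ofReal (1 / 4) * (ENNReal.ofReal (16 * A) * ENNReal.ofReal (16 * R)) +
                  ENNReal.ofReal (1 / 4) * (ENNReal.ofReal (16 * R) * ENNReal.ofReal (16 * A)) :=
                  add_le_add (mul_le_mul_right (mul_le_mul' j1 j2) _)
                    (mul_le_mul_right (mul_le_mul' j2 j1) _)
              _ = _ := by
                rw [← ENNReal.ofReal_mul (by positivity), ← ENNReal.ofReal_mul (by positivity),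
                  ← ENNReal.ofReal_mul (by positivity), ← ENNReal.ofReal_mul (by positivity),
                  ← ENNReal.ofReal_add (by positivity) (by positivity)]
                congr 1; rw [hR]; ring
          rw [ENNReal.ofReal_mul (p := L * (6400 * M ^ 4 * Y)) (by positivity)]
          exact mul_le_mul_right this _

theorem og_mono {X X' Y Y' : ℝ} (hX : X ≤ X') (hY : Y ≤ Y') (P : (ℤ × ℤ) × (ℤ × ℤ)) (β : ℝ × ℝ) :
    og X Y P β ≤ og X' Y' P β := by
  by_cases h : og X Y P β = 0
  · rw [h]; exact zero_le
  obtain ⟨h1, h2, h3, h4⟩ := og_ne_zero h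
  have : og X' Y' P β = 1 :=
    Set.indicator_of_mem (s := {β | P ∈ NZ ∧ cz P ∈ Om X' Y' β})
      ⟨h1, h2.trans hX, h3, h4.trans hY⟩ _
  rw [this]; exact og_le_one _ _ _ _

theorem Gf_mono {X X' Y Y' : ℝ} (hX : X ≤ X') (hY : Y ≤ Y') (β : ℝ × ℝ) :
    Gf X Y β ≤ Gf X' Y' β := ENNReal.tsum_le_tsum fun P => og_mono hX hY P β

theorem wt_measurable : Measurable wt := by unfold wt disc; fun_prop

theorem lintegral_wt_le {M L : ℝ} {ω : ℝ × ℝ → ℝ} (hL : 0 ≤ L) (hω : IsWt M L ω)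
    (k : ℕ) : ∫⁻ β, ENNReal.ofReal (wt β ^ k * ω β) ≤ ENNReal.ofReal (160 ^ k * L * (2 * M)) := by
  calc _ ≤ ∫⁻ β, (Kp M).indicator (fun _ => ENNReal.ofReal (160 ^ k * L)) β := by
        apply lintegral_mono
        intro β
        by_cases h : ω β = 0
        · simp only [h, mul_zero, ENNReal.ofReal_zero]; exact zero_le
        have hβ := K1_subset_Kp M (hω.supp β h)
        have h0 := wt_nonneg hβ
        have h1 := wt_le hβ
        have h2 := hω.le β
        have h3 := hω.nonneg β
        rw [Set.indicator_of_mem hβ]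
        apply ENNReal.ofReal_le_ofReal
        gcongr
    _ = ENNReal.ofReal (160 ^ k * L) * volume (Kp M) :=
        lintegral_indicator_const (Kp_measurableSet M) _
    _ ≤ ENNReal.ofReal (160 ^ k * L) * ENNReal.ofReal (2 * M) :=
        mul_le_mul_right (volume_Kp_le M) _
    _ = _ := by rw [← ENNReal.ofReal_mul (by positivity)]

theorem lower_volume {M L s Y : ℝ} {ω : ℝ × ℝ → ℝ} (hω : IsWt M L ω) (hY : 0 ≤ Y)
    (hYs : Y ≤ s ^ 4) :
    ENNReal.ofReal ((s ^ 4 - Y) * Y) * ∫⁻ β, ENNReal.ofReal (wt β * ω β) ≤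
      ∫⁻ β, volume (Om (s ^ 4) Y β) * ENNReal.ofReal (ω β) := by
  rw [← lintegral_const_mul' _ _ ENNReal.ofReal_ne_top]
  apply lintegral_mono
  intro β
  by_cases h : ω β = 0
  · simp [h]
  have hβ := K1_subset_Kp M (hω.supp β h)
  have hd : 0 < disc β := by linarith [disc_lower hβ]
  have h0 := wt_nonneg hβ
  simp only
  rw [← ENNReal.ofReal_mul (mul_nonneg (sub_nonneg.2 hYs) hY)]
  calc _ = ENNReal.ofReal (wt β * (s ^ 4 - Y) * Y) * ENNReal.ofReal (ω β) := by
        rw [← ENNReal.ofReal_mul (mul_nonneg (mul_nonneg h0 (sub_nonneg.2 hYs)) hY)]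
        congr 1; ring
    _ ≤ _ := mul_le_mul_left (le_volume_Om hd hY hYs) _

theorem bw_le {M L s : ℝ} {ω : ℝ × ℝ → ℝ} (hL : 0 ≤ L) (hω : IsWt M L ω) (hc : 0 ≤ cplK M / s)
    (β : ℝ × ℝ) :
    bw M L s ω β ≤ ENNReal.ofReal (ω β) +
      (Kp M).indicator (fun _ => ENNReal.ofReal (L * (cplK M / s))) β := by
  unfold bw
  by_cases h : β ∈ Kp M
  · rw [Set.indicator_of_mem h, Set.indicator_of_mem h,
      ENNReal.ofReal_add (hω.nonneg β) (by positivity)]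
  · rw [Set.indicator_of_notMem h]; exact zero_le

theorem lintegral_Gf_bw {M L s X Y : ℝ} {ω : ℝ × ℝ → ℝ} (hL : 0 ≤ L) (hω : IsWt M L ω)
    (hc : 0 ≤ cplK M / s) (hc1 : cplK M / s ≤ 1) :
    ENNReal.ofReal (1 + cplK M / s) * ∫⁻ β, Gf X Y β * bw M L s ω β ≤
      (∫⁻ β, Gf X Y β * ENNReal.ofReal (ω β)) +
        ENNReal.ofReal (3 * L * (cplK M / s)) * ∫⁻ β in Kp M, Gf X Y β := by
  set d := cplK M / s with hd
  have hG := Gf_measurable X Y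
  set I := ∫⁻ β in Kp M, Gf X Y β with hI
  have hind : ∀ a : ENNReal, ∫⁻ β, Gf X Y β * (Kp M).indicator (fun _ => a) β = a * I := by
    intro a
    rw [hI, ← lintegral_const_mul _ hG, ← lintegral_indicator (Kp_measurableSet M)]
    congr 1; ext β
    by_cases h : β ∈ Kp M
    · rw [Set.indicator_of_mem h, Set.indicator_of_mem h, mul_comm]
    · rw [Set.indicator_of_notMem h, Set.indicator_of_notMem h, mul_zero]
  have h1 : ∫⁻ β, Gf X Y β * bw M L s ω β ≤
      (∫⁻ β, Gf X Y β * ENNReal.ofReal (ω β)) + ENNReal.ofReal (L * d) * I := by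
    rw [← hind, ← lintegral_add_left
      (f := fun β => Gf X Y β * ENNReal.ofReal (ω β)) (hG.mul hω.meas.ennreal_ofReal)]
    apply lintegral_mono
    intro β
    simp only
    rw [← mul_add]
    exact mul_le_mul_right (bw_le hL hω hc β) _
  have h2 : ∫⁻ β, Gf X Y β * bw M L s ω β ≤ ENNReal.ofReal (2 * L) * I := by
    rw [← hind]
    apply lintegral_mono
    intro β
    refine mul_le_mul_right ?_ _
    unfold bw
    by_cases h : β ∈ Kp M
    · rw [Set.indicator_of_mem h, Set.indicator_of_mem h]
      apply ENNReal.ofReal_le_ofReal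
      have := hω.le β
      nlinarith
    · rw [Set.indicator_of_notMem h]; exact zero_le
  rw [ENNReal.ofReal_add zero_le_one hc, ENNReal.ofReal_one, add_mul, one_mul]
  calc _ ≤ ((∫⁻ β, Gf X Y β * ENNReal.ofReal (ω β)) + ENNReal.ofReal (L * d) * I) +
        ENNReal.ofReal d * (ENNReal.ofReal (2 * L) * I) :=
        add_le_add h1 (mul_le_mul_right h2 _)
    _ = _ := by
        rw [← mul_assoc, ← ENNReal.ofReal_mul hc, add_assoc, ← add_mul,
          ← ENNReal.ofReal_add (by positivity) (by positivity)]
        congr 3; ring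

theorem first_moment {M L : ℝ} (hM : 1 ≤ M) (hL : 0 ≤ L) :
    ∃ C r₀ : ℝ, 0 ≤ C ∧ 1 ≤ r₀ ∧ ∀ ω, IsWt M L ω → ∀ r, r₀ ≤ r → ∀ Y, 0 < Y → Y ≤ 1 →
      ENNReal.ofReal (r ^ 8 * Y) * (∫⁻ β, ENNReal.ofReal (wt β * ω β)) ≤
        (∫⁻ β, Gf (r ^ 8) Y β * ENNReal.ofReal (ω β)) + ENNReal.ofReal (C * r ^ 7 * Y) := by
  have hc := cplK_pos hM
  have ho := omK_pos hM
  set c := cplK M with hcdef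
  set o := omK M with hodef
  set D := 6400 * 9216 * M ^ 6 with hD
  set q := √(4 * (3 + M)) with hq
  have hq0 : 0 ≤ q := Real.sqrt_nonneg _
  have hD0 : 0 ≤ D := by positivity
  refine ⟨(4 * o + 1) * (160 * L * (2 * M)) + 6 * L * c * D + L * 6400 * M ^ 4 * (1024 * M * q),
    1 + 8 * c + 2 * o, by positivity, by linarith, ?_⟩
  intro ω hω r hr Y hY0 hY1
  have hr1 : 1 ≤ r := by linarith
  set t := r ^ 2 with ht
  have htr : r ≤ t := by nlinarith
  set s := t - o with hs
  have hs8 : 8 * c ≤ s := by linarith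
  have hs1 : 1 ≤ s := by linarith
  have hst : s ≤ t := by linarith
  have hs2 : t ≤ 2 * s := by linarith
  have hs0 : 0 < s := by linarith
  have ht1 : 1 ≤ t := by linarith
  have hcs : 0 ≤ c / s := by positivity
  have hcs1 : c / s ≤ 1 := by rw [div_le_one hs0]; linarith
  have r8 : r ^ 8 = t ^ 4 := by rw [ht]; ring
  have hs41 : 1 ≤ s ^ 4 := one_le_pow₀ hs1
  have hX : s ^ 4 + o * s ^ 3 ≤ r ^ 8 := by
    rw [r8]
    calc s ^ 4 + o * s ^ 3 = s ^ 3 * t := by rw [show t = s + o by rw [hs]; ring]; ring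
      _ ≤ t ^ 3 * t := by gcongr
      _ = _ := by ring
  have hts : t ^ 4 - s ^ 4 ≤ 4 * o * t ^ 3 := by
    have e : t ^ 4 - s ^ 4 = o * (t ^ 3 + t ^ 2 * s + t * s ^ 2 + s ^ 3) := by
      rw [show o = t - s by rw [hs]; ring]; ring
    rw [e]
    have : t ^ 3 + t ^ 2 * s + t * s ^ 2 + s ^ 3 ≤ t ^ 3 + t ^ 2 * t + t * t ^ 2 + t ^ 3 := by gcongr
    nlinarith
  have ht3 : 1 ≤ t ^ 3 := one_le_pow₀ ht1
  have ht37 : t ^ 3 ≤ r ^ 7 := by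
    rw [ht, ← pow_mul]; exact pow_le_pow_right₀ hr1 (by norm_num)
  have aux := first_moment_aux hM hL hω hs8 hY0 hY1
  have low := lower_volume hω hY0.le (hY1.trans hs41)
  have hmom : ∫⁻ β in Kp M, Gf (r ^ 8) Y β ≤ ENNReal.ofReal (D * t ^ 4 * Y) := by
    rw [r8]; exact lintegral_Gf_le hM hY0.le
  have hW := lintegral_wt_le hL hω 1
  simp only [pow_one] at hW
  set W := ∫⁻ β, ENNReal.ofReal (wt β * ω β) with hWdef
  calc _ ≤ (ENNReal.ofReal ((s ^ 4 - Y) * Y) + ENNReal.ofReal ((4 * o + 1) * t ^ 3 * Y)) * W := by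
        refine mul_le_mul_left ?_ _
        rw [← ENNReal.ofReal_add (mul_nonneg (by linarith) hY0.le) (by positivity)]
        apply ENNReal.ofReal_le_ofReal
        rw [r8, ← add_mul]
        gcongr
        linarith
    _ ≤ (ENNReal.ofReal (1 + c / s) * (∫⁻ β, Gf (s ^ 4 + o * s ^ 3) Y β * bw M L s ω β) +
        ENNReal.ofReal (L * (6400 * M ^ 4 * Y) * (1024 * M * √(4 * (3 + M) * s ^ 3) * s ^ 2))) +
        ENNReal.ofReal ((4 * o + 1) * t ^ 3 * Y) * ENNReal.ofReal (160 * L * (2 * M)) := by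
        rw [add_mul]
        exact add_le_add (low.trans aux) (mul_le_mul_right hW _)
    _ ≤ (((∫⁻ β, Gf (r ^ 8) Y β * ENNReal.ofReal (ω β)) +
        ENNReal.ofReal (3 * L * (c / s)) * ENNReal.ofReal (D * t ^ 4 * Y)) +
        ENNReal.ofReal (L * (6400 * M ^ 4 * Y) * (1024 * M * (q * r ^ 3) * t ^ 2))) +
        ENNReal.ofReal ((4 * o + 1) * t ^ 3 * Y * (160 * L * (2 * M))) := by
        refine add_le_add (add_le_add ?_ ?_) ?_
        · refine (mul_le_mul_right (lintegral_mono fun β =>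
            mul_le_mul_left (Gf_mono hX le_rfl β) _) _).trans ?_
          exact (lintegral_Gf_bw hL hω hcs hcs1).trans
            (add_le_add le_rfl (mul_le_mul_right hmom _))
        · apply ENNReal.ofReal_le_ofReal
          have : √(4 * (3 + M) * s ^ 3) ≤ q * r ^ 3 := by
            rw [hq]
            have e : q * r ^ 3 = √(4 * (3 + M) * t ^ 3) := by
              rw [Real.sqrt_mul (by positivity), ht, ← pow_mul, show 2 * 3 = 3 * 2 from rfl, pow_mul,
                Real.sqrt_sq (by positivity)]
            rw [← hq, e]
            apply Real.sqrt_le_sqrt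
            gcongr
          gcongr
        · rw [← ENNReal.ofReal_mul (by positivity)]
    _ ≤ _ := by
        rw [← ENNReal.ofReal_mul (by positivity), add_assoc, add_assoc,
          ← ENNReal.ofReal_add (by positivity) (by positivity),
          ← ENNReal.ofReal_add (by positivity) (by positivity)]
        refine add_le_add le_rfl (ENNReal.ofReal_le_ofReal ?_)
        have e1 : 3 * L * (c / s) * (D * t ^ 4 * Y) ≤ 6 * L * c * D * r ^ 7 * Y := by
          have : c / s ≤ 2 * c / t := by
            rw [div_le_div_iff₀ hs0 (by linarith)]; nlinarith
          calc _ ≤ 3 * L * (2 * c / t) * (D * t ^ 4 * Y) := by gcongr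
            _ = 6 * L * c * D * t ^ 3 * Y := by field_simp; ring
            _ ≤ _ := by gcongr
        have e2 : L * (6400 * M ^ 4 * Y) * (1024 * M * (q * r ^ 3) * t ^ 2) =
            L * 6400 * M ^ 4 * (1024 * M * q) * r ^ 7 * Y := by rw [ht]; ring
        have e3 : (4 * o + 1) * t ^ 3 * Y * (160 * L * (2 * M)) ≤
            (4 * o + 1) * r ^ 7 * Y * (160 * L * (2 * M)) := by gcongr
        rw [e2]
        linarith

set_option maxHeartbeats 1000000 in
theorem second_moment {M L ε : ℝ} (hM : 1 ≤ M) (hL : 0 ≤ L) (hε : 0 < ε) :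
    ∃ C r₀ : ℝ, 0 ≤ C ∧ 1 ≤ r₀ ∧ ∀ ω, IsWt M L ω → ∀ r, r₀ ≤ r → ∀ Y, 0 < Y → Y ≤ 1 / (32 * M) →
      ∫⁻ β, Gf (r ^ 8) Y β * Gf (r ^ 8) Y β * ENNReal.ofReal (ω β) ≤
        ENNReal.ofReal (r ^ 16 * Y ^ 2) * (∫⁻ β, ENNReal.ofReal (wt β ^ 2 * ω β)) +
          ENNReal.ofReal (C * (r ^ 14 * Y ^ 2 + r ^ 8 * Y) * r ^ ε) := by
  have hc := cplK_pos hM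
  have ho := omK_pos hM
  have hb := badK_pos hM
  set c := cplK M with hcdef
  set o := omK M with hodef
  set K := (1 + c) * (1 + o) ^ 2 with hK
  set E := 160 ^ 2 * L * c * (2 * M) with hE
  set W2 := 160 ^ 2 * L * (2 * M) with hW2
  set Q := (1 + 1 / (ε / 48)) ^ 6 * ((128 * M ^ 2) ^ (ε / 48)) ^ 6 with hQ
  refine ⟨K * W2 + K * E + L * (badK M * (64 * M ^ 2)) * (2 * 432 ^ 2 * Q),
    1 + 8 * c, by positivity, by linarith, ?_⟩
  intro ω hω r hr Y hY0 hY1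
  have hr1 : 1 ≤ r := by linarith
  set s := r ^ 2 with hs_def
  have hsr : r ≤ s := by nlinarith
  have hs8 : 8 * c ≤ s := by linarith
  have hs1 : 1 ≤ s := by linarith
  have hs0 : 0 < s := by linarith
  have r8 : r ^ 8 = s ^ 4 := by rw [hs_def]; ring
  have r16 : r ^ 16 = s ^ 8 := by rw [hs_def]; ring
  have r14 : r ^ 14 = s ^ 7 := by rw [hs_def]; ring
  have hrε : 1 ≤ r ^ ε := Real.one_le_rpow hr1 hε.le
  have hsplit : ∫⁻ β, Gf (r ^ 8) Y β * Gf (r ^ 8) Y β * ENNReal.ofReal (ω β) =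
      (∑' P, ∑' P', (GP s).indicator (fun q => Jc (s ^ 4) Y ω q.1 q.2) (P, P')) +
      ∑' P, ∑' P', (GP s)ᶜ.indicator (fun q => Jc (s ^ 4) Y ω q.1 q.2) (P, P') := by
    rw [r8, lintegral_Gf_sq _ _ hω.meas, ← ENNReal.tsum_add]
    congr 1; ext P
    rw [← ENNReal.tsum_add]
    congr 1; ext P'
    exact (congrFun (Set.indicator_self_add_compl (GP s) fun q => Jc (s ^ 4) Y ω q.1 q.2) (P, P')).symm
  have good := good_sum hM hL hω hs8 hY0.le
  have bad := bad_sum hM hL hω hs0.le hY0.le hY1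
  have hW := lintegral_wt_le hL hω 2
  set W := ∫⁻ β, ENNReal.ofReal (wt β ^ 2 * ω β) with hWdef
  have hfac : (1 + c / s) * (s ^ 4 + o * s ^ 3) ^ 2 * Y ^ 2 ≤ s ^ 8 * Y ^ 2 + K * s ^ 7 * Y ^ 2 := by
    rw [← add_mul]
    gcongr
    have e : (1 + c / s) * (s ^ 4 + o * s ^ 3) ^ 2 =
        s ^ 8 + (c + 2 * o) * s ^ 7 + (2 * c * o + o ^ 2) * s ^ 6 + c * o ^ 2 * s ^ 5 := by
      field_simp; ring
    have h6 : s ^ 6 ≤ s ^ 7 := pow_le_pow_right₀ hs1 (by norm_num)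
    have h5 : s ^ 5 ≤ s ^ 7 := pow_le_pow_right₀ hs1 (by norm_num)
    have h7 : 0 ≤ s ^ 7 := by positivity
    rw [e]
    have a1 : (2 * c * o + o ^ 2) * s ^ 6 ≤ (2 * c * o + o ^ 2) * s ^ 7 := by gcongr
    have a2 : c * o ^ 2 * s ^ 5 ≤ c * o ^ 2 * s ^ 7 := by gcongr
    have a3 : K * s ^ 7 = s ^ 7 + (c + 2 * o) * s ^ 7 + (2 * c * o + o ^ 2) * s ^ 7 +
      c * o ^ 2 * s ^ 7 := by rw [hK]; ring
    linarith
  have hfac2 : (1 + c / s) * (s ^ 4 + o * s ^ 3) ^ 2 * Y ^ 2 ≤ K * s ^ 8 * Y ^ 2 := by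
    have : (s ^ 4 + o * s ^ 3) ≤ (1 + o) * s ^ 4 := by
      have : s ^ 3 ≤ s ^ 4 := pow_le_pow_right₀ hs1 (by norm_num)
      nlinarith
    have h2 : c / s ≤ c := div_le_self hc.le hs1
    calc _ ≤ (1 + c) * ((1 + o) * s ^ 4) ^ 2 * Y ^ 2 := by gcongr
      _ = _ := by rw [hK]; ring
  have hgood : ENNReal.ofReal ((1 + c / s) * (s ^ 4 + o * s ^ 3) ^ 2 * Y ^ 2) *
      (W + ENNReal.ofReal (E / s)) ≤ ENNReal.ofReal (r ^ 16 * Y ^ 2) * W +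
        (ENNReal.ofReal (K * s ^ 7 * Y ^ 2 * W2) + ENNReal.ofReal (K * s ^ 8 * Y ^ 2 * (E / s))) := by
    rw [mul_add, ← add_assoc]
    refine add_le_add ?_ ?_
    · calc _ ≤ (ENNReal.ofReal (s ^ 8 * Y ^ 2) + ENNReal.ofReal (K * s ^ 7 * Y ^ 2)) * W := by
            rw [← ENNReal.ofReal_add (by positivity) (by positivity)]
            exact mul_le_mul_left (ENNReal.ofReal_le_ofReal hfac) _
        _ ≤ _ := by
            rw [add_mul, r16, ENNReal.ofReal_mul (p := K * s ^ 7 * Y ^ 2) (by positivity)]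
            exact add_le_add le_rfl (mul_le_mul_right hW _)
    · rw [← ENNReal.ofReal_mul (by positivity)]
      apply ENNReal.ofReal_le_ofReal
      gcongr
  set n := ⌊8 * M * s ^ 2⌋₊ with hn
  have hnle : (n : ℝ) ≤ 8 * M * s ^ 2 := Nat.floor_le (by positivity)
  have hn1 : 1 ≤ n := Nat.le_floor (by push_cast; nlinarith [one_le_pow₀ hs1 (n := 2)])
  have hhs : hs (2 * n * n) ^ 6 ≤ Q * r ^ ε := by
    have h1 := hs_le_rpow (show 0 < ε / 48 by positivity) (2 * n * n)
      (by nlinarith [Nat.mul_le_mul hn1 hn1])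
    have h2 : (((2 * n * n : ℕ) : ℝ)) ^ (ε / 48) ≤ (128 * M ^ 2) ^ (ε / 48) * (r ^ (ε / 6)) := by
      calc _ ≤ (128 * M ^ 2 * r ^ 8) ^ (ε / 48) := by
            apply Real.rpow_le_rpow (by positivity) _ (by positivity)
            push_cast
            calc (2 : ℝ) * n * n ≤ 2 * (8 * M * s ^ 2) * (8 * M * s ^ 2) := by gcongr
              _ = _ := by rw [hs_def]; ring
        _ = _ := by
            rw [Real.mul_rpow (by positivity) (by positivity), ← Real.rpow_natCast r 8,
              ← Real.rpow_mul (by positivity)]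
            congr 2; push_cast; ring
    calc _ ≤ ((1 + 1 / (ε / 48)) * ((128 * M ^ 2) ^ (ε / 48) * (r ^ (ε / 6)))) ^ 6 := by
          have := hs_nonneg (2 * n * n)
          gcongr
          exact h1.trans (by gcongr)
      _ = _ := by
          rw [mul_pow, mul_pow, ← Real.rpow_natCast (r ^ (ε / 6)) 6,
            ← Real.rpow_mul (by positivity), hQ]
          push_cast
          rw [show ε / 6 * 6 = ε by ring]; ring
  rw [hsplit]
  calc _ ≤ _ := add_le_add (good.trans hgood) bad
    _ ≤ _ := by
      rw [add_assoc, ← ENNReal.ofReal_add (by positivity) (by positivity),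
        ← ENNReal.ofReal_add (by positivity) (by positivity)]
      refine add_le_add le_rfl (ENNReal.ofReal_le_ofReal ?_)
      have e1 : K * s ^ 8 * Y ^ 2 * (E / s) = K * s ^ 7 * Y ^ 2 * E := by field_simp
      have e2 : L * (badK M * (Y ^ 2 * s ^ 7 + Y * (8 * M * s ^ 2) ^ 2)) *
          (2 * (432 * hs (2 * n * n) ^ 3) ^ 2) ≤
          L * (badK M * (64 * M ^ 2)) * (2 * 432 ^ 2 * Q) * ((s ^ 7 * Y ^ 2 + s ^ 4 * Y) * r ^ ε) := by
        have f1 : Y ^ 2 * s ^ 7 + Y * (8 * M * s ^ 2) ^ 2 ≤ 64 * M ^ 2 * (s ^ 7 * Y ^ 2 + s ^ 4 * Y) := by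
          have : 1 ≤ 64 * M ^ 2 := by nlinarith [one_le_pow₀ hM (n := 2)]
          have hA := mul_le_mul_of_nonneg_right this (show 0 ≤ s ^ 7 * Y ^ 2 by positivity)
          have hB : Y * (8 * M * s ^ 2) ^ 2 = 64 * M ^ 2 * (s ^ 4 * Y) := by ring
          rw [hB, mul_add, mul_comm (Y ^ 2)]
          linarith
        have f2 : 2 * (432 * hs (2 * n * n) ^ 3) ^ 2 ≤ 2 * 432 ^ 2 * (Q * r ^ ε) := by
          calc _ = 2 * 432 ^ 2 * hs (2 * n * n) ^ 6 := by ring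
            _ ≤ _ := by gcongr
        calc _ ≤ L * (badK M * (64 * M ^ 2 * (s ^ 7 * Y ^ 2 + s ^ 4 * Y))) *
              (2 * 432 ^ 2 * (Q * r ^ ε)) := by gcongr
          _ = _ := by ring
      rw [r14, r8, e1]
      have hW20 : 0 ≤ K * W2 + K * E := by positivity
      have e3 : s ^ 7 * Y ^ 2 ≤ (s ^ 7 * Y ^ 2 + s ^ 4 * Y) * r ^ ε := by
        have h0 : 0 ≤ s ^ 4 * Y := by positivity
        have h1 : 0 ≤ s ^ 7 * Y ^ 2 := by positivity
        nlinarith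
      have e4 := mul_le_mul_of_nonneg_left e3 hW20
      linarith

/-- A tent function supported on `K1 M`. -/
noncomputable def tent (M : ℝ) (β : ℝ × ℝ) : ℝ :=
  max 0 (min (min (β.1 + 1 / 4) (5 / 4 - β.1)) (min (β.2 - 3 / 4) (M - 1 / 4 - β.2)))

theorem tent_measurable (M : ℝ) : Measurable (tent M) := by unfold tent; fun_prop

theorem tent_nonneg (M : ℝ) (β : ℝ × ℝ) : 0 ≤ tent M β := le_max_left _ _

theorem tent_le_one (M : ℝ) (β : ℝ × ℝ) : tent M β ≤ 1 := by
  refine max_le zero_le_one ((min_le_left _ _).trans ?_)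
  rcases le_total (β.1 + 1 / 4) 1 with h | h
  · exact (min_le_left _ _).trans h
  · exact (min_le_right _ _).trans (by linarith)

theorem mem_K1_of_tent_ne_zero {M : ℝ} {β : ℝ × ℝ} (h : tent M β ≠ 0) : β ∈ K1 M := by
  by_contra hβ
  refine h (max_eq_left ?_)
  by_contra! h0
  simp only [lt_min_iff] at h0
  obtain ⟨⟨h1, h2⟩, h3, h4⟩ := h0
  exact hβ ⟨⟨by linarith, by linarith⟩, by linarith, by linarith⟩

theorem tent_le_add (M : ℝ) (β β' : ℝ × ℝ) : tent M β ≤ tent M β' + ‖β' - β‖ := by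
  have h1 := abs_le.1 (abs_fst_le (β' - β))
  have h2 := abs_le.1 (abs_snd_le (β' - β))
  rw [Prod.fst_sub] at h1
  rw [Prod.snd_sub] at h2
  unfold tent
  refine max_le (add_nonneg (le_max_left _ _) (norm_nonneg _)) ?_
  rw [← sub_le_iff_le_add]
  refine le_trans ?_ (le_max_right _ _)
  rw [sub_le_iff_le_add]
  rcases min_choice (min (β'.1 + 1 / 4) (5 / 4 - β'.1)) (min (β'.2 - 3 / 4) (M - 1 / 4 - β'.2))
    with h | h <;> rw [h]
  · refine (min_le_left _ _).trans ?_
    rcases min_choice (β'.1 + 1 / 4) (5 / 4 - β'.1) with h | h <;> rw [h]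
    · exact (min_le_left _ _).trans (by linarith)
    · exact (min_le_right _ _).trans (by linarith)
  · refine (min_le_right _ _).trans ?_
    rcases min_choice (β'.2 - 3 / 4) (M - 1 / 4 - β'.2) with h | h <;> rw [h]
    · exact (min_le_left _ _).trans (by linarith)
    · exact (min_le_right _ _).trans (by linarith)

theorem quarter_le_tent {M : ℝ} {β : ℝ × ℝ} (h : β ∈ Set.Icc (0 : ℝ) 1 ×ˢ Set.Icc 1 (M - 1 / 2)) :
    1 / 4 ≤ tent M β := by
  obtain ⟨⟨h1, h2⟩, h3, h4⟩ := h
  refine le_trans ?_ (le_max_right _ _)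
  refine le_min (le_min ?_ ?_) (le_min ?_ ?_) <;> linarith

theorem isWt_tent_mul {M A B L : ℝ} {f : ℝ × ℝ → ℝ} (hf : Measurable f)
    (hA : 0 ≤ A) (hL : A + B ≤ L) (hf0 : ∀ β ∈ Kp M, 0 ≤ f β) (hfB : ∀ β ∈ Kp M, f β ≤ B)
    (hB : 0 ≤ B)
    (hlip : ∀ β ∈ Kp M, ∀ β' ∈ Kp M, f β ≤ f β' + A * ‖β' - β‖) :
    IsWt M L (fun β => tent M β * f β) where
  meas := (tent_measurable M).mul hf
  nonneg β := by
    by_cases h : tent M β = 0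
    · rw [h, zero_mul]
    · exact mul_nonneg (tent_nonneg M β) (hf0 β (K1_subset_Kp M (mem_K1_of_tent_ne_zero h)))
  le β := by
    by_cases h : tent M β = 0
    · rw [h, zero_mul]; linarith
    · have hβ := K1_subset_Kp M (mem_K1_of_tent_ne_zero h)
      calc tent M β * f β ≤ 1 * B :=
            mul_le_mul (tent_le_one M β) (hfB β hβ) (hf0 β hβ) zero_le_one
        _ ≤ L := by linarith
  supp β h := mem_K1_of_tent_ne_zero (left_ne_zero_of_mul h)
  lip β β' hβ h := by
    have hK := K1_subset_Kp M hβ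
    have hK' := mem_Kp_of_near hβ h
    have hn := norm_nonneg (β' - β)
    have h1 : (tent M β - tent M β') * f β ≤ ‖β' - β‖ * B :=
      mul_le_mul (by linarith [tent_le_add M β β']) (hfB β hK) (hf0 β hK) hn
    have h2 : tent M β' * (f β - f β') ≤ 1 * (A * ‖β' - β‖) := by
      refine (mul_le_mul_of_nonneg_left ?_ (tent_nonneg M β')).trans
        (mul_le_mul_of_nonneg_right (tent_le_one M β') (mul_nonneg hA hn))
      linarith [hlip β hK β' hK']
    have h3 : (A + B) * ‖β' - β‖ ≤ L * ‖β' - β‖ := by gcongr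
    linarith

theorem disc_measurable : Measurable disc := by unfold disc; fun_prop

theorem disc_le_add {M : ℝ} {β β' : ℝ × ℝ} (hβ : β ∈ Kp M) (hβ' : β' ∈ Kp M) :
    disc β ≤ disc β' + 7 * ‖β' - β‖ := by
  obtain ⟨⟨b1, b2⟩, -⟩ := hβ
  obtain ⟨⟨c1, c2⟩, -⟩ := hβ'
  have h1 := abs_fst_le (β' - β)
  have h2 := abs_le.1 (abs_snd_le (β' - β))
  rw [Prod.fst_sub] at h1
  rw [Prod.snd_sub] at h2
  have h3 : (β'.1 - β.1) * (β'.1 + β.1) ≤ ‖β' - β‖ * 3 := by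
    refine (le_abs_self _).trans ?_
    rw [abs_mul]
    exact mul_le_mul h1 (abs_le.2 ⟨by linarith, by linarith⟩) (abs_nonneg _) (norm_nonneg _)
  unfold disc
  linarith [h2.1]

theorem isWt_tent_mul_disc {M : ℝ} (hM : 1 ≤ M) :
    IsWt M (100 * M ^ 2) (fun β => tent M β * disc β) :=
  isWt_tent_mul (A := 7) (B := 4 * M) disc_measurable (by norm_num) (by nlinarith)
    (fun β hβ => by linarith [disc_lower hβ]) (fun β hβ => disc_upper hβ) (by linarith)
    (fun β hβ β' hβ' => disc_le_add hβ hβ')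

theorem isWt_tent_mul_disc_sq {M : ℝ} (hM : 1 ≤ M) :
    IsWt M (100 * M ^ 2) (fun β => tent M β * disc β ^ 2) :=
  isWt_tent_mul (A := 56 * M) (B := 16 * M ^ 2) (disc_measurable.pow_const 2) (by linarith)
    (by nlinarith) (fun β _ => sq_nonneg _)
    (fun β hβ => by nlinarith [disc_upper hβ, disc_lower hβ]) (by positivity)
    (fun β hβ β' hβ' => by
      have h := disc_le_add hβ hβ'
      have u := disc_upper hβ
      have u' := disc_upper hβ'
      have l := disc_lower hβ
      have l' := disc_lower hβ'
      have h1 : (disc β - disc β') * (disc β + disc β') ≤ 7 * ‖β' - β‖ * (8 * M) :=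
        mul_le_mul (by linarith) (by linarith) (by linarith) (by positivity)
      linarith)

/-- The parameters at which the pair count deviates from its expected size by a factor `δ`. -/
def dev (δ X Y : ℝ) : Set (ℝ × ℝ) :=
  {β | ENNReal.ofReal ((1 + δ) * (wt β * X * Y)) < Gf X Y β} ∪
    {β | Gf X Y β < ENNReal.ofReal ((1 - δ) * (wt β * X * Y))}

theorem dev_measurableSet (δ X Y : ℝ) : MeasurableSet (dev δ X Y) := by
  have h := wt_measurable
  refine (measurableSet_lt ?_ (Gf_measurable X Y)).union
    (measurableSet_lt (Gf_measurable X Y) ?_) <;>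
  exact ENNReal.measurable_ofReal.comp (by fun_prop)

theorem chebyshev_pointwise {M δ X Y : ℝ} (hδ : 0 ≤ δ) (hX : 0 ≤ X) (hY : 0 ≤ Y) (β : ℝ × ℝ) :
    ENNReal.ofReal (2 * (4 * Real.pi ^ 2 * X * Y)) *
        (Gf X Y β * ENNReal.ofReal (tent M β * disc β)) +
      ENNReal.ofReal (δ ^ 2 * (4 * Real.pi ^ 2 * X * Y) ^ 2) *
        (dev δ X Y).indicator (fun β => ENNReal.ofReal (tent M β)) β ≤
    Gf X Y β * Gf X Y β * ENNReal.ofReal (tent M β * disc β ^ 2) +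
      ENNReal.ofReal ((4 * Real.pi ^ 2 * X * Y) ^ 2) * ENNReal.ofReal (tent M β) := by
  by_cases ht : tent M β = 0
  · have : (dev δ X Y).indicator (fun β => ENNReal.ofReal (tent M β)) β = 0 := by
      by_cases h : β ∈ dev δ X Y
      · rw [Set.indicator_of_mem h, ht, ENNReal.ofReal_zero]
      · rw [Set.indicator_of_notMem h]
    rw [this]; simp [ht]
  have hd : 0 < disc β := by
    linarith [disc_lower (K1_subset_Kp M (mem_K1_of_tent_ne_zero ht))]
  have htp : 0 < tent M β := lt_of_le_of_ne (tent_nonneg M β) (Ne.symm ht)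
  by_cases hG : Gf X Y β = ⊤
  · rw [hG, ENNReal.top_mul_top, ENNReal.top_mul (a := ENNReal.ofReal (tent M β * disc β ^ 2))
      (ENNReal.ofReal_pos.2 (mul_pos htp (pow_pos hd 2))).ne', top_add]
    exact le_top
  obtain ⟨g, hg0, hg⟩ : ∃ g : ℝ, 0 ≤ g ∧ Gf X Y β = ENNReal.ofReal g :=
    ⟨_, ENNReal.toReal_nonneg, (ENNReal.ofReal_toReal hG).symm⟩
  set κ := 4 * Real.pi ^ 2 with hκ
  have hκ0 : 0 ≤ κ := by positivity
  have hw : wt β * disc β = κ := by unfold wt; field_simp; rfl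
  have hXY : 0 ≤ wt β * X * Y := by unfold wt; positivity
  have key : (dev δ X Y).indicator (fun β => ENNReal.ofReal (tent M β)) β ≤
      ENNReal.ofReal ((dev δ X Y).indicator (fun β => tent M β) β) := by
    by_cases h : β ∈ dev δ X Y
    · rw [Set.indicator_of_mem h, Set.indicator_of_mem h]
    · rw [Set.indicator_of_notMem h]; exact zero_le
  refine (add_le_add le_rfl (mul_le_mul_right key _)).trans ?_
  rw [hg, ← ENNReal.ofReal_mul hg0, ← ENNReal.ofReal_mul hg0, ← ENNReal.ofReal_mul (p := 2 * (κ * X * Y)) (by positivity),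
    ← ENNReal.ofReal_mul (p := δ ^ 2 * (κ * X * Y) ^ 2) (by positivity),
    ← ENNReal.ofReal_mul (p := g * g) (by positivity),
    ← ENNReal.ofReal_mul (p := (κ * X * Y) ^ 2) (by positivity),
    ← ENNReal.ofReal_add (by positivity) (mul_nonneg (by positivity)
      (Set.indicator_nonneg (fun β _ => tent_nonneg M β) β)),
    ← ENNReal.ofReal_add (by positivity) (by positivity)]
  apply ENNReal.ofReal_le_ofReal
  by_cases hβ : β ∈ dev δ X Y
  · rw [Set.indicator_of_mem hβ]
    have : δ ^ 2 * (κ * X * Y) ^ 2 ≤ (g * disc β - κ * X * Y) ^ 2 := by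
      have hc0 : 0 ≤ κ * X * Y := by positivity
      have hwd : wt β * X * Y * disc β = κ * X * Y := by rw [← hw]; ring
      rw [← mul_pow, ← sq_abs (g * disc β - κ * X * Y)]
      refine pow_le_pow_left₀ (by positivity) (le_abs.2 ?_) 2
      rcases hβ with h | h
      · rw [Set.mem_ofPred_eq, hg] at h
        have h := mul_lt_mul_of_pos_right (ENNReal.ofReal_lt_ofReal_iff'.1 h).1 hd
        rw [mul_assoc, hwd] at h
        left; linarith
      · rw [Set.mem_ofPred_eq, hg] at h
        have h := mul_lt_mul_of_pos_right (ENNReal.ofReal_lt_ofReal_iff'.1 h).1 hd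
        rw [mul_assoc (1 - δ), hwd] at h
        right; linarith
    nlinarith [mul_le_mul_of_nonneg_left this htp.le]
  · rw [Set.indicator_of_notMem hβ]
    nlinarith [mul_nonneg htp.le (sq_nonneg (g * disc β - κ * X * Y))]

theorem lintegral_tent_lt_top (M : ℝ) : ∫⁻ β, ENNReal.ofReal (tent M β) < ⊤ := by
  calc ∫⁻ β, ENNReal.ofReal (tent M β) ≤ ∫⁻ β, (Kp M).indicator 1 β := by
        apply lintegral_mono
        intro β
        by_cases h : tent M β = 0
        · simp [h]
        · rw [Set.indicator_of_mem (K1_subset_Kp M (mem_K1_of_tent_ne_zero h))]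
          simpa using tent_le_one M β
    _ = volume (Kp M) := lintegral_indicator_one (Kp_measurableSet M)
    _ < ⊤ := (volume_Kp_le M).trans_lt ENNReal.ofReal_lt_top

/-- The parameter rectangle on which deviations are estimated. -/
def K0 (M : ℝ) : Set (ℝ × ℝ) := Set.Icc (0 : ℝ) 1 ×ˢ Set.Icc 1 (M - 1 / 2)

theorem chebyshev_integrated {M δ X Y A B : ℝ} (hδ : 0 ≤ δ) (hX : 0 ≤ X) (hY : 0 ≤ Y)
    (hA : 0 ≤ A) (hB : 0 ≤ B)
    (h1 : ENNReal.ofReal (X * Y) * (∫⁻ β, ENNReal.ofReal (wt β * (tent M β * disc β))) ≤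
        (∫⁻ β, Gf X Y β * ENNReal.ofReal (tent M β * disc β)) + ENNReal.ofReal A)
    (h2 : ∫⁻ β, Gf X Y β * Gf X Y β * ENNReal.ofReal (tent M β * disc β ^ 2) ≤
      ENNReal.ofReal (X ^ 2 * Y ^ 2) *
        (∫⁻ β, ENNReal.ofReal (wt β ^ 2 * (tent M β * disc β ^ 2))) + ENNReal.ofReal B) :
    ENNReal.ofReal (δ ^ 2 * (4 * Real.pi ^ 2 * X * Y) ^ 2 / 4) * volume (dev δ X Y ∩ K0 M) ≤
      ENNReal.ofReal (B + 2 * (4 * Real.pi ^ 2 * X * Y) * A) := by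
  have hG := Gf_measurable X Y
  have htm := tent_measurable M
  have hdm := disc_measurable
  set κ := 4 * Real.pi ^ 2 with hκ
  have hκ0 : 0 ≤ κ := by positivity
  set I := ∫⁻ β, ENNReal.ofReal (tent M β) with hI
  have hw : ∀ β, tent M β ≠ 0 → wt β * disc β = κ := by
    intro β h
    have := disc_lower (K1_subset_Kp M (mem_K1_of_tent_ne_zero h))
    unfold wt
    rw [div_mul_cancel₀ _ (by linarith)]
  have e1 : ∫⁻ β, ENNReal.ofReal (wt β * (tent M β * disc β)) = ENNReal.ofReal κ * I := by
    rw [hI, ← lintegral_const_mul' _ _ ENNReal.ofReal_ne_top]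
    apply lintegral_congr
    intro β
    rw [← ENNReal.ofReal_mul hκ0]
    congr 1
    by_cases h : tent M β = 0
    · simp [h]
    · rw [← hw β h]; ring
  have e2 : ∫⁻ β, ENNReal.ofReal (wt β ^ 2 * (tent M β * disc β ^ 2)) =
      ENNReal.ofReal (κ ^ 2) * I := by
    rw [hI, ← lintegral_const_mul' _ _ ENNReal.ofReal_ne_top]
    apply lintegral_congr
    intro β
    rw [← ENNReal.ofReal_mul (by positivity)]
    congr 1
    by_cases h : tent M β = 0
    · simp [h]
    · rw [← hw β h]; ring
  set J := ∫⁻ β, (dev δ X Y).indicator (fun β => ENNReal.ofReal (tent M β)) β with hJ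
  have hpt := lintegral_mono (μ := volume) (fun β => chebyshev_pointwise (M := M) hδ hX hY β)
  rw [lintegral_add_left (f := fun β => ENNReal.ofReal (2 * (4 * Real.pi ^ 2 * X * Y)) *
        (Gf X Y β * ENNReal.ofReal (tent M β * disc β))) (by fun_prop),
    lintegral_const_mul' _ _ ENNReal.ofReal_ne_top, lintegral_const_mul' _ _ ENNReal.ofReal_ne_top,
    lintegral_add_right (g := fun β => ENNReal.ofReal ((4 * Real.pi ^ 2 * X * Y) ^ 2) *
      ENNReal.ofReal (tent M β)) _ (by fun_prop),
    lintegral_const_mul' _ _ ENNReal.ofReal_ne_top, ← hκ, ← hJ, ← hI] at hpt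
  set P := ∫⁻ β, Gf X Y β * ENNReal.ofReal (tent M β * disc β) with hP
  set Q := ∫⁻ β, Gf X Y β * Gf X Y β * ENNReal.ofReal (tent M β * disc β ^ 2) with hQ
  rw [e1] at h1
  rw [e2] at h2
  set c := κ * X * Y with hc
  have hc0 : 0 ≤ c := by positivity
  have hIt : I ≠ ⊤ := (lintegral_tent_lt_top M).ne
  have h1' : ENNReal.ofReal (2 * c ^ 2) * I ≤
      ENNReal.ofReal (2 * c) * P + ENNReal.ofReal (2 * c * A) := by
    calc ENNReal.ofReal (2 * c ^ 2) * I =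
          ENNReal.ofReal (2 * c) * (ENNReal.ofReal (X * Y) * (ENNReal.ofReal κ * I)) := by
          rw [← mul_assoc (ENNReal.ofReal (X * Y)), ← mul_assoc (ENNReal.ofReal (2 * c)),
            ← ENNReal.ofReal_mul (by positivity), ← ENNReal.ofReal_mul (by positivity)]
          congr 2; rw [hc]; ring
      _ ≤ _ := mul_le_mul_right h1 _
      _ = _ := by rw [mul_add, ← ENNReal.ofReal_mul (by positivity)]
  have h2' : Q ≤ ENNReal.ofReal (c ^ 2) * I + ENNReal.ofReal B := by
    refine h2.trans_eq ?_
    rw [← mul_assoc, ← ENNReal.ofReal_mul (by positivity)]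
    congr 3; rw [hc]; ring
  have hJle : ENNReal.ofReal (1 / 4) * volume (dev δ X Y ∩ K0 M) ≤ J := by
    have hK0 : MeasurableSet (K0 M) := measurableSet_Icc.prod measurableSet_Icc
    rw [← lintegral_indicator_const ((dev_measurableSet δ X Y).inter hK0)]
    apply lintegral_mono
    intro β
    by_cases h : β ∈ dev δ X Y ∩ K0 M
    · rw [Set.indicator_of_mem h, Set.indicator_of_mem h.1]
      exact ENNReal.ofReal_le_ofReal (quarter_le_tent h.2)
    · rw [Set.indicator_of_notMem h]; exact zero_le
  have hfin : ENNReal.ofReal (2 * c ^ 2) * I ≠ ⊤ := ENNReal.mul_ne_top ENNReal.ofReal_ne_top hIt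
  have main : ENNReal.ofReal (2 * c ^ 2) * I + ENNReal.ofReal (δ ^ 2 * c ^ 2) * J ≤
      ENNReal.ofReal (2 * c ^ 2) * I + ENNReal.ofReal (B + 2 * c * A) := by
    calc _ ≤ ENNReal.ofReal (2 * c) * P + ENNReal.ofReal (2 * c * A) +
          ENNReal.ofReal (δ ^ 2 * c ^ 2) * J := by gcongr
      _ = (ENNReal.ofReal (2 * c) * P + ENNReal.ofReal (δ ^ 2 * c ^ 2) * J) +
          ENNReal.ofReal (2 * c * A) := by ring
      _ ≤ Q + ENNReal.ofReal (c ^ 2) * I + ENNReal.ofReal (2 * c * A) := by gcongr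
      _ ≤ ENNReal.ofReal (c ^ 2) * I + ENNReal.ofReal B + ENNReal.ofReal (c ^ 2) * I +
          ENNReal.ofReal (2 * c * A) := by gcongr
      _ = _ := by
          rw [ENNReal.ofReal_add hB (by positivity), ENNReal.ofReal_mul zero_le_two]
          simp only [ENNReal.ofReal_ofNat]
          ring
  have main2 := (ENNReal.add_le_add_iff_left hfin).1 main
  calc _ = ENNReal.ofReal (δ ^ 2 * c ^ 2) * (ENNReal.ofReal (1 / 4) *
        volume (dev δ X Y ∩ K0 M)) := by
        rw [← mul_assoc, ← ENNReal.ofReal_mul (by positivity)]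
        congr 2; ring
    _ ≤ _ := mul_le_mul_right hJle _
    _ ≤ _ := main2

theorem volume_dev_le {M η δ : ℝ} (hM : 1 ≤ M) (hη : 0 < η) (hη8 : η ≤ 1 / 8) (hδ : 0 < δ) :
    ∃ C r₀ : ℝ, 0 ≤ C ∧ 1 ≤ r₀ ∧ ∀ r, r₀ ≤ r → ∀ Y, (r ^ 8) ^ (-1 + η) ≤ Y → Y ≤ 1 / (32 * M) →
      volume (dev δ (r ^ 8) Y ∩ K0 M) ≤ ENNReal.ofReal (C * r ^ (-(4 * η))) := by
  have hL : 0 ≤ 100 * M ^ 2 := by positivity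
  obtain ⟨C₁, r₁, hC₁, hr₁, H1⟩ := first_moment hM hL
  obtain ⟨C₂, r₂, hC₂, hr₂, H2⟩ := second_moment hM hL (show 0 < 4 * η by positivity)
  set κ := 4 * Real.pi ^ 2 with hκ
  have hκ0 : 0 < κ := by positivity
  set A := δ ^ 2 * κ ^ 2 / 4 with hA
  have hA0 : 0 < A := by positivity
  refine ⟨(2 * C₂ + 2 * κ * C₁) / A, max r₁ r₂, by positivity, le_max_of_le_left hr₁, ?_⟩
  intro r hr Y hY hYM
  have hr1 : 1 ≤ r := hr₁.trans ((le_max_left _ _).trans hr)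
  have hr0 : 0 < r := by linarith
  have hY0 : 0 < Y := (Real.rpow_pos_of_pos (by positivity) _).trans_le hY
  have hY1 : Y ≤ 1 := hYM.trans (by rw [div_le_one (by positivity)]; linarith)
  have h1 := H1 _ (isWt_tent_mul_disc hM) r ((le_max_left _ _).trans hr) Y hY0 hY1
  have h2 := H2 _ (isWt_tent_mul_disc_sq hM) r ((le_max_right _ _).trans hr) Y hY0 hYM
  have e16 : r ^ 16 * Y ^ 2 = (r ^ 8) ^ 2 * Y ^ 2 := by ring
  rw [e16] at h2
  have h := chebyshev_integrated hδ.le (by positivity) hY0.le (by positivity) (by positivity) h1 h2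
  rw [← hκ] at h
  set T := r ^ 16 * Y ^ 2 with hT
  have hT0 : 0 < T := by positivity
  have b0 : r ^ 14 * Y ^ 2 * r ^ (4 * η) ≤ T * r ^ (-(4 * η)) := by
    have : r ^ (4 * η) ≤ r ^ 2 * r ^ (-(4 * η)) := by
      rw [← Real.rpow_natCast r 2, ← Real.rpow_add hr0]
      apply Real.rpow_le_rpow_of_exponent_le hr1
      push_cast; linarith
    calc _ ≤ r ^ 14 * Y ^ 2 * (r ^ 2 * r ^ (-(4 * η))) := by gcongr
      _ = _ := by rw [hT]; ring
  have b1 : r ^ 8 * Y * r ^ (4 * η) ≤ T * r ^ (-(4 * η)) := by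
    have : r ^ (4 * η) ≤ r ^ 8 * Y * r ^ (-(4 * η)) := by
      refine le_trans (le_of_eq ?_) (mul_le_mul_of_nonneg_right
        (mul_le_mul_of_nonneg_left hY (by positivity)) (by positivity))
      rw [← Real.rpow_natCast r 8, ← Real.rpow_mul hr0.le, ← Real.rpow_add hr0,
        ← Real.rpow_add hr0]
      congr 1; push_cast; ring
    calc _ ≤ r ^ 8 * Y * (r ^ 8 * Y * r ^ (-(4 * η))) := by gcongr
      _ = _ := by rw [hT]; ring
  have b2 : r ^ 15 * Y ^ 2 ≤ T * r ^ (-(4 * η)) := by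
    have : 1 ≤ r * r ^ (-(4 * η)) := by
      nth_rw 1 [← Real.rpow_one r]
      rw [← Real.rpow_add hr0]
      exact Real.one_le_rpow hr1 (by linarith)
    calc _ = r ^ 15 * Y ^ 2 * 1 := by ring
      _ ≤ r ^ 15 * Y ^ 2 * (r * r ^ (-(4 * η))) := by gcongr
      _ = _ := by rw [hT]; ring
  have e : δ ^ 2 * (κ * r ^ 8 * Y) ^ 2 / 4 = A * T := by rw [hA, hT]; ring
  rw [e] at h
  have h3 : C₂ * (r ^ 14 * Y ^ 2 + r ^ 8 * Y) * r ^ (4 * η) +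
      2 * (κ * r ^ 8 * Y) * (C₁ * r ^ 7 * Y) ≤
      (A * T) * ((2 * C₂ + 2 * κ * C₁) / A * r ^ (-(4 * η))) := by
    have e2 : (A * T) * ((2 * C₂ + 2 * κ * C₁) / A * r ^ (-(4 * η))) =
      (2 * C₂ + 2 * κ * C₁) * (T * r ^ (-(4 * η))) := by field_simp
    rw [e2]
    have := mul_le_mul_of_nonneg_left b0 hC₂
    have := mul_le_mul_of_nonneg_left b1 hC₂
    have := mul_le_mul_of_nonneg_left b2 (show 0 ≤ 2 * κ * C₁ by positivity)
    linarith
  have h4 := h.trans (ENNReal.ofReal_le_ofReal h3)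
  rw [ENNReal.ofReal_mul (p := A * T) (by positivity)] at h4
  exact (ENNReal.mul_le_mul_iff_right (ENNReal.ofReal_pos.2 (mul_pos hA0 hT0)).ne'
    ENNReal.ofReal_ne_top).1 h4

theorem ae_grid {M η δ ρ : ℝ} (hM : 1 ≤ M) (hη : 0 < η) (hη8 : η ≤ 1 / 8) (hδ : 0 < δ)
    (hρ : 1 < ρ) :
    ∀ᵐ β : ℝ × ℝ, β ∈ K0 M → ∃ k₀ : ℕ, ∀ k, k₀ ≤ k → ∀ j : ℕ,
      ((ρ ^ 8) ^ k) ^ (-1 + η) ≤ ((ρ ^ 8) ^ j)⁻¹ → ((ρ ^ 8) ^ j)⁻¹ ≤ 1 / (32 * M) →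
        β ∉ dev δ ((ρ ^ 8) ^ k) ((ρ ^ 8) ^ j)⁻¹ := by
  obtain ⟨C, r₀, hC, hr₀, H⟩ := volume_dev_le hM hη hη8 hδ
  have hρ0 : 0 < ρ := by linarith
  have hσ : 1 < ρ ^ 8 := one_lt_pow₀ hρ (by norm_num)
  obtain ⟨k₁, hk₁⟩ := pow_unbounded_of_one_lt r₀ hρ
  set q := ρ ^ (-(4 * η)) with hq
  have hq0 : 0 < q := Real.rpow_pos_of_pos hρ0 _
  have hq1 : q < 1 := Real.rpow_lt_one_of_one_lt_of_neg hρ (by linarith)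
  set p : ℕ → ℕ → ℝ × ℝ → Prop := fun k j β =>
    ((ρ ^ 8) ^ k) ^ (-1 + η) ≤ ((ρ ^ 8) ^ j)⁻¹ ∧ ((ρ ^ 8) ^ j)⁻¹ ≤ 1 / (32 * M) ∧
      β ∈ dev δ ((ρ ^ 8) ^ k) ((ρ ^ 8) ^ j)⁻¹ ∩ K0 M with hp
  have hjk : ∀ k j β, p k j β → j < k + 1 := by
    rintro k j β ⟨h, -⟩
    have h0 : ((ρ ^ 8) ^ k)⁻¹ ≤ ((ρ ^ 8) ^ k) ^ (-1 + η) := by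
      rw [← Real.rpow_neg_one]
      exact Real.rpow_le_rpow_of_exponent_le (one_le_pow₀ hσ.le) (by linarith)
    have h1 := h0.trans h
    rw [inv_le_inv₀ (by positivity) (by positivity), pow_le_pow_iff_right₀ hσ] at h1
    omega
  have hvol : ∀ k, k₁ ≤ k → volume {β | ∃ j, p k j β} ≤
      ENNReal.ofReal (C * (k * q ^ k + q ^ k)) := by
    intro k hk
    have hr : r₀ ≤ ρ ^ k := hk₁.le.trans (pow_le_pow_right₀ hρ.le hk)
    have e8 : (ρ ^ 8) ^ k = (ρ ^ k) ^ 8 := by rw [← pow_mul, ← pow_mul, mul_comm]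
    have eq : (ρ ^ k) ^ (-(4 * η)) = q ^ k := by
      rw [hq, ← Real.rpow_natCast, ← Real.rpow_natCast, ← Real.rpow_mul hρ0.le,
        ← Real.rpow_mul hρ0.le, mul_comm]
    have hj : ∀ j, volume {β | p k j β} ≤ ENNReal.ofReal (C * q ^ k) := by
      intro j
      by_cases h : ((ρ ^ 8) ^ k) ^ (-1 + η) ≤ ((ρ ^ 8) ^ j)⁻¹ ∧ ((ρ ^ 8) ^ j)⁻¹ ≤ 1 / (32 * M)
      · have h' := h.1
        rw [e8] at h'
        refine (measure_mono ?_).trans ((H _ hr _ h' h.2).trans_eq (by rw [eq]))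
        intro β hβ
        rw [← e8]
        exact hβ.2.2
      · have : {β | p k j β} = ∅ := by
          ext β
          simp only [Set.mem_ofPred_eq, Set.mem_empty_iff_false, iff_false]
          exact fun hb => h ⟨hb.1, hb.2.1⟩
        rw [this, measure_empty]; exact zero_le
    calc volume {β | ∃ j, p k j β} ≤ volume (⋃ j ∈ Finset.range (k + 1), {β | p k j β}) := by
          apply measure_mono
          rintro β ⟨j, hb⟩
          simp only [Set.mem_iUnion, Finset.mem_range]
          exact ⟨j, hjk k j β hb, hb⟩
      _ ≤ ∑ j ∈ Finset.range (k + 1), volume {β | p k j β} := measure_biUnion_finset_le _ _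
      _ ≤ ∑ j ∈ Finset.range (k + 1), ENNReal.ofReal (C * q ^ k) := Finset.sum_le_sum fun j _ => hj j
      _ = _ := by
        rw [Finset.sum_const, Finset.card_range, nsmul_eq_mul, ← ENNReal.ofReal_natCast,
          ← ENNReal.ofReal_mul (by positivity)]
        congr 1; push_cast; ring
  have hsum : Summable fun k : ℕ => C * (k * q ^ k + q ^ k) := by
    refine Summable.mul_left _ (Summable.add ?_ (summable_geometric_of_lt_one hq0.le hq1))
    simpa using summable_pow_mul_geometric_of_norm_lt_one 1
      (show ‖q‖ < 1 by rwa [Real.norm_of_nonneg hq0.le])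
  have hfin : ∑' k, volume {β | ∃ j, p (k + k₁) j β} ≠ ⊤ := by
    refine ne_top_of_le_ne_top ?_ (ENNReal.tsum_le_tsum fun k => hvol (k + k₁) (by omega))
    exact ((summable_nat_add_iff k₁).2 hsum).tsum_ofReal_ne_top
  filter_upwards [ae_eventually_notMem hfin] with β hβ hK
  obtain ⟨k₂, hk₂⟩ := Filter.eventually_atTop.1 hβ
  refine ⟨k₂ + k₁, fun k hk j h1 h2 hd => ?_⟩
  have h3 := hk₂ (k - k₁) (by omega)
  rw [Nat.sub_add_cancel (by omega)] at h3
  exact h3 ⟨j, h1, h2, hd, hK⟩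

theorem Gf_interpolate {M η δ σ : ℝ} {β : ℝ × ℝ} (hM : 1 ≤ M) (hη : 0 < η) (hη8 : η ≤ 1 / 8)
    (hδ : 0 < δ) (hδ1 : δ ≤ 1) (hσ : 1 < σ) (hw : 0 ≤ wt β)
    (h : ∃ k₀ : ℕ, ∀ k, k₀ ≤ k → ∀ j : ℕ, (σ ^ k) ^ (-1 + η) ≤ (σ ^ j)⁻¹ →
      (σ ^ j)⁻¹ ≤ 1 / (32 * M) → β ∉ dev δ (σ ^ k) (σ ^ j)⁻¹) :
    ∀ᶠ X : ℝ in Filter.atTop, ∀ Y, X ^ (-1 + 2 * η) ≤ Y → Y ≤ X ^ (-(2 * η)) →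
      ENNReal.ofReal ((1 - δ) / σ ^ 2 * (wt β * X * Y)) ≤ Gf X Y β ∧
        Gf X Y β ≤ ENNReal.ofReal ((1 + δ) * σ ^ 2 * (wt β * X * Y)) := by
  obtain ⟨k₀, hk₀⟩ := h
  have hσ0 : 0 < σ := by linarith
  have l1 := (tendsto_rpow_atTop hη).eventually_ge_atTop (σ ^ 2)
  have l2 := (tendsto_rpow_neg_atTop (show 0 < 2 * η by linarith)).eventually_le_const
    (show 0 < 1 / (32 * M * σ) by positivity)
  filter_upwards [l1, l2, Filter.eventually_ge_atTop (σ ^ (k₀ + 1)),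
    Filter.eventually_ge_atTop 1] with X h1 h2 h3 h4 Y hY hY'
  have hX0 : 0 < X := by linarith
  have hY0 : 0 < Y := (Real.rpow_pos_of_pos hX0 _).trans_le hY
  have hY1 : Y ≤ 1 := hY'.trans (Real.rpow_le_one_of_one_le_of_nonpos h4 (by linarith))
  obtain ⟨k, hk, hk'⟩ := exists_nat_pow_near h4 hσ
  obtain ⟨j, hj, hj'⟩ := exists_nat_pow_near (one_le_inv_iff₀.2 ⟨hY0, hY1⟩) hσ
  have hkk : k₀ ≤ k := by
    have := (pow_lt_pow_iff_right₀ hσ).1 (h3.trans_lt hk')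
    omega
  have hYj : Y ≤ (σ ^ j)⁻¹ := (le_inv_comm₀ (by positivity) hY0).1 hj
  have hYj' : (σ ^ (j + 1))⁻¹ ≤ Y := (inv_le_comm₀ hY0 (by positivity)).1 hj'.le
  have hσj : (σ ^ j)⁻¹ = σ * (σ ^ (j + 1))⁻¹ := by rw [pow_succ]; field_simp
  have hjM : (σ ^ j)⁻¹ ≤ 1 / (32 * M) := by
    calc (σ ^ j)⁻¹ ≤ σ * Y := by rw [hσj]; gcongr
      _ ≤ σ * (1 / (32 * M * σ)) := by gcongr; exact hY'.trans h2
      _ = _ := by field_simp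
  have hjM' : (σ ^ (j + 1))⁻¹ ≤ 1 / (32 * M) := by
    refine le_trans ?_ hjM
    rw [hσj]
    exact le_mul_of_one_le_left (by positivity) hσ.le
  have hXk : X ≤ σ * σ ^ k := by rw [← pow_succ']; exact hk'.le
  constructor
  · have c1 : (σ ^ k) ^ (-1 + η) ≤ (σ ^ (j + 1))⁻¹ := by
      have a1 : (σ ^ k) ^ (-1 + η) ≤ (X / σ) ^ (-1 + η) :=
        Real.rpow_le_rpow_of_nonpos (by positivity)
          (by rw [div_le_iff₀ hσ0]; linarith) (by linarith)
      have a2 : (X / σ) ^ (-1 + η) ≤ X ^ (-1 + η) * σ := by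
        rw [Real.div_rpow hX0.le hσ0.le, div_eq_mul_inv, ← Real.rpow_neg hσ0.le]
        gcongr
        nth_rw 2 [← Real.rpow_one σ]
        exact Real.rpow_le_rpow_of_exponent_le hσ.le (by linarith)
      have a3 : X ^ (-1 + η) * σ ^ 2 ≤ X ^ (-1 + 2 * η) := by
        rw [show -1 + 2 * η = (-1 + η) + η by ring, Real.rpow_add hX0 (-1 + η) η]
        gcongr
      have a4 : Y ≤ σ * (σ ^ (j + 1))⁻¹ := by rw [← hσj]; exact hYj
      have a5 : X ^ (-1 + η) * σ * σ ≤ (σ ^ (j + 1))⁻¹ * σ := by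
        linarith [show X ^ (-1 + η) * σ ^ 2 = X ^ (-1 + η) * σ * σ by ring]
      exact (a1.trans a2).trans (le_of_mul_le_mul_right a5 hσ0)
    have hd := hk₀ k hkk (j + 1) c1 hjM'
    simp only [dev, Set.mem_union, Set.mem_ofPred_eq, not_or, not_lt] at hd
    refine le_trans (ENNReal.ofReal_le_ofReal ?_) (hd.2.trans (Gf_mono hk hYj' β))
    have b1 : X * Y ≤ (σ * σ ^ k) * (σ * (σ ^ (j + 1))⁻¹) := by
      rw [← hσj]; gcongr
    calc (1 - δ) / σ ^ 2 * (wt β * X * Y) = (1 - δ) * wt β / σ ^ 2 * (X * Y) := by ring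
      _ ≤ (1 - δ) * wt β / σ ^ 2 * ((σ * σ ^ k) * (σ * (σ ^ (j + 1))⁻¹)) := by
        have : 0 ≤ 1 - δ := by linarith
        gcongr
      _ = _ := by field_simp
  · have c1 : (σ ^ (k + 1)) ^ (-1 + η) ≤ (σ ^ j)⁻¹ := by
      refine le_trans ?_ hYj
      refine le_trans ?_ hY
      refine (Real.rpow_le_rpow_of_nonpos hX0 hk'.le (by linarith)).trans ?_
      exact Real.rpow_le_rpow_of_exponent_le h4 (by linarith)
    have hd := hk₀ (k + 1) (by omega) j c1 hjM
    simp only [dev, Set.mem_union, Set.mem_ofPred_eq, not_or, not_lt] at hd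
    refine ((Gf_mono hk'.le hYj β).trans hd.1).trans (ENNReal.ofReal_le_ofReal ?_)
    have b1 : σ ^ (k + 1) * (σ ^ j)⁻¹ ≤ (σ * X) * (σ * Y) := by
      rw [hσj, pow_succ']; gcongr
    calc (1 + δ) * (wt β * σ ^ (k + 1) * (σ ^ j)⁻¹) =
          (1 + δ) * wt β * (σ ^ (k + 1) * (σ ^ j)⁻¹) := by ring
      _ ≤ (1 + δ) * wt β * ((σ * X) * (σ * Y)) := by gcongr
      _ = _ := by ring

theorem ae_Gf_asymptotic {η : ℝ} (hη : 0 < η) (hη8 : η ≤ 1 / 8) :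
    ∀ᵐ β : ℝ × ℝ, 0 ≤ β.1 → β.1 ≤ 1 → 1 ≤ β.2 → ∀ δ : ℝ, 0 < δ →
      ∀ᶠ X : ℝ in Filter.atTop, ∀ Y, X ^ (-1 + 2 * η) ≤ Y → Y ≤ X ^ (-(2 * η)) →
        ENNReal.ofReal ((1 - δ) * (wt β * X * Y)) ≤ Gf X Y β ∧
          Gf X Y β ≤ ENNReal.ofReal ((1 + δ) * (wt β * X * Y)) := by
  have hall : ∀ n : ℕ, _ := fun n : ℕ => ae_grid (M := n + 1) (η := η) (δ := 1 / (n + 1 : ℝ))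
    (ρ := 1 + 1 / (n + 1 : ℝ)) (by linarith [n.cast_nonneg (α := ℝ)]) hη hη8 (by positivity)
    (by linarith [show 0 < 1 / (n + 1 : ℝ) by positivity])
  filter_upwards [ae_all_iff.2 hall] with β hβ h0 h1 h2 δ hδ
  have hw : 0 ≤ wt β := by
    have : 0 ≤ disc β := by unfold disc; nlinarith
    unfold wt; positivity
  have t0 := tendsto_one_div_add_atTop_nhds_zero_nat (𝕜 := ℝ)
  have tu : Filter.Tendsto (fun n : ℕ => (1 + 1 / (n + 1 : ℝ)) * ((1 + 1 / (n + 1 : ℝ)) ^ 8) ^ 2)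
      Filter.atTop (nhds 1) := by
    simpa using (t0.const_add 1).mul (((t0.const_add 1).pow 8).pow 2)
  have tl : Filter.Tendsto (fun n : ℕ => (1 - 1 / (n + 1 : ℝ)) / ((1 + 1 / (n + 1 : ℝ)) ^ 8) ^ 2)
      Filter.atTop (nhds 1) := by
    have h := (t0.const_sub 1).div (((t0.const_add 1).pow 8).pow 2) (by simp)
    rw [show (1 - 0 : ℝ) / ((1 + 0) ^ 8) ^ 2 = 1 by norm_num] at h
    exact h
  obtain ⟨n, hnu, hnl, hn2⟩ := ((tu.eventually_le_const (show 1 < 1 + δ by linarith)).and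
    ((tl.eventually_const_le (show 1 - δ < 1 by linarith)).and
      (tendsto_natCast_atTop_atTop.eventually_ge_atTop β.2))).exists
  have hn0 : 0 < 1 / (n + 1 : ℝ) := by positivity
  have hn1 : 1 / (n + 1 : ℝ) ≤ 1 := by
    rw [div_le_one (by positivity)]; linarith [n.cast_nonneg (α := ℝ)]
  have key := Gf_interpolate (by linarith [n.cast_nonneg (α := ℝ)]) hη hη8 hn0 hn1
    (one_lt_pow₀ (by linarith) (by norm_num)) hw
    (hβ n ⟨⟨h0, h1⟩, h2, by linarith⟩)
  filter_upwards [key, Filter.eventually_ge_atTop 0] with X hX hX0 Y hY hY'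
  have hXY : 0 ≤ wt β * X * Y :=
    mul_nonneg (mul_nonneg hw hX0) ((Real.rpow_nonneg hX0 _).trans hY)
  obtain ⟨k1, k2⟩ := hX Y hY hY'
  exact ⟨(ENNReal.ofReal_le_ofReal (mul_le_mul_of_nonneg_right hnl hXY)).trans k1,
    k2.trans (ENNReal.ofReal_le_ofReal (mul_le_mul_of_nonneg_right hnu hXY))⟩

theorem Gf_toReal (X Y : ℝ) (β : ℝ × ℝ) :
    (Gf X Y β).toReal = Nat.card {P | P ∈ NZ ∧ cz P ∈ Om X Y β} := by
  have h : Gf X Y β = ∑' P, {P | P ∈ NZ ∧ cz P ∈ Om X Y β}.indicator 1 P := rfl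
  rw [h, ← tsum_subtype]
  simp only [Pi.one_apply]
  rw [ENNReal.tsum_one]
  rcases finite_or_infinite {P | P ∈ NZ ∧ cz P ∈ Om X Y β} with hf | hf
  · rw [ENat.card_eq_coe_natCard, ENat.toENNReal_coe, ENNReal.toReal_natCast]
  · rw [ENat.card_eq_top_of_infinite, Nat.card_eq_zero_of_infinite]; simp

theorem one_le_Qr {β : ℝ × ℝ} (h0 : 0 ≤ β.1) (h1 : β.1 ≤ 1) (h2 : 1 ≤ β.2) {p : ℤ × ℤ}
    (hp : p ≠ 0) : 1 ≤ Qr β (p.1, p.2) := by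
  have hz : 1 ≤ p.1 ^ 2 - |p.1 * p.2| + p.2 ^ 2 := by
    obtain ⟨a, b⟩ := p
    have hab : 1 ≤ |a| ∨ 1 ≤ |b| := by
      by_contra! h
      exact hp (Prod.ext (Int.abs_lt_one_iff.1 h.1) (Int.abs_lt_one_iff.1 h.2))
    simp only [abs_mul]
    rw [← sq_abs a, ← sq_abs b]
    have ha := abs_nonneg a
    have hb := abs_nonneg b
    by_contra! hlt
    have : |a| ^ 2 - |a| * |b| + |b| ^ 2 ≤ 0 := by omega
    rcases hab with h | h <;> nlinarith [sq_nonneg (|a| - |b|)]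
  have hr : (1 : ℝ) ≤ (p.1 : ℝ) ^ 2 - |(p.1 : ℝ) * p.2| + (p.2 : ℝ) ^ 2 := by exact_mod_cast hz
  have h3 : -|(p.1 : ℝ) * p.2| ≤ β.1 * ((p.1 : ℝ) * p.2) := by
    refine le_trans ?_ (neg_abs_le _)
    rw [abs_mul β.1, abs_of_nonneg h0]
    nlinarith [abs_nonneg ((p.1 : ℝ) * p.2)]
  simp only [Qr]
  nlinarith [sq_nonneg (p.2 : ℝ)]

theorem mem_idx_or_neg (p : ℤ × ℤ) : p ∈ idx ∨ -p ∈ idx := by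
  simp only [idx, Set.mem_ofPred_eq, Prod.fst_neg, Prod.snd_neg]
  omega

theorem eq_zero_of_mem_idx_neg {p : ℤ × ℤ} (h : p ∈ idx) (h' : -p ∈ idx) : p = 0 := by
  simp only [idx, Set.mem_ofPred_eq, Prod.fst_neg, Prod.snd_neg] at h h'
  ext <;> simp <;> omega

theorem units_smul_idx {p q : ℤ × ℤ} {u v : ℤˣ} (hp : p ∈ idx) (hq : q ∈ idx) (hp0 : p ≠ 0)
    (h : u • p = v • q) : p = q ∧ u = v := by
  have hn : p ≠ -q := fun e => hp0 (eq_zero_of_mem_idx_neg hp (by rw [e, neg_neg]; exact hq))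
  rcases Int.units_eq_one_or u with rfl | rfl <;> rcases Int.units_eq_one_or v with rfl | rfl <;>
    simp at h ⊢
  · exact h
  · exact hn h
  · exact hn (by rw [← h, neg_neg])
  · exact h

theorem Qr_units_smul (β : ℝ × ℝ) (u : ℤˣ) (p : ℤ × ℤ) :
    Qr β (((u • p).1 : ℝ), ((u • p).2 : ℝ)) = Qr β (p.1, p.2) := by
  rcases Int.units_eq_one_or u with rfl | rfl <;> simp [Qr]

/-- The normalised parameters of the form `qf α`. -/
noncomputable def nrmz (α : ℝ × ℝ × ℝ) : ℝ × ℝ := (α.2.1 / α.1, α.2.2 / α.1)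

theorem qf_eq {α : ℝ × ℝ × ℝ} (h : α.1 ≠ 0) (m n : ℤ) :
    qf α m n = α.1 * Qr (nrmz α) ((m : ℝ), (n : ℝ)) := by
  simp only [qf, Qr, nrmz]; field_simp

theorem qf_div_le {α : ℝ × ℝ × ℝ} (h : 0 < α.1) (hD : 0 < Dfun α) (p : ℤ × ℤ) (N : ℝ) :
    qf α p.1 p.2 / Dfun α ≤ N ↔ Qr (nrmz α) (p.1, p.2) ≤ N * (Dfun α / α.1) := by
  rw [qf_eq h.ne', div_le_iff₀ hD, ← mul_div_assoc, le_div_iff₀' h]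

theorem card_pairs {α : ℝ × ℝ × ℝ} (h : 0 < α.1) (hα : α ∈ Dset) (hD : 0 < Dfun α) {N Δ : ℝ}
    (hΔ : Δ * (Dfun α / α.1) < 1) :
    Nat.card {P | P ∈ NZ ∧ cz P ∈ Om (N * (Dfun α / α.1)) (Δ * (Dfun α / α.1)) (nrmz α)} =
      Nat.card {pq : (ℤ × ℤ) × (ℤ × ℤ) //
        pq.1 ∈ idx ∧ pq.2 ∈ idx ∧ pq.1 ≠ pq.2 ∧
        qf α pq.1.1 pq.1.2 / Dfun α ≤ N ∧ qf α pq.2.1 pq.2.2 / Dfun α ≤ N ∧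
        (qf α pq.1.1 pq.1.2 - qf α pq.2.1 pq.2.2) / Dfun α ∈ Set.Icc 0 Δ} * 4 := by
  obtain ⟨a1, a2, a3⟩ := hα
  have b1 : 0 ≤ (nrmz α).1 := div_nonneg a1 h.le
  have b2 : (nrmz α).1 ≤ 1 := (div_le_one h).2 a2
  have b3 : 1 ≤ (nrmz α).2 := (one_le_div h).2 a3
  have hcond : ∀ p q : ℤ × ℤ, (qf α p.1 p.2 / Dfun α ≤ N ∧ qf α q.1 q.2 / Dfun α ≤ N ∧
      (qf α p.1 p.2 - qf α q.1 q.2) / Dfun α ∈ Set.Icc 0 Δ) ↔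
      cz (p, q) ∈ Om (N * (Dfun α / α.1)) (Δ * (Dfun α / α.1)) (nrmz α) := by
    intro p q
    simp only [Om, aff_cf, cz, Set.mem_ofPred_eq, Set.mem_Icc]
    rw [qf_div_le h hD, qf_div_le h hD, qf_eq h.ne', qf_eq h.ne', ← mul_sub,
      div_le_iff₀ hD, le_div_iff₀ hD, zero_mul, mul_nonneg_iff_of_pos_left h,
      ← mul_div_assoc Δ, le_div_iff₀' h]
    constructor
    · rintro ⟨c1, -, c2, c3⟩; exact ⟨c1, c2, c3⟩
    · rintro ⟨c1, c2, c3⟩; exact ⟨c1, by linarith, c2, c3⟩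
  set Y := Δ * (Dfun α / α.1) with hY
  set X := N * (Dfun α / α.1) with hX
  set β := nrmz α with hβ
  have hne : ∀ p q : ℤ × ℤ, p ≠ q → p ≠ -q → cz (p, q) ∈ Om X Y β → p ≠ 0 ∧ q ≠ 0 := by
    intro p q h1 h2 hm
    obtain ⟨-, c2, c3⟩ := hm
    rw [aff_cf] at c2 c3
    simp only [cz] at c2 c3
    have Q0 : Qr β (((0 : ℤ × ℤ).1 : ℝ), ((0 : ℤ × ℤ).2 : ℝ)) = 0 := by simp [Qr]
    refine ⟨fun e => ?_, fun e => ?_⟩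
    · rw [e, Q0] at c2
      have hq : q ≠ 0 := fun e' => h1 (e.trans e'.symm)
      linarith [one_le_Qr b1 b2 b3 hq]
    · rw [e, Q0] at c3
      have hp : p ≠ 0 := fun e' => h1 (e'.trans e.symm)
      linarith [one_le_Qr b1 b2 b3 hp]
  have hOm : ∀ (p q : ℤ × ℤ) (u v : ℤˣ), cz (u • p, v • q) ∈ Om X Y β ↔ cz (p, q) ∈ Om X Y β := by
    intro p q u v
    simp only [Om, aff_cf, cz, Set.mem_ofPred_eq, Qr_units_smul]
  set S := {pq : (ℤ × ℤ) × (ℤ × ℤ) //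
        pq.1 ∈ idx ∧ pq.2 ∈ idx ∧ pq.1 ≠ pq.2 ∧
        qf α pq.1.1 pq.1.2 / Dfun α ≤ N ∧ qf α pq.2.1 pq.2.2 / Dfun α ≤ N ∧
        (qf α pq.1.1 pq.1.2 - qf α pq.2.1 pq.2.2) / Dfun α ∈ Set.Icc 0 Δ} with hS
  have hSOm : ∀ s : S, cz s.1 ∈ Om X Y β := fun s => (hcond _ _).1 s.2.2.2.2
  have hSne : ∀ s : S, s.1.1 ≠ 0 ∧ s.1.2 ≠ 0 := by
    intro s
    by_contra hc
    have h2 : s.1.1 = -s.1.2 := by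
      by_contra h2
      exact hc (hne _ _ s.2.2.2.1 h2 (hSOm s))
    have h3 := eq_zero_of_mem_idx_neg s.2.1 (by rw [h2, neg_neg]; exact s.2.2.1)
    exact s.2.2.2.1 (by rw [h3] at h2 ⊢; exact (neg_eq_zero.1 h2.symm).symm)
  have hNZ : ∀ (s : S) (u v : ℤˣ), (u • s.1.1, v • s.1.2) ∈ NZ := by
    intro s u v
    refine ⟨fun e => ?_, fun e => ?_⟩
    · exact s.2.2.2.1 (units_smul_idx s.2.1 s.2.2.1 (hSne s).1 (sub_eq_zero.1 e)).1
    · refine s.2.2.2.1 (units_smul_idx (u := u) (v := -v) s.2.1 s.2.2.1 (hSne s).1 ?_).1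
      refine (eq_neg_of_add_eq_zero_left e).trans ?_
      rcases Int.units_eq_one_or v with rfl | rfl <;> simp
  let f : S × (ℤˣ × ℤˣ) → {P | P ∈ NZ ∧ cz P ∈ Om X Y β} := fun x =>
    ⟨(x.2.1 • x.1.1.1, x.2.2 • x.1.1.2), hNZ _ _ _, (hOm _ _ _ _).2 (hSOm x.1)⟩
  have hf : Function.Bijective f := by
    constructor
    · rintro ⟨s, u, v⟩ ⟨s', u', v'⟩ e
      have e1 := congrArg (fun x => x.1.1) e
      have e2 := congrArg (fun x => x.1.2) e
      simp only [f] at e1 e2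
      obtain ⟨g1, rfl⟩ := units_smul_idx s.2.1 s'.2.1 (hSne s).1 e1
      obtain ⟨g2, rfl⟩ := units_smul_idx s.2.2.1 s'.2.2.1 (hSne s).2 e2
      have : s = s' := Subtype.ext (Prod.ext g1 g2)
      rw [this]
    · rintro ⟨⟨p, q⟩, ⟨n1, n2⟩, hm⟩
      have hu : ∀ p : ℤ × ℤ, ∃ u : ℤˣ, u • p ∈ idx := by
        intro p
        rcases mem_idx_or_neg p with h | h
        · exact ⟨1, by simpa using h⟩
        · exact ⟨-1, by simpa using h⟩
      obtain ⟨u, hu'⟩ := hu p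
      obtain ⟨v, hv'⟩ := hu q
      have inv : ∀ (u : ℤˣ) (p : ℤ × ℤ), u • u • p = p := by
        intro u p; rw [smul_smul, Int.units_mul_self, one_smul]
      refine ⟨(⟨(u • p, v • q), hu', hv', ?_, (hcond _ _).2 ((hOm _ _ _ _).2 hm)⟩, u, v), ?_⟩
      · intro e
        simp only at e n1 n2
        rcases Int.units_eq_one_or u with rfl | rfl <;>
          rcases Int.units_eq_one_or v with rfl | rfl <;> simp at e
        · exact n1 (sub_eq_zero.2 e)
        · exact n2 (by rw [e]; simp)
        · exact n2 (by rw [← e]; simp)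
        · exact n1 (sub_eq_zero.2 e)
      · simp only [f, inv]
  rw [← Nat.card_congr (Equiv.ofBijective f hf), Nat.card_prod, Nat.card_prod]
  simp

theorem hypMeasure_nrmz_null {Z : Set (ℝ × ℝ)} (hZ : volume Z = 0) :
    hypMeasure {α | α.1 = 0 ∨ nrmz α ∈ Z} = 0 := by
  refine withDensity_absolutelyContinuous _ _ ?_
  set T := toMeasurable volume Z with hT
  have hTm : MeasurableSet T := measurableSet_toMeasurable _ _
  have hT0 : volume T = 0 := by rw [hT, measure_toMeasurable, hZ]
  refine measure_mono_null (t := {α | α.1 = 0 ∨ nrmz α ∈ T}) ?_ ?_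
  · rintro α (h | h)
    · exact Or.inl h
    · exact Or.inr (subset_toMeasurable _ _ h)
  have hn : Measurable nrmz := by unfold nrmz; fun_prop
  have hm : MeasurableSet {α : ℝ × ℝ × ℝ | α.1 = 0 ∨ nrmz α ∈ T} :=
    (measurableSet_eq_fun measurable_fst measurable_const).union (hn hTm)
  rw [Measure.volume_eq_prod, Measure.measure_prod_null hm]
  filter_upwards [Measure.ae_ne volume (0 : ℝ)] with a ha
  have e : (Prod.mk a ⁻¹' {α : ℝ × ℝ × ℝ | α.1 = 0 ∨ nrmz α ∈ T}) = (a⁻¹ • ·) ⁻¹' T := by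
    ext x
    simp only [Set.mem_preimage, Set.mem_ofPred_eq, ha, false_or, nrmz, div_eq_inv_mul]
    rfl
  rw [e, Measure.addHaar_preimage_smul _ (inv_ne_zero ha), hT0, mul_zero]
  rfl

theorem Pcorr_asymptotic {η η₀ : ℝ} (hη₀ : 0 < η₀) (hηη : 2 * η₀ < η)
    {α : ℝ × ℝ × ℝ} (hα : α ∈ Dset) (h1 : 0 < α.1)
    (h : ∀ δ : ℝ, 0 < δ →
      ∀ᶠ X : ℝ in Filter.atTop, ∀ Y, X ^ (-1 + 2 * η₀) ≤ Y → Y ≤ X ^ (-(2 * η₀)) →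
        ENNReal.ofReal ((1 - δ) * (wt (nrmz α) * X * Y)) ≤ Gf X Y (nrmz α) ∧
          Gf X Y (nrmz α) ≤ ENNReal.ofReal ((1 + δ) * (wt (nrmz α) * X * Y)))
    {δ : ℝ} (hδ : 0 < δ) :
    ∀ᶠ N : ℝ in Filter.atTop, ∀ Δ : ℝ, N ^ (-1 + η) ≤ Δ → Δ ≤ N ^ (-η) →
      |Pcorr α N (Set.Icc 0 Δ) - Δ| ≤ δ * Δ := by
  obtain ⟨a1, a2, a3⟩ := id hα
  have hdd : α.1 ^ 2 * disc (nrmz α) = 4 * α.1 * α.2.2 - α.2.1 ^ 2 := by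
    simp only [disc, nrmz]; field_simp
  have hd4 : 0 < 4 * α.1 * α.2.2 - α.2.1 ^ 2 := by nlinarith
  have hd : 0 < disc (nrmz α) := by
    rw [← hdd] at hd4
    exact pos_of_mul_pos_right hd4 (sq_nonneg _)
  have hD : 0 < Dfun α := div_pos (Real.sqrt_pos.2 hd4) Real.pi_pos
  set c := Dfun α / α.1 with hc
  have hc0 : 0 < c := div_pos hD h1
  have hcw : wt (nrmz α) * c ^ 2 = 4 := by
    have : c ^ 2 = disc (nrmz α) / Real.pi ^ 2 := by
      rw [hc, Dfun, div_pow, div_pow, Real.sq_sqrt hd4.le, ← hdd]; field_simp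
    rw [this, wt]
    have := Real.pi_pos
    field_simp
  have hlim := tendsto_rpow_neg_atTop (show 0 < η - 2 * η₀ by linarith)
  have l1 := hlim.eventually_le_const (show 0 < c ^ (2 - 2 * η₀) by positivity)
  have l2 := hlim.eventually_le_const (show 0 < c ^ (-1 - 2 * η₀) by positivity)
  have hmul : Filter.Tendsto (fun N : ℝ => N * c) Filter.atTop Filter.atTop :=
    Filter.tendsto_id.atTop_mul_const hc0
  filter_upwards [l1, l2, hmul.eventually (h δ hδ), hmul.eventually_gt_atTop 1,
    Filter.eventually_gt_atTop 0] with N m1 m2 m3 m4 hN Δ hΔ hΔ'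
  have hΔ0 : 0 < Δ := (Real.rpow_pos_of_pos hN _).trans_le hΔ
  have k1 : (N * c) ^ (-1 + 2 * η₀) ≤ Δ * c := by
    calc (N * c) ^ (-1 + 2 * η₀) = N ^ (-1 + η) * N ^ (-(η - 2 * η₀)) * c ^ (-1 + 2 * η₀) := by
          rw [Real.mul_rpow hN.le hc0.le, ← Real.rpow_add hN]; congr 2; ring
      _ ≤ Δ * c ^ (2 - 2 * η₀) * c ^ (-1 + 2 * η₀) := by gcongr
      _ = Δ * c := by
          rw [mul_assoc, ← Real.rpow_add hc0]
          ring_nf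
          rw [Real.rpow_one]
  have k2 : Δ * c ≤ (N * c) ^ (-(2 * η₀)) := by
    calc Δ * c ≤ N ^ (-η) * c := by gcongr
      _ = N ^ (-(2 * η₀)) * N ^ (-(η - 2 * η₀)) * c := by
          rw [← Real.rpow_add hN]; congr 2; ring
      _ ≤ N ^ (-(2 * η₀)) * c ^ (-1 - 2 * η₀) * c := by gcongr
      _ = _ := by
          rw [Real.mul_rpow hN.le hc0.le, mul_assoc]
          congr 1
          nth_rw 2 [← Real.rpow_one c]
          rw [← Real.rpow_add hc0]; congr 1; ring
  have hY1 : Δ * c < 1 := k2.trans_lt (Real.rpow_lt_one_of_one_lt_of_neg m4 (by linarith))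
  obtain ⟨g1, g2⟩ := m3 _ k1 k2
  have hG : Gf (N * c) (Δ * c) (nrmz α) ≠ ⊤ := ne_top_of_le_ne_top ENNReal.ofReal_ne_top g2
  have hw : wt (nrmz α) * (N * c) * (Δ * c) = 4 * (N * Δ) := by rw [← hcw]; ring
  rw [hw] at g1 g2
  have g1' := (ENNReal.ofReal_le_iff_le_toReal hG).1 g1
  have hND : 0 < N * Δ := by positivity
  have g2' := ENNReal.toReal_le_of_le_ofReal (by positivity) g2
  rw [Gf_toReal, card_pairs h1 hα hD hY1] at g1' g2'
  push_cast at g1' g2'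
  unfold Pcorr
  rw [one_div_mul_eq_div, abs_le, neg_le_sub_iff_le_add, sub_le_iff_le_add, ← sub_le_iff_le_add,
    le_div_iff₀ hN, div_le_iff₀ hN]
  constructor <;> nlinarith

/-- **Theorem 1.** For every `η > 0` there is a null set `ℰ ⊆ 𝒟` such that for all
`α ∈ 𝒟 \ ℰ`, `P(α, N, [0,Δ]) = (1 + o(1))Δ` as `N → ∞`, uniformly in
`N^{-1+η} ≤ Δ ≤ N^{-η}`. -/
theorem small_gaps_tori (η : ℝ) (hη : 0 < η) :
    ∃ E : Set (ℝ × ℝ × ℝ), E ⊆ Dset ∧ hypMeasure E = 0 ∧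
      ∀ α ∈ Dset \ E, ∀ δ : ℝ, 0 < δ → ∃ N₀ : ℝ, ∀ N : ℝ, N₀ ≤ N →
        ∀ Δ : ℝ, N ^ (-1 + η) ≤ Δ → Δ ≤ N ^ (-η) →
          |Pcorr α N (Set.Icc 0 Δ) - Δ| ≤ δ * Δ := by
  set η₀ := min (η / 4) (1 / 8) with hη₀
  have hη₀0 : 0 < η₀ := lt_min (by linarith) (by norm_num)
  have hη₀η : 2 * η₀ < η := by linarith [min_le_left (η / 4) (1 / 8)]
  have hZ := mem_ae_iff.1 (ae_Gf_asymptotic hη₀0 (min_le_right (η / 4) (1 / 8)))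
  refine ⟨Dset ∩ {α | α.1 = 0 ∨ nrmz α ∈ _}, Set.inter_subset_left,
    measure_mono_null Set.inter_subset_right (hypMeasure_nrmz_null hZ), ?_⟩
  rintro α ⟨hα, hαE⟩ δ hδ
  have hgood := fun h => hαE ⟨hα, h⟩
  simp only [Set.mem_ofPred_eq, imp_false, not_or, Set.mem_compl_iff, not_not] at hgood
  obtain ⟨h0, hgood⟩ := hgood
  obtain ⟨a1, a2, a3⟩ := id hα
  have h1 : 0 < α.1 := lt_of_le_of_ne (a1.trans a2) (Ne.symm h0)
  exact Filter.eventually_atTop.1 (Pcorr_asymptotic hη₀0 hη₀η hα h1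
    (hgood (div_nonneg a1 h1.le) ((div_le_one h1).2 a2) ((one_le_div h1).2 a3)) hδ)
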